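/- arXiv:0708.0234 — 2 statements merged into one kernel-verified Lean document; each statement's English description precedes it below -/
import Mathlib

section
/- Let N ∈ ℕ and let C^A_{BC} (A,B,C = 1,…,N) be real constants, antisymmetric in the lower indices, such that the N×N matrices C_A with entries (C_A)^B_C = C^B_{AC} satisfy [C_A, C_B] = Σ_C C^C_{AB} C_C. Let γ = (γ_{AB}) be a real symmetric invertible N×N matrix (inverse γ^{AB}) satisfying γ_{AB} C^B_{CD} + γ_{DB} C^B_{CA} = 0. Let B = (B_{AB}) be a real antisymmetric N×N matrix satisfying Σ_A C^A_{BC} B_{AD} = 0 for all B, C, D, and set 𝓑 := γ^{−1}B. For k ∈ ℝ^N set C(k) := Σ_A k^A C_A, Y(k) := Σ_{j≥0} (−1)^j C(k)^j/(j+1)!, on U := {k : Y(k) invertible} define X_A{}^M(k) by Σ_M Y^B_M(k) X_A{}^M(k) = δ^B_A, and for smooth f define J_A[f] := Σ_M X_A{}^M ∂f/∂k^M − (1/2) Σ_B B_{AB} k^B f and J²[f] := Σ_{A,B} γ^{AB} J_A[J_B[f]]. Set sinhc(X) := Σ_{j≥0} X^{2j}/(2j+1)!, cosh(X) := Σ_{j≥0}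 X^{2j}/(2j)!, R_G := −(1/4) Σ_{A,B,C,D} γ^{AB} C^C_{AD} C^D_{BC}, and, for t > 0 with sinhc(t𝓑) invertible, Θ(t;k) := (1/2) Σ_{A,B,C} k^A γ_{AB} [cosh(t𝓑)·sinhc(t𝓑)^{−1}]^B_C k^C (i.e. Θ = (1/2)⟨k, γ·t𝓑coth(t𝓑)·k⟩). On the open set Ω of pairs (t,k) ∈ (0,∞) × U with sinhc(t𝓑) invertible and det sinhc(C(k)/2 + t𝓑) > 0, define Φ(t;k) := (4πt)^{−N/2} · (det sinhc(C(k)/2 + t𝓑))^{−1/2} · exp(−Θ(t;k)/(2t) + R_G t/6). Then Φ satisfies the heat equation ∂Φ/∂t (t;k) = J²[Φ(t;·)](k) for all (t,k) ∈ Ω. -/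
open Matrix

/-- The analytic matrix function `sinh(X)/X = Σ_{j≥0} X^{2j}/(2j+1)!`. -/
noncomputable def matSinhc {N : ℕ} (X : Matrix (Fin N) (Fin N) ℝ) : Matrix (Fin N) (Fin N) ℝ :=
  ∑' j : ℕ, ((1 : ℝ) / (Nat.factorial (2 * j + 1))) • X ^ (2 * j)

/-- The analytic matrix function `cosh(X) = Σ_{j≥0} X^{2j}/(2j)!`. -/
noncomputable def matCosh {N : ℕ} (X : Matrix (Fin N) (Fin N) ℝ) : Matrix (Fin N) (Fin N) ℝ :=
  ∑' j : ℕ, ((1 : ℝ) / (Nat.factorial (2 * j))) • X ^ (2 * j)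

/-- The covariant right-invariant vector field
`J_A[f] = Σ_M X_A{}^M ∂f/∂k^M − (1/2) Σ_B B_{AB} k^B f`. -/
noncomputable def covVecFieldOp {N : ℕ} (Xe : (Fin N → ℝ) → Fin N → Fin N → ℝ)
    (B : Matrix (Fin N) (Fin N) ℝ) (A : Fin N)
    (f : (Fin N → ℝ) → ℝ) (k : Fin N → ℝ) : ℝ :=
  (∑ M, Xe k A M * fderiv ℝ f k (Pi.single M 1)) - (1/2 : ℝ) * (∑ B', B A B' * k B') * f k

/-- The operator `J² = γ^{AB} J_A J_B`. -/
noncomputable def covCasimirOp {N : ℕ} (γinv : Matrix (Fin N) (Fin N) ℝ)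
    (Xe : (Fin N → ℝ) → Fin N → Fin N → ℝ) (B : Matrix (Fin N) (Fin N) ℝ)
    (f : (Fin N → ℝ) → ℝ) (k : Fin N → ℝ) : ℝ :=
  ∑ A, ∑ B', γinv A B' * covVecFieldOp Xe B A (covVecFieldOp Xe B B' f) k

open PowerSeries in
/-- Coefficients are dominated by those of `a * exp (r X)`. -/
def ExpBounded (φ : ℝ⟦X⟧) : Prop :=
  ∃ a r : ℝ, 0 ≤ a ∧ 0 ≤ r ∧ ∀ n, |coeff n φ| ≤ a * (r ^ n / n.factorial)

theorem sum_pow_mul_sub_mul_pow {A : Type*} [Ring A] (x w y : A) (n : ℕ) :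
    ∑ i ∈ Finset.range n, x ^ i * (x * w - w * y) * y ^ (n - 1 - i) = x ^ n * w - w * y ^ n := by
  have : ∀ i ∈ Finset.range n, x ^ i * (x * w - w * y) * y ^ (n - 1 - i)
      = x ^ (i + 1) * w * y ^ (n - (i + 1)) - x ^ i * w * y ^ (n - i) := by
    intro i hi
    have hi' := Finset.mem_range.1 hi
    have h1 : n - 1 - i = n - (i + 1) := by omega
    have h2 : n - i = n - (i + 1) + 1 := by omega
    rw [h1, h2, pow_succ, pow_succ']
    noncomm_ring
  rw [Finset.sum_congr rfl this, Finset.sum_range_sub (fun i => x ^ i * w * y ^ (n - i))]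
  simp

section PowerSeriesEval

variable {A : Type*} [Ring A] [Algebra ℝ A] [TopologicalSpace A]

/-- Evaluation of a real power series at an element of a topological algebra. -/
noncomputable def psEval (φ : PowerSeries ℝ) (x : A) : A :=
  ∑' n, PowerSeries.coeff n φ • x ^ n

/-- The noncommutative divided difference of a power series, with `v` inserted between the
powers of `x` and those of `y`. -/
noncomputable def psDivDiff (φ : PowerSeries ℝ) (x v y : A) : A :=
  ∑' n, PowerSeries.coeff n φ • ∑ i ∈ Finset.range n, x ^ i * v * y ^ (n - 1 - i)

theorem map_psEval {B F : Type*} [Ring B] [Algebra ℝ B] [TopologicalSpace B] [T2Space B]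
    [FunLike F A B] [AlgHomClass F ℝ A B] (f : F) (hf : Continuous f) {φ : PowerSeries ℝ} {x : A}
    (h : Summable fun n => PowerSeries.coeff n φ • x ^ n) :
    f (psEval φ x) = psEval φ (f x) := by
  rw [psEval, psEval, h.map_tsum f hf]
  simp

theorem map_psDivDiff {B F : Type*} [Ring B] [Algebra ℝ B] [TopologicalSpace B] [T2Space B]
    [FunLike F A B] [AlgHomClass F ℝ A B] (f : F) (hf : Continuous f) {φ : PowerSeries ℝ}
    {x v y : A} (h : Summable fun n => PowerSeries.coeff n φ •
      ∑ i ∈ Finset.range n, x ^ i * v * y ^ (n - 1 - i)) :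
    f (psDivDiff φ x v y) = psDivDiff φ (f x) (f v) (f y) := by
  rw [psDivDiff, psDivDiff, h.map_tsum f hf]
  simp

end PowerSeriesEval

section Banach

theorem norm_pow_le_mul {A : Type*} [NormedRing A] (x : A) (n : ℕ) :
    ‖x ^ n‖ ≤ (‖(1 : A)‖ + 1) * ‖x‖ ^ n := by
  rcases n.eq_zero_or_pos with rfl | hn
  · simp
  · refine (norm_pow_le' x hn).trans ?_
    have h1 := norm_nonneg (1 : A)
    have h2 := pow_nonneg (norm_nonneg x) n
    nlinarith

theorem ExpBounded.summable_bound {φ : PowerSeries ℝ} (h : ExpBounded φ) (r : ℝ) (hr : 0 ≤ r) :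
    Summable fun n => |PowerSeries.coeff n φ| * r ^ n := by
  obtain ⟨a, s, ha, hs, hb⟩ := h
  refine Summable.of_nonneg_of_le (fun n => by positivity) (fun n => ?_)
    ((Real.summable_pow_div_factorial (s * r)).mul_left a)
  calc _ ≤ a * (s ^ n / n.factorial) * r ^ n := by gcongr; exact hb n
    _ = _ := by rw [mul_pow]; ring

variable {A : Type*} [NormedRing A] [NormedAlgebra ℝ A]

theorem norm_coeff_smul_pow_le (φ : PowerSeries ℝ) (x : A) {r : ℝ} (hx : ‖x‖ ≤ r) (n : ℕ) :
    ‖PowerSeries.coeff n φ • x ^ n‖ ≤ (‖(1 : A)‖ + 1) * (|PowerSeries.coeff n φ| * r ^ n) := by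
  rw [norm_smul, Real.norm_eq_abs]
  calc _ ≤ |PowerSeries.coeff n φ| * ((‖(1 : A)‖ + 1) * r ^ n) := by
        gcongr
        exact (norm_pow_le_mul x n).trans (by gcongr)
    _ = _ := by ring

theorem summable_norm_psEval {φ : PowerSeries ℝ} (h : ExpBounded φ) (x : A) :
    Summable fun n => ‖PowerSeries.coeff n φ • x ^ n‖ :=
  Summable.of_nonneg_of_le (fun _ => norm_nonneg _) (norm_coeff_smul_pow_le φ x le_rfl)
    ((h.summable_bound _ (norm_nonneg x)).mul_left _)

/-- The divided difference of a power series as a continuous linear map of the inserted element. -/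
noncomputable def psDivDiffCLM (φ : PowerSeries ℝ) (x y : A) : A →L[ℝ] A :=
  ∑' n, PowerSeries.coeff n φ • ∑ i ∈ Finset.range n,
    (ContinuousLinearMap.mul ℝ A (x ^ i)).comp
      ((ContinuousLinearMap.mul ℝ A).flip (y ^ (n - 1 - i)))

theorem norm_psDivDiffCLM_term_le (φ : PowerSeries ℝ) (x y : A) {r : ℝ} (hr : 1 ≤ r)
    (hx : ‖x‖ ≤ r) (hy : ‖y‖ ≤ r) (n : ℕ) :
    ‖PowerSeries.coeff n φ • ∑ i ∈ Finset.range n, (ContinuousLinearMap.mul ℝ A (x ^ i)).comp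
      ((ContinuousLinearMap.mul ℝ A).flip (y ^ (n - 1 - i)))‖
      ≤ (‖(1 : A)‖ + 1) ^ 2 * (|PowerSeries.coeff n φ| * (2 * r) ^ n) := by
  rw [norm_smul, Real.norm_eq_abs]
  have h1 : ∀ i ∈ Finset.range n, ‖(ContinuousLinearMap.mul ℝ A (x ^ i)).comp
      ((ContinuousLinearMap.mul ℝ A).flip (y ^ (n - 1 - i)))‖ ≤ (‖(1 : A)‖ + 1) ^ 2 * r ^ n := by
    intro i hi
    have hi' := Finset.mem_range.1 hi
    refine (ContinuousLinearMap.opNorm_comp_le _ _).trans ?_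
    have ha : ‖ContinuousLinearMap.mul ℝ A (x ^ i)‖ ≤ (‖(1 : A)‖ + 1) * r ^ i :=
      (ContinuousLinearMap.opNorm_mul_apply_le ℝ A _).trans
        ((norm_pow_le_mul x i).trans (by gcongr))
    have hb : ‖(ContinuousLinearMap.mul ℝ A).flip (y ^ (n - 1 - i))‖
        ≤ (‖(1 : A)‖ + 1) * r ^ (n - 1 - i) := by
      refine ContinuousLinearMap.opNorm_le_bound _ (by positivity) fun v => ?_
      rw [ContinuousLinearMap.flip_apply, ContinuousLinearMap.mul_apply', mul_comm]
      refine (norm_mul_le _ _).trans ?_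
      gcongr
      exact (norm_pow_le_mul y _).trans (by gcongr)
    calc _ ≤ ((‖(1 : A)‖ + 1) * r ^ i) * ((‖(1 : A)‖ + 1) * r ^ (n - 1 - i)) := by gcongr
      _ = (‖(1 : A)‖ + 1) ^ 2 * r ^ (n - 1) := by
        have : r ^ (n - 1) = r ^ i * r ^ (n - 1 - i) := by rw [← pow_add]; congr 1; omega
        rw [this]; ring
      _ ≤ _ := by gcongr; omega
  have h2 : (n : ℝ) ≤ 2 ^ n := by exact_mod_cast Nat.lt_two_pow_self.le
  calc _ ≤ |PowerSeries.coeff n φ| * (n * ((‖(1 : A)‖ + 1) ^ 2 * r ^ n)) := by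
        gcongr
        refine (norm_sum_le_of_le _ h1).trans ?_
        simp
    _ ≤ |PowerSeries.coeff n φ| * (2 ^ n * ((‖(1 : A)‖ + 1) ^ 2 * r ^ n)) := by gcongr
    _ = _ := by rw [mul_pow]; ring

variable [CompleteSpace A]

theorem summable_psEval {φ : PowerSeries ℝ} (h : ExpBounded φ) (x : A) :
    Summable fun n => PowerSeries.coeff n φ • x ^ n :=
  (summable_norm_psEval h x).of_norm

theorem psEval_mul_of_banach {φ ψ : PowerSeries ℝ} (hφ : ExpBounded φ) (hψ : ExpBounded ψ) (x : A) :
    psEval (φ * ψ) x = psEval φ x * psEval ψ x := by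
  simp only [psEval]
  rw [tsum_mul_tsum_eq_tsum_sum_antidiagonal_of_summable_norm (summable_norm_psEval hφ x)
    (summable_norm_psEval hψ x)]
  refine tsum_congr fun n => ?_
  rw [PowerSeries.coeff_mul, Finset.sum_smul]
  refine Finset.sum_congr rfl fun p hp => ?_
  rw [smul_mul_smul_comm, ← pow_add, Finset.HasAntidiagonal.mem_antidiagonal.1 hp]

theorem summable_psEval_mul {φ ψ : PowerSeries ℝ} (hφ : ExpBounded φ) (hψ : ExpBounded ψ) (x : A) :
    Summable fun n => PowerSeries.coeff n (φ * ψ) • x ^ n := by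
  refine (summable_norm_sum_mul_antidiagonal_of_summable_norm (summable_norm_psEval hφ x)
    (summable_norm_psEval hψ x)).of_norm.congr fun n => Eq.symm ?_
  rw [PowerSeries.coeff_mul, Finset.sum_smul]
  refine Finset.sum_congr rfl fun p hp => ?_
  rw [smul_mul_smul_comm, ← pow_add, Finset.HasAntidiagonal.mem_antidiagonal.1 hp]

theorem continuous_psEval_of_banach {φ : PowerSeries ℝ} (h : ExpBounded φ) :
    Continuous (psEval φ : A → A) := by
  refine continuous_iff_continuousAt.2 fun x => ?_
  have : ContinuousOn (psEval φ : A → A) (Metric.ball 0 (‖x‖ + 1)) :=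
    continuousOn_tsum (fun n => by fun_prop)
      ((h.summable_bound (‖x‖ + 1) (by positivity)).mul_left (‖(1 : A)‖ + 1))
      fun n y hy => norm_coeff_smul_pow_le φ y (mem_ball_zero_iff.1 hy).le n
  exact this.continuousAt (Metric.isOpen_ball.mem_nhds (by simp))

theorem summable_psDivDiffCLM {φ : PowerSeries ℝ} (h : ExpBounded φ) (x y : A) :
    Summable fun n => PowerSeries.coeff n φ • ∑ i ∈ Finset.range n,
      (ContinuousLinearMap.mul ℝ A (x ^ i)).comp
        ((ContinuousLinearMap.mul ℝ A).flip (y ^ (n - 1 - i))) :=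
  Summable.of_norm_bounded
    ((h.summable_bound (2 * (‖x‖ + ‖y‖ + 1)) (by positivity)).mul_left ((‖(1 : A)‖ + 1) ^ 2))
    (norm_psDivDiffCLM_term_le φ x y (by linarith [norm_nonneg x, norm_nonneg y])
      (by linarith [norm_nonneg y]) (by linarith [norm_nonneg x]))

theorem continuous_psDivDiffCLM {φ : PowerSeries ℝ} (h : ExpBounded φ) :
    Continuous fun p : A × A => psDivDiffCLM φ p.1 p.2 := by
  refine continuous_iff_continuousAt.2 fun p => ?_
  have : ContinuousOn (fun p : A × A => psDivDiffCLM φ p.1 p.2) (Metric.ball 0 (‖p‖ + 1)) := by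
    refine continuousOn_tsum (fun n => Continuous.continuousOn ?_)
      ((h.summable_bound (2 * (‖p‖ + 1)) (by positivity)).mul_left ((‖(1 : A)‖ + 1) ^ 2))
      fun n q hq => ?_
    · have hs : Continuous fun q : A × A => ∑ i ∈ Finset.range n,
          (ContinuousLinearMap.mul ℝ A (q.1 ^ i)).comp
            ((ContinuousLinearMap.mul ℝ A).flip (q.2 ^ (n - 1 - i))) := by
        refine continuous_finsetSum _ fun i _ => Continuous.clm_comp ?_ ?_
        · exact (ContinuousLinearMap.mul ℝ A).continuous.comp (continuous_fst.pow i)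
        · exact (ContinuousLinearMap.mul ℝ A).flip.continuous.comp (continuous_snd.pow _)
      exact hs.const_smul (PowerSeries.coeff n φ)
    · have hq' := (mem_ball_zero_iff.1 hq).le
      exact norm_psDivDiffCLM_term_le φ q.1 q.2 (by linarith [norm_nonneg p])
        ((norm_fst_le q).trans hq') ((norm_snd_le q).trans hq') n
  exact this.continuousAt (Metric.isOpen_ball.mem_nhds (by simp))

theorem hasSum_psDivDiff {φ : PowerSeries ℝ} (h : ExpBounded φ) (x v y : A) :
    HasSum (fun n => PowerSeries.coeff n φ •
      ∑ i ∈ Finset.range n, x ^ i * v * y ^ (n - 1 - i)) (psDivDiffCLM φ x y v) := by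
  have := (ContinuousLinearMap.apply ℝ A v).hasSum (summable_psDivDiffCLM h x y).hasSum
  simpa [psDivDiffCLM, _root_.sum_apply, mul_assoc] using this

theorem psDivDiffCLM_apply {φ : PowerSeries ℝ} (h : ExpBounded φ) (x v y : A) :
    psDivDiffCLM φ x y v = psDivDiff φ x v y :=
  (hasSum_psDivDiff h x v y).tsum_eq.symm

theorem psDivDiff_comm_of_banach {φ : PowerSeries ℝ} (h : ExpBounded φ) (x w y : A) :
    psDivDiff φ x (x * w - w * y) y = psEval φ x * w - w * psEval φ y := by
  simp only [psDivDiff, psEval]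
  rw [← (summable_psEval h x).tsum_mul_right, ← (summable_psEval h y).tsum_mul_left,
    ← ((summable_psEval h x).mul_right w).tsum_sub ((summable_psEval h y).mul_left w)]
  refine tsum_congr fun n => ?_
  rw [sum_pow_mul_sub_mul_pow, smul_sub, smul_mul_assoc, mul_smul_comm]

theorem hasFDerivAt_psEval {φ : PowerSeries ℝ} (h : ExpBounded φ) (x : A) :
    HasFDerivAt (psEval φ : A → A) (psDivDiffCLM φ x x) x := by
  rw [hasFDerivAt_iff_isLittleO_nhds_zero]
  have hk : ∀ k, psEval φ (x + k) - psEval φ x - psDivDiffCLM φ x x k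
      = (psDivDiffCLM φ (x + k) x - psDivDiffCLM φ x x) k := by
    intro k
    have := psDivDiff_comm_of_banach h (x + k) 1 x
    simp only [mul_one, one_mul, add_sub_cancel_left] at this
    rw [← this, _root_.sub_apply, psDivDiffCLM_apply h (x + k)]
  simp only [hk]
  have hc : Filter.Tendsto (fun k => psDivDiffCLM φ (x + k) x - psDivDiffCLM φ x x)
      (nhds 0) (nhds 0) := by
    have h1 : Continuous fun k => psDivDiffCLM φ (x + k) x - psDivDiffCLM φ x x :=
      ((continuous_psDivDiffCLM h).comp (by fun_prop : Continuous fun k : A => (x + k, x))).sub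
        continuous_const
    simpa using h1.tendsto 0
  rw [Asymptotics.isLittleO_iff]
  intro c hc0
  filter_upwards [(Metric.tendsto_nhds.1 hc) c hc0] with k hk'
  rw [dist_zero_right] at hk'
  exact (ContinuousLinearMap.le_opNorm _ _).trans (by gcongr)

end Banach

section MatrixEval

variable {n : Type*} [Fintype n] [DecidableEq n]

theorem continuous_toEuclideanCLM :
    Continuous (toEuclideanCLM (n := n) (𝕜 := ℝ)).toAlgEquiv :=
  LinearMap.continuous_of_finiteDimensional
    (toEuclideanCLM (n := n) (𝕜 := ℝ)).toAlgEquiv.toLinearMap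

theorem continuous_toEuclideanCLM_symm :
    Continuous (toEuclideanCLM (n := n) (𝕜 := ℝ)).toAlgEquiv.symm :=
  LinearMap.continuous_of_finiteDimensional
    (toEuclideanCLM (n := n) (𝕜 := ℝ)).toAlgEquiv.symm.toLinearMap

theorem toEuclideanCLM_psEval {φ : PowerSeries ℝ} (h : ExpBounded φ) (X : Matrix n n ℝ) :
    psEval φ X = (toEuclideanCLM (n := n) (𝕜 := ℝ)).toAlgEquiv.symm
      (psEval φ ((toEuclideanCLM (n := n) (𝕜 := ℝ)).toAlgEquiv X)) := by
  rw [map_psEval _ continuous_toEuclideanCLM_symm (summable_psEval h _), AlgEquiv.symm_apply_apply]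

theorem toEuclideanCLM_psDivDiff {φ : PowerSeries ℝ} (h : ExpBounded φ) (X V Y : Matrix n n ℝ) :
    psDivDiff φ X V Y = (toEuclideanCLM (n := n) (𝕜 := ℝ)).toAlgEquiv.symm
      (psDivDiff φ ((toEuclideanCLM (n := n) (𝕜 := ℝ)).toAlgEquiv X)
        ((toEuclideanCLM (n := n) (𝕜 := ℝ)).toAlgEquiv V)
        ((toEuclideanCLM (n := n) (𝕜 := ℝ)).toAlgEquiv Y)) := by
  rw [map_psDivDiff _ continuous_toEuclideanCLM_symm (hasSum_psDivDiff h _ _ _).summable]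
  simp only [AlgEquiv.symm_apply_apply]

theorem Matrix.summable_psEval {φ : PowerSeries ℝ} (h : ExpBounded φ) (X : Matrix n n ℝ) :
    Summable fun j => PowerSeries.coeff j φ • X ^ j := by
  have := (_root_.summable_psEval h ((toEuclideanCLM (n := n) (𝕜 := ℝ)).toAlgEquiv X)).map
    (toEuclideanCLM (n := n) (𝕜 := ℝ)).toAlgEquiv.symm continuous_toEuclideanCLM_symm
  refine this.congr fun j => ?_
  simp only [Function.comp, map_smul, map_pow, AlgEquiv.symm_apply_apply]

theorem Matrix.hasSum_psDivDiff {φ : PowerSeries ℝ} (h : ExpBounded φ) (X V Y : Matrix n n ℝ) :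
    HasSum (fun j => PowerSeries.coeff j φ • ∑ i ∈ Finset.range j, X ^ i * V * Y ^ (j - 1 - i))
      (psDivDiff φ X V Y) := by
  have := (_root_.hasSum_psDivDiff h ((toEuclideanCLM (n := n) (𝕜 := ℝ)).toAlgEquiv X)
    ((toEuclideanCLM (n := n) (𝕜 := ℝ)).toAlgEquiv V)
    ((toEuclideanCLM (n := n) (𝕜 := ℝ)).toAlgEquiv Y)).map
    (toEuclideanCLM (n := n) (𝕜 := ℝ)).toAlgEquiv.symm continuous_toEuclideanCLM_symm
  refine Summable.hasSum (this.summable.congr fun j => ?_)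
  simp only [Function.comp, map_smul, map_pow, map_mul, map_sum, AlgEquiv.symm_apply_apply]

theorem psEval_mul {φ ψ : PowerSeries ℝ} (hφ : ExpBounded φ) (hψ : ExpBounded ψ)
    (X : Matrix n n ℝ) : psEval (φ * ψ) X = psEval φ X * psEval ψ X := by
  have hs := psEval_mul_of_banach hφ hψ ((toEuclideanCLM (n := n) (𝕜 := ℝ)).toAlgEquiv X)
  rw [toEuclideanCLM_psEval hφ, toEuclideanCLM_psEval hψ, ← map_mul, ← hs,
    map_psEval _ continuous_toEuclideanCLM_symm (summable_psEval_mul hφ hψ _),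
    AlgEquiv.symm_apply_apply]

theorem psEval_add {φ ψ : PowerSeries ℝ} (hφ : ExpBounded φ) (hψ : ExpBounded ψ)
    (X : Matrix n n ℝ) : psEval (φ + ψ) X = psEval φ X + psEval ψ X := by
  simp only [psEval, map_add, add_smul]
  exact (Matrix.summable_psEval hφ X).tsum_add (Matrix.summable_psEval hψ X)

theorem psEval_X (X : Matrix n n ℝ) : psEval PowerSeries.X X = X := by
  rw [psEval, tsum_eq_single 1]
  · simp
  · intro _ hj
    simp [PowerSeries.coeff_X, hj]

theorem psEval_smul (φ : PowerSeries ℝ) (a : ℝ) (X : Matrix n n ℝ) :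
    psEval φ (a • X) = psEval (PowerSeries.rescale a φ) X := by
  simp only [psEval, PowerSeries.coeff_rescale, smul_pow, smul_smul]
  exact tsum_congr fun j => by rw [mul_comm]

theorem psEval_transpose (φ : PowerSeries ℝ) (X : Matrix n n ℝ) :
    psEval φ Xᵀ = (psEval φ X)ᵀ := by
  simp only [psEval, Matrix.transpose_tsum, transpose_smul, transpose_pow]

theorem psDivDiff_comm {φ : PowerSeries ℝ} (h : ExpBounded φ) (X W Y : Matrix n n ℝ) :
    psDivDiff φ X (X * W - W * Y) Y = psEval φ X * W - W * psEval φ Y := by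
  rw [toEuclideanCLM_psDivDiff h, toEuclideanCLM_psEval h, toEuclideanCLM_psEval h]
  simp only [map_sub, map_mul]
  rw [psDivDiff_comm_of_banach h, map_sub, map_mul, map_mul]
  simp only [AlgEquiv.symm_apply_apply]

theorem psEval_mul_eq_mul_psEval {φ : PowerSeries ℝ} (h : ExpBounded φ) {X W Y : Matrix n n ℝ}
    (hW : X * W = W * Y) : psEval φ X * W = W * psEval φ Y := by
  rw [← sub_eq_zero, ← psDivDiff_comm h, hW, sub_self]
  simp [psDivDiff]

theorem commute_psEval (φ : PowerSeries ℝ) {X W : Matrix n n ℝ}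
    (hW : Commute W X) : Commute W (psEval φ X) :=
  Commute.tsum_right _ fun j => (hW.pow_right j).smul_right _

theorem commute_psDivDiff (φ : PowerSeries ℝ) {X V Y W : Matrix n n ℝ}
    (hX : Commute W X) (hV : Commute W V) (hY : Commute W Y) : Commute W (psDivDiff φ X V Y) :=
  Commute.tsum_right _ fun _ => (Commute.sum_right _ _ _ fun i _ =>
    ((hX.pow_right i).mul_right hV).mul_right (hY.pow_right _)).smul_right _

theorem continuous_psEval {φ : PowerSeries ℝ} (h : ExpBounded φ) :
    Continuous (psEval φ : Matrix n n ℝ → Matrix n n ℝ) := by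
  rw [funext (toEuclideanCLM_psEval h)]
  exact continuous_toEuclideanCLM_symm.comp
    ((continuous_psEval_of_banach h).comp continuous_toEuclideanCLM)

theorem continuous_psDivDiff {φ : PowerSeries ℝ} (h : ExpBounded φ) (V : Matrix n n ℝ) :
    Continuous fun p : Matrix n n ℝ × Matrix n n ℝ => psDivDiff φ p.1 V p.2 := by
  have := (((continuous_psDivDiffCLM h).clm_apply
    (continuous_const (y := (toEuclideanCLM (n := n) (𝕜 := ℝ)).toAlgEquiv V))).comp
      ((continuous_toEuclideanCLM.comp continuous_fst).prodMk
        (continuous_toEuclideanCLM.comp continuous_snd)))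
  refine (continuous_toEuclideanCLM_symm.comp this).congr fun p => ?_
  simp only [Function.comp, psDivDiffCLM_apply h]
  exact (toEuclideanCLM_psDivDiff h _ _ _).symm

theorem psEval_exp (X : Matrix n n ℝ) : psEval (PowerSeries.exp ℝ) X = NormedSpace.exp X := by
  rw [NormedSpace.exp_eq_tsum ℝ]
  simp [psEval, PowerSeries.coeff_exp]

theorem psEval_exp_add {X Y : Matrix n n ℝ} (h : Commute X Y) :
    psEval (PowerSeries.exp ℝ) (X + Y)
      = psEval (PowerSeries.exp ℝ) X * psEval (PowerSeries.exp ℝ) Y := by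
  simp only [psEval_exp, Matrix.exp_add_of_commute X Y h]

end MatrixEval

section Trace

theorem hasSum_trace_mul {n : Type*} [Fintype n] {f : ℕ → Matrix n n ℝ} {a : Matrix n n ℝ}
    (h : HasSum f a)
    (T : Matrix n n ℝ) : HasSum (fun j => (T * f j).trace) (T * a).trace :=
  (h.mul_left T).map (traceAddMonoidHom n ℝ)
    (continuous_id.matrix_trace)

variable {n : Type*} [Fintype n] [DecidableEq n]

/-- Under a trace against a commuting matrix, a divided difference becomes a derivative. -/
theorem trace_mul_psDivDiff {φ : PowerSeries ℝ} (h : ExpBounded φ)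
    (h' : ExpBounded (PowerSeries.derivative ℝ φ)) {T X : Matrix n n ℝ} (hT : Commute T X)
    (V : Matrix n n ℝ) :
    (T * psDivDiff φ X V X).trace = (T * psEval (PowerSeries.derivative ℝ φ) X * V).trace := by
  have h1 := hasSum_trace_mul (Matrix.hasSum_psDivDiff h X V X) T
  have h2 := hasSum_trace_mul ((Matrix.summable_psEval h' X).hasSum.mul_right V) T
  rw [← hasSum_nat_add_iff' 1, Finset.sum_range_one, Finset.range_zero, Finset.sum_empty,
    smul_zero, mul_zero, trace_zero, sub_zero] at h1
  rw [mul_assoc]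
  refine HasSum.unique (h1.congr_fun fun j => ?_) h2
  have hterm : ∀ i ∈ Finset.range (j + 1), (T * (X ^ i * V * X ^ (j + 1 - 1 - i))).trace
      = (T * (X ^ j * V)).trace := by
    intro i hi
    have hi' := Finset.mem_range.1 hi
    have : X ^ j = X ^ (j + 1 - 1 - i) * X ^ i := by rw [← pow_add]; congr 1; omega
    rw [this, ← mul_assoc, trace_mul_comm, ← mul_assoc, (hT.pow_right _).symm.eq]
    simp only [mul_assoc]
  rw [PowerSeries.coeff_derivative, mul_smul_comm, trace_smul, Finset.mul_sum, trace_sum,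
    Finset.sum_congr rfl hterm, smul_mul_assoc, mul_smul_comm, trace_smul]
  simp only [Finset.sum_const, Finset.card_range, nsmul_eq_mul, smul_eq_mul]
  push_cast
  ring

/-- The divided difference along a commuting direction. -/
theorem psDivDiff_eq_of_commute (φ : PowerSeries ℝ) {X V : Matrix n n ℝ}
    (h' : ExpBounded (PowerSeries.derivative ℝ φ)) (h : ExpBounded φ) (hV : Commute V X) :
    psDivDiff φ X V X = psEval (PowerSeries.derivative ℝ φ) X * V := by
  have h1 := Matrix.hasSum_psDivDiff h X V X
  have h2 := (Matrix.summable_psEval h' X).hasSum.mul_right V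
  rw [← hasSum_nat_add_iff' 1, Finset.sum_range_one, Finset.range_zero, Finset.sum_empty,
    smul_zero, sub_zero] at h1
  refine HasSum.unique (h1.congr_fun fun j => ?_) h2
  have hterm : ∀ i ∈ Finset.range (j + 1), X ^ i * V * X ^ (j + 1 - 1 - i) = X ^ j * V := by
    intro i hi
    have hi' := Finset.mem_range.1 hi
    have : X ^ j = X ^ i * X ^ (j + 1 - 1 - i) := by rw [← pow_add]; congr 1; omega
    rw [this, mul_assoc, mul_assoc, (hV.pow_right _).eq]
  rw [PowerSeries.coeff_derivative, Finset.sum_congr rfl hterm, smul_mul_assoc, Finset.sum_const,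
    Finset.card_range, ← Nat.cast_smul_eq_nsmul ℝ, smul_smul]
  push_cast
  rfl

end Trace

section Derivatives

variable {n : Type*} [Fintype n] [DecidableEq n]

theorem toEuclideanCLM_symm_inverse (z : EuclideanSpace ℝ n →L[ℝ] EuclideanSpace ℝ n) :
    (toEuclideanCLM (n := n) (𝕜 := ℝ)).toAlgEquiv.symm (Ring.inverse z)
      = ((toEuclideanCLM (n := n) (𝕜 := ℝ)).toAlgEquiv.symm z)⁻¹ := by
  by_cases h : IsUnit z
  · refine (Matrix.inv_eq_right_inv ?_).symm
    rw [← map_mul, Ring.mul_inverse_cancel _ h, map_one]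
  · rw [Ring.inverse_non_unit _ h, map_zero, Matrix.nonsing_inv_eq_ringInverse,
      Ring.inverse_non_unit]
    rwa [MulEquiv.isUnit_map]

theorem commute_matrix_inv {A M : Matrix n n ℝ} (h : Commute A M) : Commute A M⁻¹ := by
  by_cases hM : IsUnit M
  · obtain ⟨u, rfl⟩ := hM
    rw [← Matrix.coe_units_inv]
    exact h.units_inv_right
  · rw [Matrix.nonsing_inv_eq_ringInverse, Ring.inverse_non_unit _ hM]
    exact Commute.zero_right A

theorem commute_psEval_psEval (φ ψ : PowerSeries ℝ) (X : Matrix n n ℝ) :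
    Commute (psEval φ X) (psEval ψ X) :=
  commute_psEval ψ (commute_psEval φ (Commute.refl X)).symm

variable {E : Type*} [NormedAddCommGroup E] [NormedSpace ℝ E] [FiniteDimensional ℝ E]

theorem hasFDerivAt_trace_inv_psEval_mul_psEval {φ ψ : PowerSeries ℝ} (hφ : ExpBounded φ)
    (hψ : ExpBounded ψ) (L : E →ₗ[ℝ] Matrix n n ℝ) (M : Matrix n n ℝ) {k : E}
    (hk : IsUnit (psEval ψ (L k))) :
    ∃ D : E →L[ℝ] ℝ,
      HasFDerivAt (fun k => ((psEval ψ (L k))⁻¹ * psEval φ (L k) * M).trace) D k ∧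
      ∀ v, D v = (((psEval ψ (L k))⁻¹ * psDivDiff φ (L k) (L v) (L k)
        - (psEval ψ (L k))⁻¹ * psDivDiff ψ (L k) (L v) (L k)
          * ((psEval ψ (L k))⁻¹ * psEval φ (L k))) * M).trace := by
  set e := (toEuclideanCLM (n := n) (𝕜 := ℝ)).toAlgEquiv with he
  have hu : IsUnit (psEval ψ (e (L k))) := by
    rw [toEuclideanCLM_psEval hψ, MulEquiv.isUnit_map] at hk
    exact hk
  obtain ⟨u, hu⟩ := hu
  have huinv : (↑u⁻¹ : EuclideanSpace ℝ n →L[ℝ] EuclideanSpace ℝ n)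
      = Ring.inverse (psEval ψ (e (L k))) := by rw [← hu, Ring.inverse_unit]
  let a : E →L[ℝ] (EuclideanSpace ℝ n →L[ℝ] EuclideanSpace ℝ n) :=
    (e.toLinearMap ∘ₗ L).toContinuousLinearMap
  have ha : ∀ v, a v = e (L v) := fun v => rfl
  let l : (EuclideanSpace ℝ n →L[ℝ] EuclideanSpace ℝ n) →L[ℝ] ℝ :=
    (traceLinearMap n ℝ ℝ ∘ₗ (LinearMap.mulRight ℝ M) ∘ₗ e.symm.toLinearMap).toContinuousLinearMap
  have hl : ∀ z, l z = (e.symm z * M).trace := fun z => rfl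
  have h1 : HasFDerivAt (fun k => psEval φ (a k)) _ k :=
    (hasFDerivAt_psEval hφ (a k)).comp k a.hasFDerivAt
  have h2 : HasFDerivAt (fun k => psEval ψ (a k)) _ k :=
    (hasFDerivAt_psEval hψ (a k)).comp k a.hasFDerivAt
  have h3 := (hasFDerivAt_ringInverse (𝕜 := ℝ) u)
  rw [hu] at h3
  have h4 : HasFDerivAt (fun k => Ring.inverse (psEval ψ (a k))) _ k :=
    HasFDerivAt.comp (g := Ring.inverse) (f := fun k => psEval ψ (a k)) k h3 h2
  have h5 := l.hasFDerivAt.comp k (h4.mul' h1)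
  refine ⟨_, h5.congr_of_eventuallyEq (Filter.Eventually.of_forall fun k' => ?_), fun v => ?_⟩
  · simp only [Function.comp, Pi.mul_apply, hl, map_mul]
    rw [toEuclideanCLM_symm_inverse, ha, ← toEuclideanCLM_psEval hφ, ← toEuclideanCLM_psEval hψ]
  · simp only [ContinuousLinearMap.comp_apply, hl]
    congr 2
    simp only [_root_.add_apply, _root_.smul_apply, ContinuousLinearMap.comp_apply,
      _root_.neg_apply,
      ContinuousLinearMap.mulLeftRight_apply, psDivDiffCLM_apply hφ, psDivDiffCLM_apply hψ, ha,
      huinv, smul_eq_mul, MulOpposite.smul_eq_mul_unop, MulOpposite.unop_op, map_add, map_mul,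
      map_neg]
    rw [toEuclideanCLM_symm_inverse, ← toEuclideanCLM_psEval hφ, ← toEuclideanCLM_psEval hψ,
      ← toEuclideanCLM_psDivDiff hφ, ← toEuclideanCLM_psDivDiff hψ]
    noncomm_ring

theorem hasDerivAt_det_add_smul {M : Matrix n n ℝ} (hM : IsUnit M) (V : Matrix n n ℝ) :
    HasDerivAt (fun ε : ℝ => (M + ε • V).det) (M.det * (M⁻¹ * V).trace) 0 := by
  obtain ⟨p, hp⟩ : ∃ p : Polynomial ℝ, ∀ ε : ℝ, (1 + ε • (M⁻¹ * V)).det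
      = 1 + (M⁻¹ * V).trace * ε + p.eval ε * ε ^ 2 := ⟨_, fun ε => det_one_add_smul ε _⟩
  have h1 : (fun ε : ℝ => (M + ε • V).det)
      = fun ε : ℝ => M.det * (1 + (M⁻¹ * V).trace * ε + p.eval ε * ε ^ 2) := by
    funext ε
    rw [← hp, ← det_mul, mul_add, mul_one, mul_smul_comm, ← mul_assoc,
      mul_nonsing_inv _ ((isUnit_iff_isUnit_det _).1 hM), one_mul]
  rw [h1]
  have h2 := ((((hasDerivAt_id (0 : ℝ)).const_mul (M⁻¹ * V).trace).const_add 1).add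
    ((p.hasDerivAt 0).mul (hasDerivAt_pow 2 (0 : ℝ)))).const_mul M.det
  simpa using h2

theorem differentiable_det : Differentiable ℝ fun M : n → n → ℝ => det (of M) := by
  simp only [det_apply, of_apply]
  fun_prop

theorem hasFDerivAt_det {M : Matrix n n ℝ} (hM : IsUnit M) :
    ∃ D : (n → n → ℝ) →L[ℝ] ℝ, HasFDerivAt (fun M : n → n → ℝ => det (of M)) D (of.symm M) ∧
      ∀ V : Matrix n n ℝ, D (of.symm V) = M.det * (M⁻¹ * V).trace := by
  refine ⟨_, (differentiable_det (of.symm M)).hasFDerivAt, fun V => ?_⟩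
  have h1 : HasDerivAt (fun ε : ℝ => of.symm M + ε • of.symm V) (of.symm V) 0 := by
    simpa using ((hasDerivAt_id (0 : ℝ)).smul_const (of.symm V)).const_add (of.symm M)
  have h2 := HasFDerivAt.comp_hasDerivAt_of_eq (0 : ℝ)
    (differentiable_det (of.symm M)).hasFDerivAt h1 (by simp)
  exact h2.unique (hasDerivAt_det_add_smul hM V)

theorem hasFDerivAt_det_psEval {ψ : PowerSeries ℝ} (hψ : ExpBounded ψ)
    (hψ' : ExpBounded (PowerSeries.derivative ℝ ψ)) (L : E →ₗ[ℝ] Matrix n n ℝ) {k : E}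
    (hk : IsUnit (psEval ψ (L k))) :
    ∃ D : E →L[ℝ] ℝ, HasFDerivAt (fun k => (psEval ψ (L k)).det) D k ∧
      ∀ v, D v = (psEval ψ (L k)).det * ((psEval (PowerSeries.derivative ℝ ψ) (L k)
        * (psEval ψ (L k))⁻¹) * L v).trace := by
  set e := (toEuclideanCLM (n := n) (𝕜 := ℝ)).toAlgEquiv with he
  let a : E →L[ℝ] (EuclideanSpace ℝ n →L[ℝ] EuclideanSpace ℝ n) :=
    (e.toLinearMap ∘ₗ L).toContinuousLinearMap
  have ha : ∀ v, a v = e (L v) := fun v => rfl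
  let l : (EuclideanSpace ℝ n →L[ℝ] EuclideanSpace ℝ n) →L[ℝ] (n → n → ℝ) :=
    (e.symm.toLinearMap : _ →ₗ[ℝ] Matrix n n ℝ).toContinuousLinearMap
  have hl : ∀ z, l z = of.symm (e.symm z) := fun z => rfl
  have h1 : HasFDerivAt (fun k => psEval ψ (a k)) _ k :=
    (hasFDerivAt_psEval hψ (a k)).comp k a.hasFDerivAt
  have h2 := l.hasFDerivAt.comp k h1
  obtain ⟨D, hD, hDv⟩ := hasFDerivAt_det hk
  have h0 : of.symm (psEval ψ (L k)) = (l ∘ fun k => psEval ψ (a k)) k := by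
    simp only [Function.comp, hl, ha]
    rw [← toEuclideanCLM_psEval hψ]
  rw [h0] at hD
  have h3 := hD.comp k h2
  refine ⟨_, h3.congr_of_eventuallyEq (Filter.Eventually.of_forall fun k' => ?_), fun v => ?_⟩
  · simp only [Function.comp, hl, ha]
    rw [← toEuclideanCLM_psEval hψ]
    rfl
  · simp only [ContinuousLinearMap.comp_apply, hl, hDv, ha, psDivDiffCLM_apply hψ]
    rw [← toEuclideanCLM_psDivDiff hψ, trace_mul_psDivDiff hψ hψ']
    · rw [(commute_matrix_inv (commute_psEval_psEval _ _ _)).eq]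
    · exact (commute_matrix_inv (commute_psEval ψ (Commute.refl (L k)))).symm

end Derivatives

section Series

/-- The power series of `sinh x / x`. -/
noncomputable def sinhcSeries : PowerSeries ℝ :=
  PowerSeries.mk fun n => if Even n then 1 / ((n + 1).factorial : ℝ) else 0

/-- The power series of `cosh x`. -/
noncomputable def coshSeries : PowerSeries ℝ :=
  PowerSeries.mk fun n => if Even n then 1 / (n.factorial : ℝ) else 0

/-- The power series of `(1 - exp (-x)) / x`. -/
noncomputable def oneSubExpNegSeries : PowerSeries ℝ :=
  PowerSeries.mk fun n => (-1 : ℝ) ^ n / ((n + 1).factorial : ℝ)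

theorem expBounded_of_abs_le {φ : PowerSeries ℝ}
    (h : ∀ n, |PowerSeries.coeff n φ| ≤ 1 / (n.factorial : ℝ)) : ExpBounded φ :=
  ⟨1, 1, zero_le_one, zero_le_one, fun n => by simpa using h n⟩

theorem ExpBounded.derivative {φ : PowerSeries ℝ} (h : ExpBounded φ) :
    ExpBounded (PowerSeries.derivative ℝ φ) := by
  obtain ⟨a, r, ha, hr, hb⟩ := h
  refine ⟨a * r, r, by positivity, hr, fun n => ?_⟩
  rw [PowerSeries.coeff_derivative, abs_mul, abs_of_nonneg (by positivity : (0 : ℝ) ≤ n + 1)]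
  calc _ ≤ a * (r ^ (n + 1) / (n + 1).factorial) * (n + 1) := by gcongr; exact hb _
    _ = _ := by
      rw [Nat.factorial_succ]
      push_cast
      field_simp
      ring

theorem ExpBounded.rescale {φ : PowerSeries ℝ} (h : ExpBounded φ) (c : ℝ) :
    ExpBounded (PowerSeries.rescale c φ) := by
  obtain ⟨a, r, ha, hr, hb⟩ := h
  refine ⟨a, |c| * r, ha, by positivity, fun n => ?_⟩
  rw [PowerSeries.coeff_rescale, abs_mul, abs_pow, mul_pow]
  calc _ ≤ |c| ^ n * (a * (r ^ n / n.factorial)) := by gcongr; exact hb _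
    _ = _ := by ring

theorem expBounded_X : ExpBounded PowerSeries.X := by
  refine expBounded_of_abs_le fun n => ?_
  rw [PowerSeries.coeff_X]
  split_ifs with h
  · simp [h]
  · simp only [abs_zero]; positivity

theorem one_div_factorial_succ_le (n : ℕ) :
    1 / ((n + 1).factorial : ℝ) ≤ 1 / (n.factorial : ℝ) := by
  gcongr
  omega

theorem expBounded_sinhcSeries : ExpBounded sinhcSeries := by
  refine expBounded_of_abs_le fun n => ?_
  rw [sinhcSeries, PowerSeries.coeff_mk]
  split_ifs with h
  · rw [abs_of_nonneg (by positivity)]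
    exact one_div_factorial_succ_le n
  · simp only [abs_zero]; positivity

theorem expBounded_coshSeries : ExpBounded coshSeries := by
  refine expBounded_of_abs_le fun n => ?_
  rw [coshSeries, PowerSeries.coeff_mk]
  split_ifs with h
  · rw [abs_of_nonneg (by positivity)]
  · simp only [abs_zero]; positivity

theorem expBounded_oneSubExpNegSeries : ExpBounded oneSubExpNegSeries := by
  refine expBounded_of_abs_le fun n => ?_
  rw [oneSubExpNegSeries, PowerSeries.coeff_mk, abs_div, abs_pow, abs_neg, abs_one, one_pow,
    abs_of_nonneg (by positivity : (0 : ℝ) ≤ ((n + 1).factorial : ℝ))]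
  exact one_div_factorial_succ_le n

theorem expBounded_exp : ExpBounded (PowerSeries.exp ℝ) := by
  refine expBounded_of_abs_le fun n => ?_
  rw [PowerSeries.coeff_exp]
  simp

theorem expBounded_X_mul_sinhcSeries : ExpBounded (PowerSeries.X * sinhcSeries) := by
  refine expBounded_of_abs_le fun n => ?_
  cases n with
  | zero => simp
  | succ n =>
    rw [PowerSeries.coeff_succ_X_mul, sinhcSeries, PowerSeries.coeff_mk]
    split_ifs with h
    · rw [abs_of_nonneg (by positivity)]
    · simp only [abs_zero]; positivity

theorem coshSeries_eq :
    coshSeries = sinhcSeries + PowerSeries.X * PowerSeries.derivative ℝ sinhcSeries := by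
  ext n
  cases n with
  | zero => simp [coshSeries, sinhcSeries]
  | succ n =>
    rw [map_add, PowerSeries.coeff_succ_X_mul, PowerSeries.coeff_derivative, coshSeries,
      sinhcSeries, PowerSeries.coeff_mk, PowerSeries.coeff_mk]
    split_ifs with h
    · rw [Nat.factorial_succ (n + 1)]
      push_cast
      field_simp
      ring
    · simp

theorem expBounded_X_mul_derivative_sinhcSeries :
    ExpBounded (PowerSeries.X * PowerSeries.derivative ℝ sinhcSeries) := by
  refine expBounded_of_abs_le fun n => ?_
  have h1 : PowerSeries.X * PowerSeries.derivative ℝ sinhcSeries = coshSeries - sinhcSeries := by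
    rw [coshSeries_eq]; ring
  rw [h1, map_sub, coshSeries, sinhcSeries, PowerSeries.coeff_mk, PowerSeries.coeff_mk]
  have h2 := one_div_factorial_succ_le n
  have h3 : 0 ≤ 1 / ((n + 1).factorial : ℝ) := by positivity
  split_ifs with h
  · rw [abs_of_nonneg (by linarith)]
    linarith
  · simp only [sub_zero, abs_zero]; positivity

theorem derivative_coshSeries :
    PowerSeries.derivative ℝ coshSeries = PowerSeries.X * sinhcSeries := by
  ext n
  rw [PowerSeries.coeff_derivative, coshSeries, PowerSeries.coeff_mk]
  cases n with
  | zero => simp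
  | succ n =>
    rw [PowerSeries.coeff_succ_X_mul, sinhcSeries, PowerSeries.coeff_mk]
    have : Even (n + 1 + 1) ↔ Even n := by simp [Nat.even_add_one]
    simp only [this]
    split_ifs with h
    · rw [Nat.factorial_succ (n + 1)]
      push_cast
      field_simp
    · simp

theorem exp_eq_coshSeries_add : PowerSeries.exp ℝ = coshSeries + PowerSeries.X * sinhcSeries := by
  ext n
  rw [map_add, PowerSeries.coeff_exp, coshSeries, PowerSeries.coeff_mk]
  cases n with
  | zero => simp
  | succ n =>
    rw [PowerSeries.coeff_succ_X_mul, sinhcSeries, PowerSeries.coeff_mk]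
    by_cases h : Even n
    · have : ¬ Even (n + 1) := by simpa [Nat.even_add_one] using h
      simp [h, this]
    · have : Even (n + 1) := by simpa [Nat.even_add_one] using h
      simp [h, this]

theorem rescale_neg_one_coshSeries : PowerSeries.rescale (-1) coshSeries = coshSeries := by
  ext n
  rw [PowerSeries.coeff_rescale, coshSeries, PowerSeries.coeff_mk]
  split_ifs with h
  · rw [h.neg_one_pow, one_mul]
  · simp

theorem rescale_neg_one_sinhcSeries : PowerSeries.rescale (-1) sinhcSeries = sinhcSeries := by
  ext n
  rw [PowerSeries.coeff_rescale, sinhcSeries, PowerSeries.coeff_mk]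
  split_ifs with h
  · rw [h.neg_one_pow, one_mul]
  · simp

theorem rescale_neg_one_derivative_sinhcSeries :
    PowerSeries.rescale (-1) (PowerSeries.derivative ℝ sinhcSeries)
      = -PowerSeries.derivative ℝ sinhcSeries := by
  ext n
  rw [PowerSeries.coeff_rescale, map_neg, PowerSeries.coeff_derivative, sinhcSeries,
    PowerSeries.coeff_mk]
  split_ifs with h
  · have : Odd n := by
      rw [Nat.even_add_one] at h
      exact Nat.not_even_iff_odd.1 h
    rw [this.neg_one_pow]
    ring
  · simp

theorem rescale_neg_one_exp_mul_exp :
    PowerSeries.rescale (-1) (PowerSeries.exp ℝ) * PowerSeries.exp ℝ = 1 := by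
  rw [mul_comm]
  exact PowerSeries.exp_mul_exp_neg_eq_one

theorem X_mul_oneSubExpNegSeries :
    PowerSeries.X * oneSubExpNegSeries = 1 - PowerSeries.rescale (-1) (PowerSeries.exp ℝ) := by
  ext n
  rw [map_sub, PowerSeries.coeff_rescale, PowerSeries.coeff_exp, PowerSeries.coeff_one]
  cases n with
  | zero => simp
  | succ n =>
    rw [PowerSeries.coeff_succ_X_mul, oneSubExpNegSeries, PowerSeries.coeff_mk]
    simp [pow_succ]
    ring

theorem rescale_two_oneSubExpNegSeries_mul_exp :
    PowerSeries.rescale 2 oneSubExpNegSeries * PowerSeries.exp ℝ = sinhcSeries := by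
  have h1 := congrArg (PowerSeries.rescale (2 : ℝ)) X_mul_oneSubExpNegSeries
  have h2 : PowerSeries.rescale (2 : ℝ) (PowerSeries.rescale (-1) (PowerSeries.exp ℝ))
      = PowerSeries.rescale (-1) (PowerSeries.exp ℝ) ^ 2 := by
    rw [← map_pow, PowerSeries.exp_pow_eq_rescale_exp, PowerSeries.rescale_rescale,
      PowerSeries.rescale_rescale, mul_comm]
    norm_num
  have h3 : PowerSeries.rescale (-1) (PowerSeries.exp ℝ)
      = coshSeries - PowerSeries.X * sinhcSeries := by
    rw [exp_eq_coshSeries_add, map_add, map_mul, rescale_neg_one_coshSeries,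
      rescale_neg_one_sinhcSeries, PowerSeries.rescale_neg_one_X]
    ring
  have h4 := rescale_neg_one_exp_mul_exp
  rw [map_mul, map_sub, map_one, h2, PowerSeries.rescale_X] at h1
  have h5 : PowerSeries.C (2 : ℝ) = 2 := map_ofNat _ 2
  have h6 : (2 * PowerSeries.X : PowerSeries ℝ) ≠ 0 := by
    refine mul_ne_zero ?_ PowerSeries.X_ne_zero
    rw [← h5]
    exact (map_ne_zero_iff _ PowerSeries.C_injective).2 two_ne_zero
  refine mul_left_cancel₀ h6 ?_
  rw [h5] at h1
  have h7 := exp_eq_coshSeries_add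
  linear_combination PowerSeries.exp ℝ * h1
    - PowerSeries.rescale (-1) (PowerSeries.exp ℝ) * h4 - h3 + h7

end Series

section HyperbolicMatrices

variable {n : Type*} [Fintype n] [DecidableEq n]

/-- The matrix function `sinh X / X`. -/
noncomputable abbrev sinhcM (X : Matrix n n ℝ) : Matrix n n ℝ := psEval sinhcSeries X

/-- The derivative of `sinh X / X` as a matrix function. -/
noncomputable abbrev dsinhcM (X : Matrix n n ℝ) : Matrix n n ℝ :=
  psEval (PowerSeries.derivative ℝ sinhcSeries) X

/-- The matrix function `cosh X`. -/
noncomputable abbrev coshM (X : Matrix n n ℝ) : Matrix n n ℝ := psEval coshSeries X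

/-- The matrix exponential as a power series evaluation. -/
noncomputable abbrev expM (X : Matrix n n ℝ) : Matrix n n ℝ := psEval (PowerSeries.exp ℝ) X

theorem matSinhc_eq {N : ℕ} (X : Matrix (Fin N) (Fin N) ℝ) : matSinhc X = sinhcM X := by
  have hinj : Function.Injective fun j : ℕ => 2 * j := fun a b h => by simpa using h
  have hs : Function.support (fun j => PowerSeries.coeff j sinhcSeries • X ^ j)
      ⊆ Set.range fun j : ℕ => 2 * j := by
    intro j hj
    by_contra h
    have : ¬ Even j := fun ⟨i, hi⟩ => h ⟨i, by simp [hi, two_mul]⟩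
    exact hj (by simp [sinhcSeries, this])
  rw [sinhcM, psEval, ← hinj.tsum_eq hs, matSinhc]
  simp [sinhcSeries]

theorem matCosh_eq {N : ℕ} (X : Matrix (Fin N) (Fin N) ℝ) : matCosh X = coshM X := by
  have hinj : Function.Injective fun j : ℕ => 2 * j := fun a b h => by simpa using h
  have hs : Function.support (fun j => PowerSeries.coeff j coshSeries • X ^ j)
      ⊆ Set.range fun j : ℕ => 2 * j := by
    intro j hj
    by_contra h
    have : ¬ Even j := fun ⟨i, hi⟩ => h ⟨i, by simp [hi, two_mul]⟩
    exact hj (by simp [coshSeries, this])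
  rw [coshM, psEval, ← hinj.tsum_eq hs, matCosh]
  simp [coshSeries]

theorem coshM_eq (X : Matrix n n ℝ) : coshM X = sinhcM X + X * dsinhcM X := by
  rw [coshM, coshSeries_eq, psEval_add expBounded_sinhcSeries
    expBounded_X_mul_derivative_sinhcSeries, psEval_mul expBounded_X
    expBounded_sinhcSeries.derivative, psEval_X]

theorem expM_eq (X : Matrix n n ℝ) : expM X = coshM X + X * sinhcM X := by
  rw [expM, exp_eq_coshSeries_add, psEval_add expBounded_coshSeries
    expBounded_X_mul_sinhcSeries, psEval_mul expBounded_X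
    expBounded_sinhcSeries, psEval_X]

theorem psEval_neg (φ : PowerSeries ℝ) (X : Matrix n n ℝ) :
    psEval φ (-X) = psEval (PowerSeries.rescale (-1) φ) X := by
  rw [← psEval_smul, neg_one_smul]

theorem sinhcM_neg (X : Matrix n n ℝ) : sinhcM (-X) = sinhcM X := by
  rw [sinhcM, psEval_neg, rescale_neg_one_sinhcSeries]

theorem coshM_neg (X : Matrix n n ℝ) : coshM (-X) = coshM X := by
  rw [coshM, psEval_neg, rescale_neg_one_coshSeries]

theorem dsinhcM_neg (X : Matrix n n ℝ) : dsinhcM (-X) = -dsinhcM X := by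
  rw [dsinhcM, psEval_neg, rescale_neg_one_derivative_sinhcSeries]
  simp [dsinhcM, psEval, tsum_neg]

theorem expM_neg (X : Matrix n n ℝ) : expM (-X) = coshM X - X * sinhcM X := by
  rw [expM_eq, coshM_neg, sinhcM_neg, neg_mul, sub_eq_add_neg]

theorem psEval_oneSubExpNegSeries_two_smul_mul (X : Matrix n n ℝ) :
    psEval oneSubExpNegSeries ((2 : ℝ) • X) * expM X = sinhcM X := by
  rw [psEval_smul, ← psEval_mul (expBounded_oneSubExpNegSeries.rescale 2) expBounded_exp,
    rescale_two_oneSubExpNegSeries_mul_exp]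

theorem two_mul_sinh_add_add {x y z : Matrix n n ℝ} (hxy : Commute x y) (hyz : Commute y z)
    (hxz : Commute x z) :
    2 * ((x + y + z) * sinhcM (x + y + z))
      = (coshM x + x * sinhcM x) * (coshM y + y * sinhcM y) * (coshM z + z * sinhcM z)
        - (coshM x - x * sinhcM x) * (coshM y - y * sinhcM y) * (coshM z - z * sinhcM z) := by
  have h1 : expM (x + y + z) = expM x * expM y * expM z := by
    rw [expM, psEval_exp_add (hxz.add_left hyz), psEval_exp_add hxy]
  have h2 : expM (-(x + y + z)) = expM (-x) * expM (-y) * expM (-z) := by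
    rw [neg_add, neg_add, expM, psEval_exp_add (by
      rw [← neg_add]; exact ((hxz.add_left hyz).neg_left).neg_right),
      psEval_exp_add hxy.neg_left.neg_right]
  rw [← expM_eq, ← expM_eq, ← expM_eq, ← expM_neg, ← expM_neg, ← expM_neg, ← h1, ← h2, expM_eq,
    expM_neg]
  noncomm_ring

/-- The symmetric divided-difference term entering the three-variable identity; it satisfies
`(x + y) * mixedTerm x y = s'(x) s(y) + s(x) s'(y)` for commuting `x`, `y`, where `s = sinhcM`. -/
noncomputable def mixedTerm (x y : Matrix n n ℝ) : Matrix n n ℝ :=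
  sinhcM y * psDivDiff (PowerSeries.derivative ℝ sinhcSeries) x 1 (-y)
    + dsinhcM y * psDivDiff sinhcSeries x 1 (-y)

/-- The combination of three commuting matrices which vanishes on the kernel of their sum. -/
noncomputable def tripleDefect (x y z : Matrix n n ℝ) : Matrix n n ℝ :=
  mixedTerm x y * sinhcM z + mixedTerm y z * sinhcM x + mixedTerm z x * sinhcM y
    - dsinhcM x * dsinhcM y * sinhcM z - dsinhcM y * dsinhcM z * sinhcM x
    - dsinhcM z * dsinhcM x * sinhcM y - sinhcM x * sinhcM y * sinhcM z

theorem add_mul_psDivDiff {φ : PowerSeries ℝ} (h : ExpBounded φ) {x y : Matrix n n ℝ}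
    (hxy : Commute x y) :
    (x + y) * psDivDiff φ x 1 (-y) = psEval φ x - psEval φ (-y) := by
  have h1 := psDivDiff_comm h x 1 (-y)
  simp only [mul_one, one_mul, sub_neg_eq_add] at h1
  rw [← h1, psDivDiff, psDivDiff, ← (Matrix.hasSum_psDivDiff h x 1 (-y)).summable.tsum_mul_left]
  refine tsum_congr fun j => ?_
  rw [mul_smul_comm, Finset.mul_sum]
  congr 1
  refine Finset.sum_congr rfl fun i _ => ?_
  rw [mul_one, ← mul_assoc, (((Commute.refl x).add_left hxy.symm).pow_right i).eq]

theorem add_mul_mixedTerm {x y : Matrix n n ℝ} (hxy : Commute x y) :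
    (x + y) * mixedTerm x y = dsinhcM x * sinhcM y + sinhcM x * dsinhcM y := by
  have h1 := add_mul_psDivDiff expBounded_sinhcSeries hxy
  have h2 := add_mul_psDivDiff expBounded_sinhcSeries.derivative hxy
  have h3 : Commute (x + y) (sinhcM y) :=
    commute_psEval _ (hxy.add_left (Commute.refl y))
  have h4 : Commute (x + y) (dsinhcM y) :=
    commute_psEval _ (hxy.add_left (Commute.refl y))
  have h5 := sinhcM_neg y
  have h6 := dsinhcM_neg y
  simp only [sinhcM, dsinhcM] at *
  have h7 : Commute (psEval sinhcSeries y) (psEval (PowerSeries.derivative ℝ sinhcSeries) x) :=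
    (commute_psEval _ (commute_psEval _ hxy).symm)
  have h8 : Commute (psEval (PowerSeries.derivative ℝ sinhcSeries) y) (psEval sinhcSeries x) :=
    (commute_psEval _ (commute_psEval _ hxy).symm)
  have h9 := commute_psEval_psEval sinhcSeries (PowerSeries.derivative ℝ sinhcSeries) y
  rw [mixedTerm, mul_add, ← mul_assoc, ← mul_assoc, h3.eq, h4.eq, mul_assoc, mul_assoc, h1, h2,
    h5, h6, mul_sub, mul_sub, h7.eq, h8.eq, mul_neg, h9.eq]
  abel

end HyperbolicMatrices

theorem three_variable_ring_identity {R : Type*} [CommRing R]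
    {x y z sx sy sz dx dy dz s mxy myz mzx : R}
    (hxy : (x + y) * mxy = dx * sy + sx * dy) (hyz : (y + z) * myz = dy * sz + sy * dz)
    (hzx : (z + x) * mzx = dz * sx + sz * dx)
    (hs : 2 * ((x + y + z) * s)
      = (sx + x * dx + x * sx) * (sy + y * dy + y * sy) * (sz + z * dz + z * sz)
        - (sx + x * dx - x * sx) * (sy + y * dy - y * sy) * (sz + z * dz - z * sz)) :
    2 * x * y * z * (mxy * sz + myz * sx + mzx * sy - dx * dy * sz - dy * dz * sx - dz * dx * sy
        - sx * sy * sz)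
      = 2 * (x * y * sz * mxy + y * z * sx * myz + z * x * sy * mzx - s + sx * sy * sz)
        * (x + y + z) := by
  linear_combination (-2 * x * y * sz) * hxy - (2 * y * z * sx) * hyz - (2 * z * x * sy) * hzx + hs

section TripleDefect

variable {n : Type*} [Fintype n] [DecidableEq n]

theorem exists_mul_tripleDefect_eq {x y z : Matrix n n ℝ} (hxy : Commute x y) (hyz : Commute y z)
    (hxz : Commute x z) :
    ∃ T, 2 * x * y * z * tripleDefect x y z = T * (x + y + z) := by
  set Z : Set (Matrix n n ℝ) := Set.centralizer {x, y, z} with hZ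
  have mem_Z : ∀ w, w ∈ Z ↔ Commute w x ∧ Commute w y ∧ Commute w z := by
    intro w
    simp only [hZ, Set.mem_centralizer_iff, Set.mem_insert_iff, Set.mem_singleton_iff,
      forall_eq_or_imp, forall_eq]
    constructor
    · rintro ⟨h1, h2, h3⟩
      exact ⟨h1.symm, h2.symm, h3.symm⟩
    · rintro ⟨h1, h2, h3⟩
      exact ⟨h1.symm, h2.symm, h3.symm⟩
  set S := Subring.centralizer Z with hS
  have mem_S : ∀ w, w ∈ S ↔ ∀ g ∈ Z, Commute g w := fun w => Subring.mem_centralizer_iff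
  have hx : x ∈ S := (mem_S x).2 fun g hg => ((mem_Z g).1 hg).1
  have hy : y ∈ S := (mem_S y).2 fun g hg => ((mem_Z g).1 hg).2.1
  have hz : z ∈ S := (mem_S z).2 fun g hg => ((mem_Z g).1 hg).2.2
  have hps : ∀ φ, ∀ w ∈ S, psEval φ w ∈ S := fun φ w hw =>
    (mem_S _).2 fun g hg => commute_psEval φ ((mem_S w).1 hw g hg)
  have hdd : ∀ φ, ∀ w ∈ S, ∀ w' ∈ S, psDivDiff φ w 1 w' ∈ S := fun φ w hw w' hw' =>
    (mem_S _).2 fun g hg => commute_psDivDiff φ ((mem_S w).1 hw g hg) (Commute.one_right g)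
      ((mem_S w').1 hw' g hg)
  have hmt : ∀ w ∈ S, ∀ w' ∈ S, mixedTerm w w' ∈ S := fun w hw w' hw' =>
    S.add_mem (S.mul_mem (hps _ _ hw') (hdd _ _ hw _ (S.neg_mem hw')))
      (S.mul_mem (hps _ _ hw') (hdd _ _ hw _ (S.neg_mem hw')))
  have hcomm : ∀ a b : S, a * b = b * a := by
    intro a b
    refine Subtype.ext ?_
    have hb : (b : Matrix n n ℝ) ∈ Z := (mem_Z _).2
      ⟨((mem_S _).1 b.2 x ((mem_Z x).2 ⟨Commute.refl x, hxy, hxz⟩)).symm,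
        ((mem_S _).1 b.2 y ((mem_Z y).2 ⟨hxy.symm, Commute.refl y, hyz⟩)).symm,
        ((mem_S _).1 b.2 z ((mem_Z z).2 ⟨hxz.symm, hyz.symm, Commute.refl z⟩)).symm⟩
    exact ((mem_S _).1 a.2 b hb).symm.eq
  let _ : CommRing S := { (inferInstance : Ring S) with mul_comm := hcomm }
  have h1 := add_mul_mixedTerm hxy
  have h2 := add_mul_mixedTerm hyz
  have h3 := add_mul_mixedTerm hxz.symm
  have h4 := two_mul_sinh_add_add hxy hyz hxz
  simp only [coshM_eq] at h4
  have key := three_variable_ring_identity (R := S) (x := ⟨x, hx⟩) (y := ⟨y, hy⟩) (z := ⟨z, hz⟩)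
    (sx := ⟨sinhcM x, hps _ _ hx⟩) (sy := ⟨sinhcM y, hps _ _ hy⟩) (sz := ⟨sinhcM z, hps _ _ hz⟩)
    (dx := ⟨dsinhcM x, hps _ _ hx⟩) (dy := ⟨dsinhcM y, hps _ _ hy⟩)
    (dz := ⟨dsinhcM z, hps _ _ hz⟩)
    (s := ⟨sinhcM (x + y + z), hps _ _ (S.add_mem (S.add_mem hx hy) hz)⟩)
    (mxy := ⟨mixedTerm x y, hmt _ hx _ hy⟩) (myz := ⟨mixedTerm y z, hmt _ hy _ hz⟩)
    (mzx := ⟨mixedTerm z x, hmt _ hz _ hx⟩)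
    (Subtype.ext h1) (Subtype.ext h2) (Subtype.ext h3) (Subtype.ext h4)
  exact ⟨_, congrArg Subtype.val key⟩

theorem tripleDefect_mulVec_of_isUnit {x y z : Matrix n n ℝ} (hxy : Commute x y)
    (hyz : Commute y z) (hxz : Commute x z) (hx : IsUnit x) (hy : IsUnit y) (hz : IsUnit z)
    {w : n → ℝ} (hw : (x + y + z) *ᵥ w = 0) : tripleDefect x y z *ᵥ w = 0 := by
  obtain ⟨T, hT⟩ := exists_mul_tripleDefect_eq hxy hyz hxz
  have h2 : IsUnit (2 : Matrix n n ℝ) := by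
    have := (isUnit_iff_ne_zero.2 (two_ne_zero (α := ℝ))).map (algebraMap ℝ (Matrix n n ℝ))
    rwa [map_ofNat] at this
  have hu : IsUnit (2 * x * y * z) := ((h2.mul hx).mul hy).mul hz
  refine Matrix.mulVec_injective_of_isUnit hu ?_
  simp only [mulVec_mulVec, hT, mulVec_zero]
  rw [← mulVec_mulVec, hw, mulVec_zero]

theorem continuous_mixedTerm_comp {f g : ℝ → Matrix n n ℝ} (hf : Continuous f)
    (hg : Continuous g) : Continuous fun ε => mixedTerm (f ε) (g ε) := by
  have hfg : Continuous fun ε => (f ε, -g ε) := hf.prodMk hg.neg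
  have h1 : Continuous fun ε =>
      psDivDiff (PowerSeries.derivative ℝ sinhcSeries) (f ε) 1 (-g ε) := by
    have := (continuous_psDivDiff expBounded_sinhcSeries.derivative (1 : Matrix n n ℝ)).comp hfg
    simpa only [Function.comp_def] using this
  have h2 : Continuous fun ε => psDivDiff sinhcSeries (f ε) 1 (-g ε) := by
    have := (continuous_psDivDiff expBounded_sinhcSeries (1 : Matrix n n ℝ)).comp hfg
    simpa only [Function.comp_def] using this
  have h3 : Continuous fun ε => sinhcM (g ε) :=
    (continuous_psEval expBounded_sinhcSeries).comp hg
  have h4 : Continuous fun ε => dsinhcM (g ε) :=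
    (continuous_psEval expBounded_sinhcSeries.derivative).comp hg
  simp only [mixedTerm]
  exact (h3.mul h1).add (h4.mul h2)

theorem continuous_tripleDefect_comp {f g h : ℝ → Matrix n n ℝ} (hf : Continuous f)
    (hg : Continuous g) (hh : Continuous h) :
    Continuous fun ε => tripleDefect (f ε) (g ε) (h ε) := by
  have hs : ∀ {f : ℝ → Matrix n n ℝ}, Continuous f → Continuous fun ε => sinhcM (f ε) :=
    fun hf => (continuous_psEval expBounded_sinhcSeries).comp hf
  have hd : ∀ {f : ℝ → Matrix n n ℝ}, Continuous f → Continuous fun ε => dsinhcM (f ε) :=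
    fun hf => (continuous_psEval expBounded_sinhcSeries.derivative).comp hf
  have h1 := continuous_mixedTerm_comp hf hg
  have h2 := continuous_mixedTerm_comp hg hh
  have h3 := continuous_mixedTerm_comp hh hf
  have a1 := hs hf
  have a2 := hs hg
  have a3 := hs hh
  have b1 := hd hf
  have b2 := hd hg
  have b3 := hd hh
  simp only [tripleDefect]
  exact (((((((h1.mul a3).add (h2.mul a1)).add (h3.mul a2)).sub ((b1.mul b2).mul a3)).sub
    ((b2.mul b3).mul a1))).sub ((b3.mul b1).mul a2)).sub ((a1.mul a2).mul a3)

theorem finite_setOf_not_isUnit_add_smul_one (x : Matrix n n ℝ) {c : ℝ} (hc : c ≠ 0) :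
    {ε : ℝ | ¬ IsUnit (x + (c * ε) • (1 : Matrix n n ℝ))}.Finite := by
  refine ((Matrix.finite_spectrum x).preimage (f := fun ε => -(c * ε)) ?_).subset ?_
  · intro a _ b _ h
    exact mul_left_cancel₀ hc (neg_injective h)
  · intro ε hε hmem
    refine hε ?_
    have h := spectrum.mem_resolventSet_iff.1 hmem
    rw [Algebra.algebraMap_eq_smul_one, neg_smul, ← IsUnit.neg_iff] at h
    convert h using 1
    abel

theorem tripleDefect_mulVec {x y z : Matrix n n ℝ} (hxy : Commute x y)
    (hyz : Commute y z) (hxz : Commute x z) {w : n → ℝ} (hw : (x + y + z) *ᵥ w = 0) :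
    tripleDefect x y z *ᵥ w = 0 := by
  let f : ℝ → n → ℝ := fun ε => tripleDefect (x + ((1 : ℝ) * ε) • (1 : Matrix n n ℝ))
    (y + ((1 : ℝ) * ε) • (1 : Matrix n n ℝ)) (z + ((-2 : ℝ) * ε) • (1 : Matrix n n ℝ)) *ᵥ w
  have hf : Continuous f :=
    (continuous_tripleDefect_comp (by fun_prop) (by fun_prop) (by fun_prop)).matrix_mulVec
      continuous_const
  have hfin := ((finite_setOf_not_isUnit_add_smul_one x one_ne_zero).union
    (finite_setOf_not_isUnit_add_smul_one y one_ne_zero)).union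
    (finite_setOf_not_isUnit_add_smul_one z (c := -2) (by norm_num))
  have h0 : ∀ ε, f ε = 0 := by
    have := (isClosed_singleton (x := (0 : n → ℝ))).preimage hf
    refine fun ε => (this.closure_subset_iff.2 ?_) (hfin.countable.dense_compl ℝ ε)
    intro ε hε
    simp only [Set.mem_compl_iff, Set.mem_union, Set.mem_ofPred_eq, not_or, not_not] at hε
    have hc : ∀ (a b : Matrix n n ℝ) (r s : ℝ), Commute a b →
        Commute (a + r • (1 : Matrix n n ℝ)) (b + s • (1 : Matrix n n ℝ)) := fun a b r s h =>
      (h.add_right ((Commute.one_right a).smul_right s)).add_left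
        (((Commute.one_left b).add_right ((Commute.one_left _).smul_right s)).smul_left r)
    refine tripleDefect_mulVec_of_isUnit (hc _ _ _ _ hxy) (hc _ _ _ _ hyz) (hc _ _ _ _ hxz)
      hε.1.1 hε.1.2 hε.2 ?_
    rw [← hw]
    congr 1
    module
  simpa [f] using h0 0

end TripleDefect

section InvariantAd

variable {n : Type*} [Fintype n] [DecidableEq n]

/-- `ad` is the adjoint action of a Lie algebra structure on `n → ℝ`, `γ` an invariant
nondegenerate symmetric form, and `B` a skew form which annihilates all brackets. -/
structure IsInvariantAd (ad : (n → ℝ) →ₗ[ℝ] Matrix n n ℝ) (γ B : Matrix n n ℝ) : Prop where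
  mulVec_comm : ∀ v w, ad v *ᵥ w = -(ad w *ᵥ v)
  ad_mulVec : ∀ v w, ad (ad v *ᵥ w) = ad v * ad w - ad w * ad v
  symm : γᵀ = γ
  isUnit : IsUnit γ
  mul_ad : ∀ v, γ * ad v = -((ad v)ᵀ * γ)
  skew : Bᵀ = -B
  transpose_ad_mul : ∀ v, (ad v)ᵀ * B = 0

namespace IsInvariantAd

variable {ad : (n → ℝ) →ₗ[ℝ] Matrix n n ℝ} {γ B : Matrix n n ℝ}

theorem inv_mul (h : IsInvariantAd ad γ B) : γ⁻¹ * γ = 1 :=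
  Matrix.nonsing_inv_mul γ ((Matrix.isUnit_iff_isUnit_det γ).1 h.isUnit)

theorem mul_inv (h : IsInvariantAd ad γ B) : γ * γ⁻¹ = 1 :=
  Matrix.mul_nonsing_inv γ ((Matrix.isUnit_iff_isUnit_det γ).1 h.isUnit)

theorem inv_symm (h : IsInvariantAd ad γ B) : γ⁻¹ᵀ = γ⁻¹ := by
  rw [Matrix.transpose_nonsing_inv, h.symm]

theorem ad_mul_inv (h : IsInvariantAd ad γ B) (v : n → ℝ) :
    ad v * γ⁻¹ = -(γ⁻¹ * (ad v)ᵀ) := by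
  have h1 : γ⁻¹ * (γ * ad v) * γ⁻¹ = ad v * γ⁻¹ := by rw [← mul_assoc, h.inv_mul, one_mul]
  rw [← h1, h.mul_ad, mul_neg, neg_mul, ← mul_assoc, mul_assoc _ γ, h.mul_inv, mul_one]

theorem ad_mulVec_self (h : IsInvariantAd ad γ B) (v : n → ℝ) : ad v *ᵥ v = 0 := by
  have := h.mulVec_comm v v
  exact self_eq_neg.1 this

theorem trace_ad (h : IsInvariantAd ad γ B) (v : n → ℝ) : (ad v).trace = 0 := by
  have h1 : (γ * ad v * γ⁻¹).trace = (ad v).trace := by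
    rw [Matrix.trace_mul_comm, ← mul_assoc, h.inv_mul, one_mul]
  rw [h.mul_ad, neg_mul, mul_assoc, h.mul_inv, mul_one, Matrix.trace_neg,
    Matrix.trace_transpose] at h1
  linarith

theorem mul_ad_eq_zero (h : IsInvariantAd ad γ B) (v : n → ℝ) : B * ad v = 0 := by
  have := congrArg Matrix.transpose (h.transpose_ad_mul v)
  simpa [h.skew] using this

theorem ad_mul_inv_mul (h : IsInvariantAd ad γ B) (v : n → ℝ) : ad v * (γ⁻¹ * B) = 0 := by
  rw [← mul_assoc, h.ad_mul_inv, neg_mul, mul_assoc, h.transpose_ad_mul, mul_zero, neg_zero]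

theorem ad_inv_mul_mulVec (h : IsInvariantAd ad γ B) (v : n → ℝ) :
    ad ((γ⁻¹ * B) *ᵥ v) = 0 := by
  refine Matrix.ext_of_mulVec_single fun j => ?_
  rw [h.mulVec_comm, mulVec_mulVec, h.ad_mul_inv_mul, zero_mulVec, neg_zero, zero_mulVec]

theorem inv_mul_transpose_mul (h : IsInvariantAd ad γ B) {φ : PowerSeries ℝ}
    (hφ : ExpBounded φ) (v : n → ℝ) :
    γ⁻¹ * (psEval φ (ad v))ᵀ * γ = psEval φ (-ad v) := by
  have h1 : (ad v)ᵀ * γ = γ * -ad v := by rw [mul_neg, h.mul_ad, neg_neg]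
  rw [← psEval_transpose, mul_assoc, psEval_mul_eq_mul_psEval hφ h1, ← mul_assoc, h.inv_mul,
    one_mul]

end IsInvariantAd

end InvariantAd

section ThreeSlots

open scoped Kronecker

variable {n : Type*} [Fintype n] [DecidableEq n]

/-- The action of a matrix on the first tensor factor. -/
noncomputable def slotOne : Matrix n n ℝ →ₐ[ℝ] Matrix (n × n × n) (n × n × n) ℝ :=
  AlgHom.ofLinearMap
    { toFun := fun F => F ⊗ₖ (1 : Matrix (n × n) (n × n) ℝ)
      map_add' := fun F K => add_kronecker F K _
      map_smul' := fun r F => smul_kronecker r F _ }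
    one_kronecker_one (fun F K => by simp [← mul_kronecker_mul])

/-- The action of a matrix on the second tensor factor. -/
noncomputable def slotTwo : Matrix n n ℝ →ₐ[ℝ] Matrix (n × n × n) (n × n × n) ℝ :=
  AlgHom.ofLinearMap
    { toFun := fun F => (1 : Matrix n n ℝ) ⊗ₖ (F ⊗ₖ (1 : Matrix n n ℝ))
      map_add' := fun F K => by rw [add_kronecker, kronecker_add]
      map_smul' := fun r F => by rw [smul_kronecker, kronecker_smul, RingHom.id_apply] }
    (by simp) (fun F K => by simp [← mul_kronecker_mul])

/-- The action of a matrix on the third tensor factor. -/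
noncomputable def slotThree : Matrix n n ℝ →ₐ[ℝ] Matrix (n × n × n) (n × n × n) ℝ :=
  AlgHom.ofLinearMap
    { toFun := fun F => (1 : Matrix n n ℝ) ⊗ₖ ((1 : Matrix n n ℝ) ⊗ₖ F)
      map_add' := fun F K => by rw [kronecker_add, kronecker_add]
      map_smul' := fun r F => by rw [kronecker_smul, kronecker_smul, RingHom.id_apply] }
    (by simp) (fun F K => by simp [← mul_kronecker_mul])

theorem slotOne_mul_slotTwo_mul_slotThree (F K H : Matrix n n ℝ) :
    slotOne F * slotTwo K * slotThree H = F ⊗ₖ (K ⊗ₖ H) := by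
  simp [slotOne, slotTwo, slotThree, ← mul_kronecker_mul]

theorem commute_slotOne_slotTwo (F K : Matrix n n ℝ) : Commute (slotOne F) (slotTwo K) := by
  simp [commute_iff_eq, slotOne, slotTwo, ← mul_kronecker_mul]

theorem commute_slotTwo_slotThree (F K : Matrix n n ℝ) : Commute (slotTwo F) (slotThree K) := by
  simp [commute_iff_eq, slotTwo, slotThree, ← mul_kronecker_mul]

theorem commute_slotOne_slotThree (F K : Matrix n n ℝ) : Commute (slotOne F) (slotThree K) := by
  simp [commute_iff_eq, slotOne, slotThree, ← mul_kronecker_mul]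

/-- The cyclic permutation of the three tensor factors. -/
noncomputable def slotCycle :
    Matrix (n × n × n) (n × n × n) ℝ ≃ₐ[ℝ] Matrix (n × n × n) (n × n × n) ℝ :=
  Matrix.reindexAlgEquiv ℝ ℝ
    { toFun := fun p => (p.2.2, p.1, p.2.1)
      invFun := fun p => (p.2.1, p.2.2, p.1)
      left_inv := fun _ => rfl
      right_inv := fun _ => rfl }

theorem slotCycle_slotOne (F : Matrix n n ℝ) : slotCycle (slotOne F) = slotTwo F := by
  ext p q
  simp [slotCycle, slotOne, slotTwo, one_apply, Prod.ext_iff]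
  aesop

theorem slotCycle_slotTwo (F : Matrix n n ℝ) : slotCycle (slotTwo F) = slotThree F := by
  ext p q
  simp [slotCycle, slotThree, slotTwo, one_apply]
  aesop

theorem slotCycle_slotThree (F : Matrix n n ℝ) : slotCycle (slotThree F) = slotOne F := by
  ext p q
  simp [slotCycle, slotThree, slotOne, one_apply, Prod.ext_iff]
  aesop

end ThreeSlots

section StructureTensor

open scoped Kronecker

variable {n : Type*} [Fintype n] [DecidableEq n]

/-- The structure tensor of `ad`, with all indices lowered by `γ`. -/
def lowerTensor (ad : (n → ℝ) →ₗ[ℝ] Matrix n n ℝ) (γ : Matrix n n ℝ) : n × n × n → ℝ :=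
  fun p => (γ * ad (Pi.single p.2.2 1)) p.1 p.2.1

/-- The structure tensor of `ad`, with all indices raised by `γ`. -/
noncomputable def upperTensor (ad : (n → ℝ) →ₗ[ℝ] Matrix n n ℝ) (γ : Matrix n n ℝ) :
    n × n × n → ℝ :=
  fun p => (ad (γ⁻¹ *ᵥ Pi.single p.2.2 1) * γ⁻¹) p.1 p.2.1

/-- The full contraction of the two structure tensors through an operator on the three slots. -/
noncomputable def contraction (ad : (n → ℝ) →ₗ[ℝ] Matrix n n ℝ) (γ : Matrix n n ℝ) :
    Matrix (n × n × n) (n × n × n) ℝ →ₗ[ℝ] ℝ where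
  toFun T := lowerTensor ad γ ⬝ᵥ T *ᵥ upperTensor ad γ
  map_add' S T := by rw [add_mulVec, dotProduct_add]
  map_smul' r T := by rw [smul_mulVec, dotProduct_smul, RingHom.id_apply]

namespace IsInvariantAd

variable {ad : (n → ℝ) →ₗ[ℝ] Matrix n n ℝ} {γ B : Matrix n n ℝ}

theorem transpose_mul_ad (h : IsInvariantAd ad γ B) (v : n → ℝ) :
    (γ * ad v)ᵀ = -(γ * ad v) := by
  rw [h.mul_ad, transpose_neg, transpose_mul, transpose_transpose, h.symm, h.mul_ad]

theorem transpose_ad_mul_inv (h : IsInvariantAd ad γ B) (v : n → ℝ) :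
    (ad v * γ⁻¹)ᵀ = -(ad v * γ⁻¹) := by
  rw [h.ad_mul_inv, transpose_neg, transpose_mul, transpose_transpose, h.inv_symm, h.ad_mul_inv]

theorem lowerTensor_cycle (h : IsInvariantAd ad γ B) (a c b : n) :
    lowerTensor ad γ (a, c, b) = lowerTensor ad γ (c, b, a) := by
  have h1 : (γ * ad (Pi.single b 1)) a c = -(γ * ad (Pi.single b 1)) c a :=
    congrFun (congrFun (h.transpose_mul_ad (Pi.single b 1)) c) a
  have h2 : ad (Pi.single b 1) *ᵥ Pi.single a 1 = -(ad (Pi.single a 1) *ᵥ Pi.single b 1) :=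
    h.mulVec_comm _ _
  have h3 : ∀ u v : n,
      (γ * ad (Pi.single u 1)) c v = (γ *ᵥ (ad (Pi.single u 1) *ᵥ Pi.single v 1)) c := by
    intro u v
    rw [mulVec_mulVec, mulVec_single_one]
    rfl
  simp only [lowerTensor]
  rw [h1, h3, h3, h2, mulVec_neg, Pi.neg_apply, neg_neg]

theorem upperTensor_cycle (h : IsInvariantAd ad γ B) (a c b : n) :
    upperTensor ad γ (a, c, b) = upperTensor ad γ (c, b, a) := by
  have h1 : ∀ v, (ad v * γ⁻¹) a c = -(ad v * γ⁻¹) c a := fun v =>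
    congrFun (congrFun (h.transpose_ad_mul_inv v) c) a
  have h2 := h.mulVec_comm (γ⁻¹ *ᵥ Pi.single b 1) (γ⁻¹ *ᵥ Pi.single a 1)
  have h3 : ∀ (w : n → ℝ) (v : n),
      (ad w * γ⁻¹) c v = (ad w *ᵥ (γ⁻¹ *ᵥ Pi.single v 1)) c := by
    intro w v
    rw [mulVec_mulVec, mulVec_single_one]
    rfl
  simp only [upperTensor]
  rw [h1, h3, h3, h2, Pi.neg_apply, neg_neg]

theorem contraction_slotCycle (h : IsInvariantAd ad γ B)
    (T : Matrix (n × n × n) (n × n × n) ℝ) :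
    contraction ad γ (slotCycle T) = contraction ad γ T := by
  let e : n × n × n ≃ n × n × n :=
    { toFun := fun p => (p.2.2, p.1, p.2.1)
      invFun := fun p => (p.2.1, p.2.2, p.1)
      left_inv := fun _ => rfl
      right_inv := fun _ => rfl }
  have hl : ∀ p, lowerTensor ad γ (e p) = lowerTensor ad γ p := fun p => h.lowerTensor_cycle _ _ _
  have hu : ∀ p, upperTensor ad γ (e p) = upperTensor ad γ p := fun p => h.upperTensor_cycle _ _ _
  have hT : ∀ p q, slotCycle T (e p) (e q) = T p q := fun p q => rfl
  change ∑ p, lowerTensor ad γ p * ∑ q, slotCycle T p q * upperTensor ad γ q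
    = ∑ p, lowerTensor ad γ p * ∑ q, T p q * upperTensor ad γ q
  rw [← e.sum_comp]
  refine Finset.sum_congr rfl fun p _ => ?_
  rw [hl, ← e.sum_comp]
  simp only [hu, hT]

theorem contraction_slots (h : IsInvariantAd ad γ B) (F K H : Matrix n n ℝ) :
    contraction ad γ (slotOne F * slotTwo K * slotThree H)
      = -∑ b, (ad (Pi.single b 1) * F * ad (γ⁻¹ *ᵥ (Hᵀ *ᵥ Pi.single b 1))
          * (γ⁻¹ * Kᵀ * γ)).trace := by
  have h1 : ∀ b : n, (ad (Pi.single b 1) * F * ad (γ⁻¹ *ᵥ (Hᵀ *ᵥ Pi.single b 1))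
          * (γ⁻¹ * Kᵀ * γ)).trace
        = -∑ b', H b b' * ((γ * ad (Pi.single b 1))ᵀ * F
          * (ad (γ⁻¹ *ᵥ Pi.single b' 1) * γ⁻¹) * Kᵀ).trace := by
    intro b
    have h2 : Hᵀ *ᵥ Pi.single b 1 = ∑ b', H b b' • (Pi.single b' 1 : n → ℝ) := by
      rw [mulVec_single_one]
      ext i
      simp [Finset.sum_apply, Pi.single_apply, transpose_apply, col_apply]
    have h3 : (γ * ad (Pi.single b 1))ᵀ = -(γ * ad (Pi.single b 1)) :=
      h.transpose_mul_ad _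
    rw [h2, mulVec_sum, map_sum]
    simp only [mulVec_smul, map_smul, Finset.mul_sum, Finset.sum_mul, trace_sum,
      mul_smul_comm, smul_mul_assoc, trace_smul, smul_eq_mul]
    rw [← Finset.sum_neg_distrib]
    refine Finset.sum_congr rfl fun b' _ => ?_
    rw [h3, ← mul_neg, ← trace_neg]
    congr 1
    rw [← mul_assoc, trace_mul_comm]
    simp only [neg_mul, neg_neg, mul_assoc]
  simp only [h1, ← Finset.sum_neg_distrib, neg_neg]
  rw [slotOne_mul_slotTwo_mul_slotThree]
  change ∑ p, lowerTensor ad γ p * ∑ q, (F ⊗ₖ (K ⊗ₖ H)) p q * upperTensor ad γ q = _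
  have h4 : ∀ M W : Matrix n n ℝ, (Mᵀ * F * W * Kᵀ).trace
      = ∑ a, ∑ c, ∑ a', ∑ c', M a c * (F a a' * K c c') * W a' c' := by
    intro M W
    simp only [trace, diag, mul_apply, transpose_apply, Finset.sum_mul]
    conv_rhs => rw [Finset.sum_comm]
    refine Finset.sum_congr rfl fun c _ => ?_
    rw [Finset.sum_comm_cycle]
    refine Finset.sum_congr rfl fun c' _ => ?_
    rw [Finset.sum_comm]
    refine Finset.sum_congr rfl fun a _ => Finset.sum_congr rfl fun a' _ => ?_
    ring
  simp only [h4, Fintype.sum_prod_type, lowerTensor, upperTensor, kroneckerMap_apply,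
    Finset.mul_sum]
  rw [Finset.sum_comm_cycle]
  refine Finset.sum_congr rfl fun b _ => ?_
  conv_lhs => enter [2, a, 2, c]; rw [Finset.sum_comm_cycle]
  rw [Finset.sum_comm_cycle]
  refine Finset.sum_congr rfl fun b' _ => Finset.sum_congr rfl fun a _ =>
    Finset.sum_congr rfl fun c _ => Finset.sum_congr rfl fun a' _ =>
      Finset.sum_congr rfl fun c' _ => ?_
  ring

end IsInvariantAd

end StructureTensor

section TraceIdentity

variable {n : Type*} [Fintype n] [DecidableEq n]

/-- The logarithmic derivative of `sinhcM`. -/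
noncomputable abbrev logDerivSinhcM (X : Matrix n n ℝ) : Matrix n n ℝ := (sinhcM X)⁻¹ * dsinhcM X

/-- The derivative of `logDerivSinhcM` at `X` in the direction `V`. -/
noncomputable def fderivLogDerivSinhcM (X V : Matrix n n ℝ) : Matrix n n ℝ :=
  (sinhcM X)⁻¹ * psDivDiff (PowerSeries.derivative ℝ sinhcSeries) X V X
    - (sinhcM X)⁻¹ * psDivDiff sinhcSeries X V X * logDerivSinhcM X

theorem slotOne_mulVec (F : Matrix n n ℝ) (u : n × n × n → ℝ) (a c b : n) :
    (slotOne F *ᵥ u) (a, c, b) = ∑ i, F a i * u (i, c, b) := by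
  simp [slotOne, mulVec, dotProduct, Fintype.sum_prod_type, one_apply, Prod.ext_iff, ite_and]

theorem slotTwo_mulVec (F : Matrix n n ℝ) (u : n × n × n → ℝ) (a c b : n) :
    (slotTwo F *ᵥ u) (a, c, b) = ∑ i, F c i * u (a, i, b) := by
  simp [slotTwo, mulVec, dotProduct, Fintype.sum_prod_type, one_apply]

theorem slotThree_mulVec (F : Matrix n n ℝ) (u : n × n × n → ℝ) (a c b : n) :
    (slotThree F *ᵥ u) (a, c, b) = ∑ i, F b i * u (a, c, i) := by
  simp [slotThree, mulVec, dotProduct, Fintype.sum_prod_type, one_apply]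

theorem slotOne_psEval {φ : PowerSeries ℝ} (hφ : ExpBounded φ) (X : Matrix n n ℝ) :
    slotOne (psEval φ X) = psEval φ (slotOne X) :=
  map_psEval slotOne slotOne.toLinearMap.continuous_of_finiteDimensional
    (Matrix.summable_psEval hφ X)

theorem slotTwo_psEval {φ : PowerSeries ℝ} (hφ : ExpBounded φ) (X : Matrix n n ℝ) :
    slotTwo (psEval φ X) = psEval φ (slotTwo X) :=
  map_psEval slotTwo slotTwo.toLinearMap.continuous_of_finiteDimensional
    (Matrix.summable_psEval hφ X)

theorem slotThree_psEval {φ : PowerSeries ℝ} (hφ : ExpBounded φ) (X : Matrix n n ℝ) :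
    slotThree (psEval φ X) = psEval φ (slotThree X) :=
  map_psEval slotThree slotThree.toLinearMap.continuous_of_finiteDimensional
    (Matrix.summable_psEval hφ X)

theorem slotCycle_mixedTerm (x y : Matrix (n × n × n) (n × n × n) ℝ) :
    slotCycle (mixedTerm x y) = mixedTerm (slotCycle x) (slotCycle y) := by
  have hc : Continuous (slotCycle (n := n)) :=
    slotCycle.toLinearMap.continuous_of_finiteDimensional
  simp only [mixedTerm, map_add, map_mul, sinhcM, dsinhcM]
  rw [map_psEval slotCycle hc (Matrix.summable_psEval expBounded_sinhcSeries y),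
    map_psEval slotCycle hc (Matrix.summable_psEval expBounded_sinhcSeries.derivative y),
    map_psDivDiff slotCycle hc (Matrix.hasSum_psDivDiff expBounded_sinhcSeries _ _ _).summable,
    map_psDivDiff slotCycle hc
      (Matrix.hasSum_psDivDiff expBounded_sinhcSeries.derivative _ _ _).summable, map_one, map_neg]

namespace IsInvariantAd

variable {ad : (n → ℝ) →ₗ[ℝ] Matrix n n ℝ} {γ B : Matrix n n ℝ}

theorem slots_mulVec_upperTensor (h : IsInvariantAd ad γ B) (k : n → ℝ) :
    (slotOne (ad k) + slotTwo (ad k) + slotThree (ad k)) *ᵥ upperTensor ad γ = 0 := by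
  have key : ∀ v, ad k * (ad v * γ⁻¹) + (ad v * γ⁻¹) * (ad k)ᵀ - ad (ad k *ᵥ v) * γ⁻¹ = 0 := by
    intro v
    have h1 : γ⁻¹ * (ad k)ᵀ = -(ad k * γ⁻¹) := by rw [h.ad_mul_inv, neg_neg]
    rw [h.ad_mulVec, mul_assoc (ad v), h1]
    noncomm_ring
  funext ⟨a, c, b⟩
  rw [add_mulVec, add_mulVec, Pi.add_apply, Pi.add_apply, slotOne_mulVec, slotTwo_mulVec,
    slotThree_mulVec, Pi.zero_apply]
  have h2 : ∑ i, ad k b i * upperTensor ad γ (a, c, i)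
      = -(ad (ad k *ᵥ (γ⁻¹ *ᵥ Pi.single b 1)) * γ⁻¹) a c := by
    have h3 : -(ad k *ᵥ (γ⁻¹ *ᵥ Pi.single b 1))
        = ∑ i, ad k b i • (γ⁻¹ *ᵥ (Pi.single i 1 : n → ℝ)) := by
      have h4 : -(ad k * γ⁻¹) = γ⁻¹ * (ad k)ᵀ := by rw [h.ad_mul_inv, neg_neg]
      rw [mulVec_mulVec, ← neg_mulVec, h4, ← mulVec_mulVec]
      simp only [← mulVec_smul, ← mulVec_sum]
      congr 1
      rw [mulVec_single_one]
      ext i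
      simp [Finset.sum_apply, Pi.single_apply, transpose_apply, col_apply]
    have h5 : -(ad (ad k *ᵥ (γ⁻¹ *ᵥ Pi.single b 1)) * γ⁻¹) a c
        = (ad (-(ad k *ᵥ (γ⁻¹ *ᵥ Pi.single b 1))) * γ⁻¹) a c := by
      rw [map_neg, neg_mul]
      rfl
    rw [h5, h3, map_sum, Finset.sum_mul, Matrix.sum_apply]
    refine Finset.sum_congr rfl fun i _ => ?_
    rw [map_smul, smul_mul_assoc]
    rfl
  have h6 := congrFun (congrFun (key (γ⁻¹ *ᵥ Pi.single b 1)) a) c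
  rw [h2]
  rw [← sub_eq_add_neg]
  refine Eq.trans ?_ h6
  simp only [Matrix.sub_apply, Matrix.add_apply, mul_apply (M := ad k), mul_apply (N := (ad k)ᵀ),
    upperTensor,
    transpose_apply]
  congr 2
  exact Finset.sum_congr rfl fun i _ => mul_comm _ _

theorem contraction_slots_psDivDiff (h : IsInvariantAd ad γ B) {φ : PowerSeries ℝ}
    (hφ : ExpBounded φ) (F K : Matrix n n ℝ) (k : n → ℝ) :
    contraction ad γ
        (slotOne F * slotTwo K * psDivDiff φ (slotOne (ad k)) 1 (-slotTwo (ad k)))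
      = -∑ b, (ad (Pi.single b 1) * F * psDivDiff φ (ad k) (ad (γ⁻¹ *ᵥ Pi.single b 1)) (ad k)
          * (γ⁻¹ * Kᵀ * γ)).trace := by
  have h1 : ∀ i j : ℕ, slotOne F * slotTwo K * (slotOne (ad k) ^ i * 1 * (-slotTwo (ad k)) ^ j)
      = slotOne (F * ad k ^ i) * slotTwo (K * (-ad k) ^ j) * slotThree 1 := by
    intro i j
    have hc := commute_slotOne_slotTwo (ad k ^ i) K
    rw [map_one, mul_one, mul_one, map_mul, map_mul, ← map_neg slotTwo, ← map_pow slotOne,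
      ← map_pow slotTwo, mul_assoc,
      ← mul_assoc (slotTwo K), ← hc.eq]
    simp only [mul_assoc]
  have h2 : ∀ j : ℕ, ∀ K : Matrix n n ℝ,
      γ⁻¹ * (K * (-ad k) ^ j)ᵀ * γ = ad k ^ j * (γ⁻¹ * Kᵀ * γ) := by
    intro j K
    have hs : SemiconjBy γ⁻¹ (-ad k)ᵀ (ad k) := by
      rw [SemiconjBy, h.ad_mul_inv, transpose_neg, mul_neg]
    rw [transpose_mul, transpose_pow, ← mul_assoc, (hs.pow_right j).eq]
    simp only [mul_assoc]
  have h3 : ∀ i j : ℕ,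
      contraction ad γ (slotOne F * slotTwo K * (slotOne (ad k) ^ i * 1 * (-slotTwo (ad k)) ^ j))
      = -∑ b, (ad (Pi.single b 1) * F * (ad k ^ i * ad (γ⁻¹ *ᵥ Pi.single b 1) * ad k ^ j)
          * (γ⁻¹ * Kᵀ * γ)).trace := by
    intro i j
    rw [h1, h.contraction_slots]
    congr 1
    refine Finset.sum_congr rfl fun b _ => ?_
    rw [h2, transpose_one, one_mulVec]
    simp only [mul_assoc]
  have hl := ((Matrix.hasSum_psDivDiff hφ (slotOne (ad k)) 1 (-slotTwo (ad k))).mul_left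
    (slotOne F * slotTwo K)).map (contraction ad γ)
      (contraction ad γ).continuous_of_finiteDimensional
  have hr := (hasSum_sum (s := Finset.univ) fun (b : n) _ =>
    (((Matrix.hasSum_psDivDiff hφ (ad k) (ad (γ⁻¹ *ᵥ Pi.single b 1)) (ad k)).mul_left
      (ad (Pi.single b 1) * F)).mul_right (γ⁻¹ * Kᵀ * γ)).map (traceLinearMap n ℝ ℝ)
        (traceLinearMap n ℝ ℝ).continuous_of_finiteDimensional).neg
  refine hl.unique (hr.congr_fun fun j => ?_)
  simp only [Function.comp_apply, traceLinearMap_apply, mul_smul_comm, smul_mul_assoc, map_smul,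
    Finset.mul_sum, Finset.sum_mul, map_sum, h3, smul_eq_mul]
  conv_rhs => rw [Finset.sum_comm]
  simp only [mul_neg, Finset.mul_sum, Finset.sum_neg_distrib]

end IsInvariantAd

end TraceIdentity

section CurvatureIdentity

variable {n : Type*} [Fintype n] [DecidableEq n]

theorem psDivDiff_add {φ : PowerSeries ℝ} (h : ExpBounded φ) (X V W Y : Matrix n n ℝ) :
    psDivDiff φ X (V + W) Y = psDivDiff φ X V Y + psDivDiff φ X W Y := by
  refine (((Matrix.hasSum_psDivDiff h X V Y).add (Matrix.hasSum_psDivDiff h X W Y)).unique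
    ((Matrix.hasSum_psDivDiff h X (V + W) Y).congr_fun fun j => ?_)).symm
  simp only [mul_add, add_mul, Finset.sum_add_distrib, smul_add]

theorem commute_mixedTerm {x y w : Matrix n n ℝ} (hx : Commute w x) (hy : Commute w y) :
    Commute w (mixedTerm x y) :=
  ((commute_psEval _ hy).mul_right (commute_psDivDiff _ hx (Commute.one_right w)
      hy.neg_right)).add_right
    ((commute_psEval _ hy).mul_right (commute_psDivDiff _ hx (Commute.one_right w) hy.neg_right))

theorem mul_mul_mul_cancel_of_commute {R : Type*} [Ring R] {p q r m s : R} (hm : Commute r m)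
    (hs : r * s = 1) : p * q * r * (m * s) = p * q * m := by
  rw [mul_assoc (p * q), ← mul_assoc r, hm.eq, mul_assoc m, hs, mul_one]

theorem fderivLogDerivSinhcM_add (X V W : Matrix n n ℝ) :
    fderivLogDerivSinhcM X (V + W) = fderivLogDerivSinhcM X V + fderivLogDerivSinhcM X W := by
  simp only [fderivLogDerivSinhcM, psDivDiff_add expBounded_sinhcSeries,
    psDivDiff_add expBounded_sinhcSeries.derivative]
  noncomm_ring

theorem fderivLogDerivSinhcM_commutator {X : Matrix n n ℝ} (hS : IsUnit (sinhcM X))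
    (W : Matrix n n ℝ) :
    fderivLogDerivSinhcM X (X * W - W * X) = logDerivSinhcM X * W - W * logDerivSinhcM X := by
  have hdet := (Matrix.isUnit_iff_isUnit_det _).1 hS
  have h1 : sinhcM X * logDerivSinhcM X = dsinhcM X := by
    rw [logDerivSinhcM, Matrix.mul_nonsing_inv_cancel_left _ _ hdet]
  rw [fderivLogDerivSinhcM, psDivDiff_comm expBounded_sinhcSeries,
    psDivDiff_comm expBounded_sinhcSeries.derivative, mul_sub, mul_sub, sub_mul,
    Matrix.nonsing_inv_mul_cancel_left _ _ hdet, mul_assoc _ (W * _), mul_assoc W, h1,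
    ← mul_assoc _ (dsinhcM X)]
  abel

namespace IsInvariantAd

variable {ad : (n → ℝ) →ₗ[ℝ] Matrix n n ℝ} {γ B : Matrix n n ℝ}

theorem inv_mul_transpose_logDerivSinhcM_mul (h : IsInvariantAd ad γ B) (k : n → ℝ) :
    γ⁻¹ * (logDerivSinhcM (ad k))ᵀ * γ = -logDerivSinhcM (ad k) := by
  have h1 : γ⁻¹ * (sinhcM (ad k))ᵀ * γ = sinhcM (ad k) := by
    exact (h.inv_mul_transpose_mul expBounded_sinhcSeries k).trans (sinhcM_neg _)
  have h2 : γ⁻¹ * (dsinhcM (ad k))ᵀ * γ = -dsinhcM (ad k) := by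
    exact (h.inv_mul_transpose_mul expBounded_sinhcSeries.derivative k).trans (dsinhcM_neg _)
  have h3 : γ⁻¹ * (sinhcM (ad k))⁻¹ᵀ * γ = (sinhcM (ad k))⁻¹ := by
    refine Eq.trans ?_ (congrArg (fun M => M⁻¹) h1)
    rw [Matrix.mul_inv_rev, Matrix.mul_inv_rev, Matrix.transpose_nonsing_inv,
      Matrix.nonsing_inv_nonsing_inv _ ((Matrix.isUnit_iff_isUnit_det γ).1 h.isUnit), mul_assoc]
  have h4 : Commute (dsinhcM (ad k)) (sinhcM (ad k))⁻¹ :=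
    commute_matrix_inv (commute_psEval_psEval _ _ _)
  calc γ⁻¹ * (logDerivSinhcM (ad k))ᵀ * γ
      = (γ⁻¹ * (dsinhcM (ad k))ᵀ * γ) * (γ⁻¹ * (sinhcM (ad k))⁻¹ᵀ * γ) := by
        rw [logDerivSinhcM, transpose_mul]
        simp only [mul_assoc]
        rw [← mul_assoc γ γ⁻¹, h.mul_inv, one_mul]
    _ = -dsinhcM (ad k) * (sinhcM (ad k))⁻¹ := by rw [h2, h3]
    _ = _ := by rw [neg_mul, h4.eq]

theorem contraction_mixedTerm (h : IsInvariantAd ad γ B) (k : n → ℝ)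
    (hS : IsUnit (sinhcM (ad k))) :
    contraction ad γ (slotOne (sinhcM (ad k))⁻¹ * slotTwo (sinhcM (ad k))⁻¹
        * mixedTerm (slotOne (ad k)) (slotTwo (ad k)))
      = -∑ b, (ad (Pi.single b 1)
          * fderivLogDerivSinhcM (ad k) (ad (γ⁻¹ *ᵥ Pi.single b 1))).trace := by
  have hdet := (Matrix.isUnit_iff_isUnit_det _).1 hS
  have h1 : slotOne (sinhcM (ad k))⁻¹ * slotTwo (sinhcM (ad k))⁻¹
        * mixedTerm (slotOne (ad k)) (slotTwo (ad k))
      = slotOne (sinhcM (ad k))⁻¹ * slotTwo 1 * psDivDiff (PowerSeries.derivative ℝ sinhcSeries)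
          (slotOne (ad k)) 1 (-slotTwo (ad k))
        + slotOne (sinhcM (ad k))⁻¹ * slotTwo (logDerivSinhcM (ad k)) * psDivDiff sinhcSeries
          (slotOne (ad k)) 1 (-slotTwo (ad k)) := by
    have hs : sinhcM (slotTwo (ad k)) = slotTwo (sinhcM (ad k)) :=
      (slotTwo_psEval expBounded_sinhcSeries _).symm
    have hd : dsinhcM (slotTwo (ad k)) = slotTwo (dsinhcM (ad k)) :=
      (slotTwo_psEval expBounded_sinhcSeries.derivative _).symm
    rw [mixedTerm, hs, hd, mul_add, ← mul_assoc, ← mul_assoc,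
      mul_assoc _ (slotTwo _) (slotTwo _), mul_assoc _ (slotTwo _) (slotTwo _), ← map_mul,
      ← map_mul, Matrix.nonsing_inv_mul _ hdet]
  rw [h1, map_add, h.contraction_slots_psDivDiff expBounded_sinhcSeries.derivative,
    h.contraction_slots_psDivDiff expBounded_sinhcSeries,
    h.inv_mul_transpose_logDerivSinhcM_mul, transpose_one, mul_one, h.inv_mul, ← neg_add,
    ← Finset.sum_add_distrib]
  congr 1
  refine Finset.sum_congr rfl fun b _ => ?_
  rw [fderivLogDerivSinhcM, ← trace_add]
  congr 1
  noncomm_ring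

theorem contraction_mul_tripleDefect (h : IsInvariantAd ad γ B) (k : n → ℝ)
    (P : Matrix (n × n × n) (n × n × n) ℝ) :
    contraction ad γ (P * tripleDefect (slotOne (ad k)) (slotTwo (ad k)) (slotThree (ad k)))
      = 0 := by
  change _ ⬝ᵥ (P * tripleDefect _ _ _) *ᵥ _ = 0
  rw [← mulVec_mulVec, tripleDefect_mulVec (commute_slotOne_slotTwo _ _)
    (commute_slotTwo_slotThree _ _) (commute_slotOne_slotThree _ _) (h.slots_mulVec_upperTensor k),
    mulVec_zero, dotProduct_zero]

theorem contraction_mixedTerm_sub (h : IsInvariantAd ad γ B) (k : n → ℝ)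
    (hS : IsUnit (sinhcM (ad k))) :
    3 * contraction ad γ (slotOne (sinhcM (ad k))⁻¹ * slotTwo (sinhcM (ad k))⁻¹
        * mixedTerm (slotOne (ad k)) (slotTwo (ad k)))
      - 3 * contraction ad γ
          (slotOne (logDerivSinhcM (ad k)) * slotTwo (logDerivSinhcM (ad k)))
      = contraction ad γ 1 := by
  have hdet := (Matrix.isUnit_iff_isUnit_det _).1 hS
  set X := ad k
  set S := sinhcM X
  set G := logDerivSinhcM X with hG
  have hs1 : sinhcM (slotOne X) = slotOne S := (slotOne_psEval expBounded_sinhcSeries _).symm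
  have hs2 : sinhcM (slotTwo X) = slotTwo S := (slotTwo_psEval expBounded_sinhcSeries _).symm
  have hs3 : sinhcM (slotThree X) = slotThree S := (slotThree_psEval expBounded_sinhcSeries _).symm
  have hd1 : dsinhcM (slotOne X) = slotOne (dsinhcM X) :=
    (slotOne_psEval expBounded_sinhcSeries.derivative _).symm
  have hd2 : dsinhcM (slotTwo X) = slotTwo (dsinhcM X) :=
    (slotTwo_psEval expBounded_sinhcSeries.derivative _).symm
  have hd3 : dsinhcM (slotThree X) = slotThree (dsinhcM X) :=
    (slotThree_psEval expBounded_sinhcSeries.derivative _).symm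
  have c12 := fun F K : Matrix n n ℝ => commute_slotOne_slotTwo F K
  have c23 := fun F K : Matrix n n ℝ => commute_slotTwo_slotThree F K
  have c13 := fun F K : Matrix n n ℝ => commute_slotOne_slotThree F K
  set p := slotOne S⁻¹ * slotTwo S⁻¹ * slotThree S⁻¹ with hp
  have hp2 : p = slotTwo S⁻¹ * slotThree S⁻¹ * slotOne S⁻¹ := by
    rw [hp, mul_assoc, ((c12 _ _).mul_right (c13 _ _)).eq]
  have hp3 : p = slotThree S⁻¹ * slotOne S⁻¹ * slotTwo S⁻¹ := by
    rw [hp, mul_assoc (slotThree _), ((c13 _ _).symm.mul_right (c23 _ _).symm).eq]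
  have i1 : slotOne S⁻¹ * slotOne S = 1 := by
    rw [← map_mul, Matrix.nonsing_inv_mul _ hdet, map_one]
  have i2 : slotTwo S⁻¹ * slotTwo S = 1 := by
    rw [← map_mul, Matrix.nonsing_inv_mul _ hdet, map_one]
  have i3 : slotThree S⁻¹ * slotThree S = 1 := by
    rw [← map_mul, Matrix.nonsing_inv_mul _ hdet, map_one]
  have m1 : p * (mixedTerm (slotOne X) (slotTwo X) * slotThree S)
      = slotOne S⁻¹ * slotTwo S⁻¹ * mixedTerm (slotOne X) (slotTwo X) :=
    mul_mul_mul_cancel_of_commute (commute_mixedTerm (c13 _ _).symm (c23 _ _).symm) i3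
  have m2 : p * (mixedTerm (slotTwo X) (slotThree X) * slotOne S)
      = slotTwo S⁻¹ * slotThree S⁻¹ * mixedTerm (slotTwo X) (slotThree X) := by
    rw [hp2]
    exact mul_mul_mul_cancel_of_commute (commute_mixedTerm (c12 _ _) (c13 _ _)) i1
  have m3 : p * (mixedTerm (slotThree X) (slotOne X) * slotTwo S)
      = slotThree S⁻¹ * slotOne S⁻¹ * mixedTerm (slotThree X) (slotOne X) := by
    rw [hp3]
    exact mul_mul_mul_cancel_of_commute (commute_mixedTerm (c23 _ _) (c12 _ _).symm) i2
  have d1 : p * (slotOne (dsinhcM X) * slotTwo (dsinhcM X) * slotThree S)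
      = slotOne G * slotTwo G := by
    rw [hp, mul_mul_mul_cancel_of_commute ((c13 _ _).symm.mul_right (c23 _ _).symm) i3, hG,
      map_mul, map_mul, (c12 _ _).symm.mul_mul_mul_comm]
  have d2 : p * (slotTwo (dsinhcM X) * slotThree (dsinhcM X) * slotOne S)
      = slotTwo G * slotThree G := by
    rw [hp2, mul_mul_mul_cancel_of_commute ((c12 _ _).mul_right (c13 _ _)) i1, hG,
      map_mul, map_mul, (c23 _ _).symm.mul_mul_mul_comm]
  have d3 : p * (slotThree (dsinhcM X) * slotOne (dsinhcM X) * slotTwo S)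
      = slotThree G * slotOne G := by
    rw [hp3, mul_mul_mul_cancel_of_commute ((c23 _ _).mul_right (c12 _ _).symm) i2, hG,
      map_mul, map_mul, (c13 _ _).mul_mul_mul_comm]
  have s1 : p * (slotOne S * slotTwo S * slotThree S) = 1 := by
    rw [hp, mul_mul_mul_cancel_of_commute ((c13 _ _).symm.mul_right (c23 _ _).symm) i3,
      (c12 _ _).symm.mul_mul_mul_comm, i1, i2, one_mul]
  have e1 : contraction ad γ (slotTwo S⁻¹ * slotThree S⁻¹ * mixedTerm (slotTwo X) (slotThree X))
      = contraction ad γ (slotOne S⁻¹ * slotTwo S⁻¹ * mixedTerm (slotOne X) (slotTwo X)) := by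
    rw [← h.contraction_slotCycle (slotOne _ * _ * _), map_mul slotCycle, map_mul slotCycle,
      slotCycle_mixedTerm,
      slotCycle_slotOne, slotCycle_slotTwo, slotCycle_slotOne, slotCycle_slotTwo]
  have e2 : contraction ad γ (slotThree S⁻¹ * slotOne S⁻¹ * mixedTerm (slotThree X) (slotOne X))
      = contraction ad γ (slotTwo S⁻¹ * slotThree S⁻¹ * mixedTerm (slotTwo X) (slotThree X)) := by
    rw [← h.contraction_slotCycle (slotTwo _ * _ * _), map_mul slotCycle, map_mul slotCycle,
      slotCycle_mixedTerm,
      slotCycle_slotTwo, slotCycle_slotThree, slotCycle_slotTwo, slotCycle_slotThree]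
  have e3 : contraction ad γ (slotTwo G * slotThree G)
      = contraction ad γ (slotOne G * slotTwo G) := by
    rw [← h.contraction_slotCycle (slotOne _ * _), map_mul slotCycle, slotCycle_slotOne,
      slotCycle_slotTwo]
  have e4 : contraction ad γ (slotThree G * slotOne G)
      = contraction ad γ (slotTwo G * slotThree G) := by
    rw [← h.contraction_slotCycle (slotTwo _ * _), map_mul slotCycle, slotCycle_slotTwo,
      slotCycle_slotThree]
  have key := h.contraction_mul_tripleDefect k p
  rw [tripleDefect, hs1, hs2, hs3, hd1, hd2, hd3] at key
  simp only [mul_add, mul_sub] at key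
  rw [m1, m2, m3, d1, d2, d3, s1] at key
  simp only [map_add, map_sub, e2, e1, e4, e3] at key
  linarith

end IsInvariantAd

end CurvatureIdentity

section CurvatureTrace

variable {n : Type*} [Fintype n] [DecidableEq n]

namespace IsInvariantAd

variable {ad : (n → ℝ) →ₗ[ℝ] Matrix n n ℝ} {γ B : Matrix n n ℝ}

theorem dotProduct_mulVec_ad_cycle (h : IsInvariantAd ad γ B) (u v w : n → ℝ) :
    u ⬝ᵥ (γ * ad v) *ᵥ w = w ⬝ᵥ (γ * ad u) *ᵥ v := by
  have h1 : ∀ x y z : n → ℝ, x ⬝ᵥ (γ * ad y) *ᵥ z = -(x ⬝ᵥ (γ * ad z) *ᵥ y) := by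
    intro x y z
    rw [← mulVec_mulVec, h.mulVec_comm, mulVec_neg, dotProduct_neg, mulVec_mulVec]
  have h2 : ∀ x y z : n → ℝ, x ⬝ᵥ (γ * ad y) *ᵥ z = -(z ⬝ᵥ (γ * ad y) *ᵥ x) := by
    intro x y z
    rw [dotProduct_mulVec, ← mulVec_transpose, h.transpose_mul_ad, dotProduct_comm, neg_mulVec,
      dotProduct_neg]
  rw [h2, h1, neg_neg]

theorem mulVec_sum_bracket (h : IsInvariantAd ad γ B) (M : Matrix n n ℝ) (i : n) :
    (γ *ᵥ ∑ b, ad (M *ᵥ (γ⁻¹ *ᵥ Pi.single b 1)) *ᵥ Pi.single b 1) i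
      = (M * ad (Pi.single i 1)).trace := by
  have h1 : (M * ad (Pi.single i 1)).trace = (γ * ad (Pi.single i 1) * (M * γ⁻¹)).trace := by
    rw [← mul_assoc, trace_mul_comm _ γ⁻¹, ← mul_assoc, ← mul_assoc, h.inv_mul, one_mul,
      trace_mul_comm]
  rw [h1, mulVec_sum, Finset.sum_apply, trace]
  refine Finset.sum_congr rfl fun b _ => ?_
  have h2 := h.dotProduct_mulVec_ad_cycle (Pi.single i 1) (M *ᵥ (γ⁻¹ *ᵥ Pi.single b 1))
    (Pi.single b 1)
  rw [single_one_dotProduct, single_one_dotProduct, ← mulVec_mulVec] at h2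
  rw [h2, mulVec_mulVec, mulVec_mulVec, mulVec_single_one, ← mul_assoc (γ * _) M]
  rfl

theorem sum_trace_mul_bracket (h : IsInvariantAd ad γ B) (M T : Matrix n n ℝ) :
    ∑ b, (T * (ad (M *ᵥ (γ⁻¹ *ᵥ Pi.single b 1)) * ad (Pi.single b 1)
        - ad (Pi.single b 1) * ad (M *ᵥ (γ⁻¹ *ᵥ Pi.single b 1)))).trace
      = ∑ b, (M * ad (Pi.single b 1)).trace * (T * ad (γ⁻¹ *ᵥ Pi.single b 1)).trace := by
  simp only [← h.ad_mulVec]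
  rw [← trace_sum, ← Finset.mul_sum, ← map_sum]
  set z := ∑ b, ad (M *ᵥ (γ⁻¹ *ᵥ Pi.single b 1)) *ᵥ Pi.single b 1 with hz
  have hz' : z = ∑ b, (M * ad (Pi.single b 1)).trace • (γ⁻¹ *ᵥ Pi.single b 1) := by
    have h1 : z = γ⁻¹ *ᵥ (γ *ᵥ z) := by rw [mulVec_mulVec, h.inv_mul, one_mulVec]
    have h2 : γ *ᵥ z = ∑ b, (M * ad (Pi.single b 1)).trace • (Pi.single b 1 : n → ℝ) := by
      ext i
      rw [h.mulVec_sum_bracket]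
      simp [Finset.sum_apply, Pi.single_apply]
    rw [h1, h2, mulVec_sum]
    simp only [mulVec_smul]
  rw [hz', map_sum, Finset.mul_sum, trace_sum]
  simp only [map_smul, mul_smul_comm, trace_smul, smul_eq_mul]

theorem contraction_one (h : IsInvariantAd ad γ B) :
    contraction ad γ 1
      = -∑ b, (ad (Pi.single b 1) * ad (γ⁻¹ *ᵥ Pi.single b 1)).trace := by
  have := h.contraction_slots 1 1 1
  simpa only [map_one, mul_one, transpose_one, one_mulVec, h.inv_mul] using this

theorem sum_trace_logDerivSinhcM_mul (h : IsInvariantAd ad γ B) (k : n → ℝ) :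
    ∑ b, (logDerivSinhcM (ad k) * ad (Pi.single b 1)).trace
        * (logDerivSinhcM (ad k) * ad (γ⁻¹ *ᵥ Pi.single b 1)).trace
      = 2 * contraction ad γ
          (slotOne (logDerivSinhcM (ad k)) * slotTwo (logDerivSinhcM (ad k))) := by
  have hG := h.inv_mul_transpose_logDerivSinhcM_mul k
  set G := logDerivSinhcM (ad k)
  have hG' : γ⁻¹ * Gᵀ = -(G * γ⁻¹) := by
    rw [← neg_mul, ← hG, mul_assoc, h.mul_inv, mul_one]
  have e : ∀ b : n, ad (γ⁻¹ *ᵥ (Gᵀ *ᵥ Pi.single b 1)) = -ad (G *ᵥ (γ⁻¹ *ᵥ Pi.single b 1)) := by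
    intro b
    rw [mulVec_mulVec, hG', neg_mulVec, map_neg, mulVec_mulVec]
  have c1 : contraction ad γ (slotTwo G * slotThree G)
      = contraction ad γ (slotOne G * slotTwo G) := by
    rw [← h.contraction_slotCycle (slotOne _ * _), map_mul slotCycle, slotCycle_slotOne,
      slotCycle_slotTwo]
  have c2 : contraction ad γ (slotOne G * slotThree G)
      = contraction ad γ (slotTwo G * slotThree G) := by
    rw [(commute_slotOne_slotThree G G).eq, ← h.contraction_slotCycle (slotTwo _ * _),
      map_mul slotCycle, slotCycle_slotTwo, slotCycle_slotThree]
  have h1 := h.contraction_slots G 1 G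
  have h2 := h.contraction_slots 1 G G
  simp only [map_one, mul_one, one_mul, transpose_one, h.inv_mul, hG, e] at h1 h2
  rw [c2, c1] at h1
  rw [c1] at h2
  rw [← h.sum_trace_mul_bracket, two_mul]
  nth_rewrite 1 [h1]
  rw [h2, ← neg_add, ← Finset.sum_add_distrib, ← Finset.sum_neg_distrib]
  refine Finset.sum_congr rfl fun b _ => ?_
  rw [mul_sub, trace_sub, ← mul_assoc G, trace_mul_comm (G * _), trace_mul_comm G (_ * _)]
  simp only [mul_neg, neg_mul, trace_neg, neg_neg, mul_assoc, sub_eq_add_neg, neg_add]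

theorem sum_trace_fderivLogDerivSinhcM (h : IsInvariantAd ad γ B) (k : n → ℝ)
    (hS : IsUnit (sinhcM (ad k))) :
    2 * ∑ b, (ad (Pi.single b 1) * fderivLogDerivSinhcM (ad k)
          (ad ((1 + ad k + ad k * logDerivSinhcM (ad k)) *ᵥ (γ⁻¹ *ᵥ Pi.single b 1)))).trace
      - ∑ b, (logDerivSinhcM (ad k) * ad (Pi.single b 1)).trace
        * (logDerivSinhcM (ad k) * ad (γ⁻¹ *ᵥ Pi.single b 1)).trace
      = 2 / 3 * ∑ b, (ad (Pi.single b 1) * ad (γ⁻¹ *ᵥ Pi.single b 1)).trace := by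
  have h1 := h.contraction_mixedTerm_sub k hS
  rw [h.contraction_mixedTerm k hS, h.contraction_one] at h1
  have h2 := h.sum_trace_logDerivSinhcM_mul k
  have h3 := h.sum_trace_mul_bracket (logDerivSinhcM (ad k)) (logDerivSinhcM (ad k))
  have h4 := h.sum_trace_mul_bracket 1 (logDerivSinhcM (ad k))
  simp only [one_mul, one_mulVec, h.trace_ad, zero_mul, Finset.sum_const_zero] at h4
  have h5 : ∀ w : n → ℝ, fderivLogDerivSinhcM (ad k)
        (ad ((1 + ad k + ad k * logDerivSinhcM (ad k)) *ᵥ w))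
      = fderivLogDerivSinhcM (ad k) (ad w)
        + (logDerivSinhcM (ad k) * ad w - ad w * logDerivSinhcM (ad k))
        + (logDerivSinhcM (ad k) * ad (logDerivSinhcM (ad k) *ᵥ w)
          - ad (logDerivSinhcM (ad k) *ᵥ w) * logDerivSinhcM (ad k)) := by
    intro w
    rw [add_mulVec, add_mulVec, one_mulVec, ← mulVec_mulVec, map_add, map_add, h.ad_mulVec,
      h.ad_mulVec, fderivLogDerivSinhcM_add, fderivLogDerivSinhcM_add,
      fderivLogDerivSinhcM_commutator hS, fderivLogDerivSinhcM_commutator hS]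
  have h6 : ∀ U V G : Matrix n n ℝ, (U * (G * V - V * G)).trace = (G * (V * U - U * V)).trace := by
    intro U V G
    rw [mul_sub, mul_sub, trace_sub, trace_sub, trace_mul_comm U, ← mul_assoc U,
      trace_mul_comm (U * V), mul_assoc]
  have h7 : ∀ b : n, (ad (Pi.single b 1) * fderivLogDerivSinhcM (ad k)
        (ad ((1 + ad k + ad k * logDerivSinhcM (ad k)) *ᵥ (γ⁻¹ *ᵥ Pi.single b 1)))).trace
      = (ad (Pi.single b 1) * fderivLogDerivSinhcM (ad k) (ad (γ⁻¹ *ᵥ Pi.single b 1))).trace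
        + (logDerivSinhcM (ad k) * (ad (γ⁻¹ *ᵥ Pi.single b 1) * ad (Pi.single b 1)
          - ad (Pi.single b 1) * ad (γ⁻¹ *ᵥ Pi.single b 1))).trace
        + (logDerivSinhcM (ad k) * (ad (logDerivSinhcM (ad k) *ᵥ (γ⁻¹ *ᵥ Pi.single b 1))
            * ad (Pi.single b 1) - ad (Pi.single b 1)
              * ad (logDerivSinhcM (ad k) *ᵥ (γ⁻¹ *ᵥ Pi.single b 1)))).trace := by
    intro b
    rw [h5, mul_add, mul_add, trace_add, trace_add, h6 _ (ad (γ⁻¹ *ᵥ _)),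
      h6 _ (ad (logDerivSinhcM (ad k) *ᵥ _))]
  rw [Finset.sum_congr rfl fun b _ => h7 b, Finset.sum_add_distrib, Finset.sum_add_distrib, h3, h4]
  linarith

end IsInvariantAd

end CurvatureTrace

section HyperbolicCotangent

variable {n : Type*} [Fintype n] [DecidableEq n]

theorem psEval_zero (φ : PowerSeries ℝ) :
    psEval φ (0 : Matrix n n ℝ) = PowerSeries.coeff 0 φ • (1 : Matrix n n ℝ) := by
  rw [psEval, tsum_eq_single 0 fun j hj => by rw [zero_pow hj, smul_zero], pow_zero]

theorem sinhcM_zero : sinhcM (0 : Matrix n n ℝ) = 1 := by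
  simp [sinhcM, psEval_zero, sinhcSeries]

theorem psEval_mul_of_mul_eq_zero {φ : PowerSeries ℝ} (h : ExpBounded φ) {Z W : Matrix n n ℝ}
    (hZW : Z * W = 0) : psEval φ Z * W = PowerSeries.coeff 0 φ • W := by
  rw [psEval_mul_eq_mul_psEval h (hZW.trans (mul_zero W).symm), psEval_zero, mul_smul_comm, mul_one]

theorem add_pow_of_mul_eq_zero {X Z : Matrix n n ℝ} (hXZ : X * Z = 0) (hZX : Z * X = 0) (j : ℕ) :
    (X + Z) ^ (j + 1) = X ^ (j + 1) + Z ^ (j + 1) := by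
  induction j with
  | zero => simp
  | succ j ih =>
    rw [pow_succ, ih, add_mul, mul_add, mul_add, pow_succ X j, pow_succ Z j, mul_assoc _ X Z,
      mul_assoc _ Z X, hXZ, hZX, mul_zero, mul_zero, add_zero, zero_add, ← pow_succ, ← pow_succ,
      ← pow_succ, ← pow_succ]

theorem sinhcM_add_of_mul_eq_zero {X Z : Matrix n n ℝ} (hXZ : X * Z = 0) (hZX : Z * X = 0) :
    sinhcM (X + Z) = sinhcM X * sinhcM Z := by
  have h0 : PowerSeries.coeff 0 sinhcSeries = 1 := by simp [sinhcSeries]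
  have h1 : sinhcM (X + Z) = sinhcM X + sinhcM Z - 1 := by
    have hs := ((Matrix.summable_psEval expBounded_sinhcSeries X).hasSum.add
      (Matrix.summable_psEval expBounded_sinhcSeries Z).hasSum).sub
      (hasSum_ite_eq 0 (1 : Matrix n n ℝ))
    refine ((Matrix.summable_psEval expBounded_sinhcSeries (X + Z)).hasSum).unique
      (hs.congr_fun fun j => ?_)
    cases j with
    | zero => simp [h0]
    | succ j => simp [add_pow_of_mul_eq_zero hXZ hZX]
  have h2 := add_mul_psDivDiff expBounded_sinhcSeries (Commute.zero_right Z)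
  rw [neg_zero, add_zero, ← sinhcM, ← sinhcM, sinhcM_zero] at h2
  have h3 : sinhcM X * (sinhcM Z - 1) = sinhcM Z - 1 := by
    rw [← h2, ← mul_assoc, psEval_mul_of_mul_eq_zero expBounded_sinhcSeries hXZ, h0, one_smul]
  rw [h1, ← sub_eq_zero]
  rw [mul_sub, mul_one] at h3
  rw [← sub_eq_zero] at h3
  rw [← neg_eq_zero, ← h3]
  abel

theorem inv_psEval_oneSubExpNegSeries {X : Matrix n n ℝ} (hS : IsUnit (sinhcM X)) :
    (psEval oneSubExpNegSeries ((2 : ℝ) • X))⁻¹ = 1 + X + X * logDerivSinhcM X := by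
  have hdet := (Matrix.isUnit_iff_isUnit_det _).1 hS
  have h1 : psEval oneSubExpNegSeries ((2 : ℝ) • X) * (expM X * (sinhcM X)⁻¹) = 1 := by
    rw [← mul_assoc, psEval_oneSubExpNegSeries_two_smul_mul, Matrix.mul_nonsing_inv _ hdet]
  have h2 : Commute (dsinhcM X) (sinhcM X)⁻¹ := commute_matrix_inv (commute_psEval_psEval _ _ _)
  rw [Matrix.inv_eq_right_inv h1, expM_eq, coshM_eq, add_mul, add_mul, mul_assoc, h2.eq,
    mul_assoc X, Matrix.mul_nonsing_inv _ hdet, mul_one, logDerivSinhcM]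
  abel

/-- The matrix function `β coth (t β)`. -/
noncomputable def cothM (t : ℝ) (β : Matrix n n ℝ) : Matrix n n ℝ :=
  t⁻¹ • (coshM (t • β) * (sinhcM (t • β))⁻¹)

theorem commute_inv_sinhcM_coshM (X : Matrix n n ℝ) : Commute (sinhcM X)⁻¹ (coshM X) :=
  (commute_matrix_inv (commute_psEval_psEval _ _ _)).symm

theorem commute_cothM (t : ℝ) (β : Matrix n n ℝ) : Commute β (cothM t β) := by
  have h : Commute β (t • β) := (Commute.refl β).smul_right t
  exact ((commute_psEval _ h).mul_right (commute_matrix_inv (commute_psEval _ h))).smul_right _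

theorem cothM_eq {t : ℝ} (ht : t ≠ 0) {β : Matrix n n ℝ} (hσ : IsUnit (sinhcM (t • β))) :
    cothM t β = t⁻¹ • 1 + β * (dsinhcM (t • β) * (sinhcM (t • β))⁻¹) := by
  have hdet := (Matrix.isUnit_iff_isUnit_det _).1 hσ
  rw [cothM, coshM_eq, add_mul, Matrix.mul_nonsing_inv _ hdet, smul_add, smul_mul_assoc,
    smul_mul_assoc, inv_smul_smul₀ ht, mul_assoc]

theorem cothM_mul_of_mul_eq_zero {t : ℝ} (ht : t ≠ 0) {β X : Matrix n n ℝ}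
    (hσ : IsUnit (sinhcM (t • β))) (h : β * X = 0) : cothM t β * X = t⁻¹ • X := by
  have h1 : Commute β (dsinhcM (t • β) * (sinhcM (t • β))⁻¹) := by
    have h : Commute β (t • β) := (Commute.refl β).smul_right t
    exact (commute_psEval _ h).mul_right (commute_matrix_inv (commute_psEval _ h))
  rw [cothM_eq ht hσ, h1.eq, add_mul, mul_assoc, h, mul_zero, add_zero, smul_mul_assoc, one_mul]

theorem hasDerivAt_trace_cothM_mul {t : ℝ} (ht : t ≠ 0) {β : Matrix n n ℝ}
    (hσ : IsUnit (sinhcM (t • β))) (M : Matrix n n ℝ) :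
    HasDerivAt (fun s => (cothM s β * M).trace)
      (((β * β - cothM t β * cothM t β) * M).trace) t := by
  have hdet := (Matrix.isUnit_iff_isUnit_det _).1 hσ
  obtain ⟨D, hD, hDv⟩ := hasFDerivAt_trace_inv_psEval_mul_psEval expBounded_coshSeries
    expBounded_sinhcSeries (LinearMap.toSpanSingleton ℝ (Matrix n n ℝ) β) M (k := t) hσ
  have h1 := (hasDerivAt_inv ht).mul hD.hasDerivAt
  have h2 : (fun s => (cothM s β * M).trace) = fun s : ℝ => s⁻¹ *
      ((sinhcM (s • β))⁻¹ * coshM (s • β) * M).trace := by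
    funext s
    rw [cothM, (commute_inv_sinhcM_coshM _).eq, smul_mul_assoc, trace_smul, smul_eq_mul]
  rw [h2]
  refine h1.congr_deriv ?_
  rw [hDv]
  simp only [LinearMap.toSpanSingleton_apply, one_smul]
  have hc : Commute β (t • β) := (Commute.refl β).smul_right t
  rw [psDivDiff_eq_of_commute _ expBounded_coshSeries.derivative expBounded_coshSeries hc,
    psDivDiff_eq_of_commute _ expBounded_sinhcSeries.derivative expBounded_sinhcSeries hc]
  have e1 : (sinhcM (t • β))⁻¹ * coshM (t • β) = t • cothM t β := by
    rw [cothM, (commute_inv_sinhcM_coshM _).eq, smul_inv_smul₀ ht]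
  have e2 : (sinhcM (t • β))⁻¹ * (psEval (PowerSeries.derivative ℝ coshSeries) (t • β) * β)
      = t • (β * β) := by
    rw [derivative_coshSeries, psEval_mul expBounded_X expBounded_sinhcSeries, psEval_X,
      (commute_psEval sinhcSeries (Commute.refl (t • β))).eq, ← mul_assoc, ← mul_assoc,
      Matrix.nonsing_inv_mul _ hdet, one_mul, smul_mul_assoc]
  have e3 : (sinhcM (t • β))⁻¹ * (dsinhcM (t • β) * β) = cothM t β - t⁻¹ • 1 := by
    rw [cothM_eq ht hσ, add_sub_cancel_left, ← mul_assoc,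
      ((commute_matrix_inv (commute_psEval sinhcSeries hc)).mul_right
        (commute_psEval _ hc)).eq.symm,
      (commute_matrix_inv (commute_psEval_psEval (PowerSeries.derivative ℝ sinhcSeries)
        sinhcSeries (t • β))).eq]
  rw [e1, e2, e3]
  simp only [sub_mul, smul_mul_assoc, mul_smul_comm, one_mul, trace_sub, trace_smul, smul_eq_mul]
  field_simp
  ring

theorem hasDerivAt_det_sinhcM_smul {t : ℝ} (ht : t ≠ 0) {β : Matrix n n ℝ}
    (hσ : IsUnit (sinhcM (t • β))) :
    HasDerivAt (fun s : ℝ => (sinhcM (s • β)).det)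
      ((sinhcM (t • β)).det * ((cothM t β).trace - Fintype.card n * t⁻¹)) t := by
  obtain ⟨D, hD, hDv⟩ := hasFDerivAt_det_psEval expBounded_sinhcSeries
    expBounded_sinhcSeries.derivative (LinearMap.toSpanSingleton ℝ (Matrix n n ℝ) β) (k := t) hσ
  refine hD.hasDerivAt.congr_deriv ?_
  rw [hDv, cothM_eq ht hσ]
  simp only [LinearMap.toSpanSingleton_apply, one_smul]
  rw [trace_add, trace_smul, trace_one, trace_mul_comm β, smul_eq_mul]
  ring

end HyperbolicCotangent

section CasimirSymbol

variable {n : Type*} [Fintype n] [DecidableEq n]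

theorem logDerivSinhcM_comm (X : Matrix n n ℝ) : Commute X (logDerivSinhcM X) :=
  (commute_matrix_inv (commute_psEval _ (Commute.refl X))).mul_right
    (commute_psEval _ (Commute.refl X))

namespace IsInvariantAd

variable {ad : (n → ℝ) →ₗ[ℝ] Matrix n n ℝ} {γ B : Matrix n n ℝ}

theorem mul_inv_mul (h : IsInvariantAd ad γ B) (M : Matrix n n ℝ) : γ * (γ⁻¹ * M) = M := by
  rw [← mul_assoc, h.mul_inv, one_mul]

theorem inv_mul_mul_ad (h : IsInvariantAd ad γ B) (v : n → ℝ) : γ⁻¹ * B * ad v = 0 := by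
  rw [mul_assoc, h.mul_ad_eq_zero, mul_zero]

theorem trace_inv_mul (h : IsInvariantAd ad γ B) : (γ⁻¹ * B).trace = 0 := by
  have h1 := trace_transpose (γ⁻¹ * B)
  rw [transpose_mul, h.skew, h.inv_symm, neg_mul, trace_neg, trace_mul_comm] at h1
  linarith

theorem transpose_psEval_mul (h : IsInvariantAd ad γ B) {φ : PowerSeries ℝ} (hφ : ExpBounded φ)
    (t : ℝ) : (psEval φ (t • (γ⁻¹ * B)))ᵀ * γ = γ * psEval φ (-(t • (γ⁻¹ * B))) := by
  rw [← psEval_transpose]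
  refine psEval_mul_eq_mul_psEval hφ ?_
  rw [transpose_smul, transpose_mul, h.skew, h.inv_symm, smul_mul_assoc, mul_assoc, h.inv_mul,
    mul_one, smul_neg, mul_neg, mul_smul_comm, h.mul_inv_mul]

theorem transpose_mul_cothM (h : IsInvariantAd ad γ B) (t : ℝ) :
    (γ * cothM t (γ⁻¹ * B))ᵀ = γ * cothM t (γ⁻¹ * B) := by
  have hγ := (Matrix.isUnit_iff_isUnit_det γ).1 h.isUnit
  have h1 := h.transpose_psEval_mul expBounded_coshSeries t
  have h2 := h.transpose_psEval_mul expBounded_sinhcSeries t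
  rw [← coshM, ← coshM, coshM_neg] at h1
  rw [← sinhcM, ← sinhcM, sinhcM_neg] at h2
  have h3 : (sinhcM (t • (γ⁻¹ * B)))⁻¹ᵀ * γ = γ * (sinhcM (t • (γ⁻¹ * B)))⁻¹ := by
    have h4 : (sinhcM (t • (γ⁻¹ * B)))ᵀ = γ * sinhcM (t • (γ⁻¹ * B)) * γ⁻¹ := by
      rw [← h2, mul_assoc, h.mul_inv, mul_one]
    rw [Matrix.transpose_nonsing_inv, h4, Matrix.mul_inv_rev, Matrix.mul_inv_rev,
      Matrix.nonsing_inv_nonsing_inv _ hγ, mul_assoc, mul_assoc, h.inv_mul, mul_one]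
  rw [transpose_mul, h.symm, cothM, transpose_smul, smul_mul_assoc, mul_smul_comm, transpose_mul,
    mul_assoc, h1, ← mul_assoc, h3, mul_assoc, (commute_inv_sinhcM_coshM _).eq]

theorem ad_cothM_mulVec (h : IsInvariantAd ad γ B) {t : ℝ} (ht : t ≠ 0)
    (hσ : IsUnit (sinhcM (t • (γ⁻¹ * B)))) (v : n → ℝ) :
    ad (cothM t (γ⁻¹ * B) *ᵥ v) = t⁻¹ • ad v := by
  rw [cothM_eq ht hσ, add_mulVec, smul_mulVec, one_mulVec, ← mulVec_mulVec, map_add, map_smul,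
    h.ad_inv_mul_mulVec, add_zero]

theorem cothM_add_mul_ad (h : IsInvariantAd ad γ B) {t : ℝ} (ht : t ≠ 0)
    (hσ : IsUnit (sinhcM (t • (γ⁻¹ * B)))) (v : n → ℝ) :
    (cothM t (γ⁻¹ * B) + γ⁻¹ * B) * ad v = t⁻¹ • ad v := by
  rw [add_mul, cothM_mul_of_mul_eq_zero ht hσ (h.inv_mul_mul_ad v), h.inv_mul_mul_ad, add_zero]

theorem dotProduct_trace_mul_ad (M : Matrix n n ℝ) (v : n → ℝ) :
    (fun b => (M * ad (Pi.single b 1)).trace) ⬝ᵥ v = (M * ad v).trace := by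
  have hv : v = ∑ b, v b • (Pi.single b 1 : n → ℝ) := by
    ext i
    simp [Finset.sum_apply, Pi.single_apply]
  conv_rhs => rw [hv, map_sum, Finset.mul_sum, trace_sum]
  simp only [map_smul, mul_smul_comm, trace_smul, smul_eq_mul, dotProduct, mul_comm]

theorem sum_mulVec_inv_apply (h : IsInvariantAd ad γ B) (M : Matrix n n ℝ) :
    ∑ b, ((γ * M) *ᵥ (γ⁻¹ *ᵥ Pi.single b 1)) b = M.trace := by
  have h1 : M.trace = (γ * M * γ⁻¹).trace := by
    rw [trace_mul_comm, ← mul_assoc, h.inv_mul, one_mul]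
  rw [h1, trace]
  refine Finset.sum_congr rfl fun b _ => ?_
  rw [mulVec_mulVec, mulVec_single_one]
  rfl

theorem dotProduct_inv_mulVec_comm (h : IsInvariantAd ad γ B) (u v : n → ℝ) :
    u ⬝ᵥ γ⁻¹ *ᵥ v = v ⬝ᵥ γ⁻¹ *ᵥ u := by
  rw [dotProduct_mulVec, ← mulVec_transpose, h.inv_symm, dotProduct_comm]

theorem dotProduct_inv_mulVec_gradient (h : IsInvariantAd ad γ B) {t : ℝ} (k : n → ℝ) :
    ((γ * cothM t (γ⁻¹ * B) + B) *ᵥ k) ⬝ᵥ γ⁻¹ *ᵥ ((γ * cothM t (γ⁻¹ * B) + B) *ᵥ k)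
      = -(k ⬝ᵥ (γ * ((γ⁻¹ * B) * (γ⁻¹ * B) - cothM t (γ⁻¹ * B) * cothM t (γ⁻¹ * B))) *ᵥ k) := by
  have h1 : (γ * cothM t (γ⁻¹ * B) + B)ᵀ = γ * cothM t (γ⁻¹ * B) - B := by
    rw [transpose_add, h.transpose_mul_cothM, h.skew, sub_eq_add_neg]
  have h2 : γ⁻¹ * (γ * cothM t (γ⁻¹ * B) + B) = cothM t (γ⁻¹ * B) + γ⁻¹ * B := by
    rw [mul_add, ← mul_assoc, h.inv_mul, one_mul]
  have h3 : (γ * cothM t (γ⁻¹ * B) - B) = γ * (cothM t (γ⁻¹ * B) - γ⁻¹ * B) := by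
    rw [mul_sub, h.mul_inv_mul]
  rw [dotProduct_comm, dotProduct_mulVec, ← mulVec_transpose, h1, mulVec_mulVec, mulVec_mulVec,
    mul_assoc, h2, h3, mul_assoc, dotProduct_comm, ← dotProduct_neg, ← neg_mulVec, ← mul_neg,
    neg_sub, (commute_cothM t (γ⁻¹ * B)).symm.mul_self_sub_mul_self_eq']

theorem casimirSymbol_eq (h : IsInvariantAd ad γ B) {t : ℝ} (ht : t ≠ 0)
    (hσ : IsUnit (sinhcM (t • (γ⁻¹ * B)))) (k : n → ℝ)
    (hS : IsUnit (sinhcM (ad ((1 / 2 : ℝ) • k)))) (w : n → ℝ)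
    (hw : ∀ b, w b = -(1 / 4) * (logDerivSinhcM (ad ((1 / 2 : ℝ) • k)) * ad (Pi.single b 1)).trace
      - 1 / 2 * ((γ * cothM t (γ⁻¹ * B) + B) *ᵥ k) b) :
    w ⬝ᵥ γ⁻¹ *ᵥ w
      + ∑ b, (-(1 / 8) * (ad (Pi.single b 1) * fderivLogDerivSinhcM (ad ((1 / 2 : ℝ) • k))
          (ad ((1 + ad ((1 / 2 : ℝ) • k) + ad ((1 / 2 : ℝ) • k)
            * logDerivSinhcM (ad ((1 / 2 : ℝ) • k))) *ᵥ (γ⁻¹ *ᵥ Pi.single b 1)))).trace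
        - 1 / 2 * ((γ * cothM t (γ⁻¹ * B) + B) *ᵥ ((1 + ad ((1 / 2 : ℝ) • k)
            + ad ((1 / 2 : ℝ) • k) * logDerivSinhcM (ad ((1 / 2 : ℝ) • k)))
              *ᵥ (γ⁻¹ *ᵥ Pi.single b 1))) b)
      = -(1 / 2) * (cothM t (γ⁻¹ * B)).trace
        - 1 / 4 * (k ⬝ᵥ (γ * ((γ⁻¹ * B) * (γ⁻¹ * B)
            - cothM t (γ⁻¹ * B) * cothM t (γ⁻¹ * B))) *ᵥ k)
        - 1 / 24 * ∑ b, (ad (Pi.single b 1) * ad (γ⁻¹ *ᵥ Pi.single b 1)).trace := by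
  set κ := (1 / 2 : ℝ) • k with hκ
  set q := cothM t (γ⁻¹ * B) with hq
  have hcurv := h.sum_trace_fderivLogDerivSinhcM κ hS
  set g : n → ℝ := fun b => (logDerivSinhcM (ad κ) * ad (Pi.single b 1)).trace with hg
  set r : n → ℝ := (γ * q + B) *ᵥ k with hr
  have hwg : w = (-(1 / 4) : ℝ) • g - (1 / 2 : ℝ) • r := by
    ext b
    simp [hw, hg]
  have hγB : γ * q + B = γ * (q + γ⁻¹ * B) := by rw [mul_add, h.mul_inv_mul]
  have hrg : r ⬝ᵥ γ⁻¹ *ᵥ g = g ⬝ᵥ γ⁻¹ *ᵥ r :=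
    h.dotProduct_inv_mulVec_comm _ _
  have hgg : g ⬝ᵥ γ⁻¹ *ᵥ g = ∑ b, (logDerivSinhcM (ad κ) * ad (Pi.single b 1)).trace
        * (logDerivSinhcM (ad κ) * ad (γ⁻¹ *ᵥ Pi.single b 1)).trace := by
    refine Finset.sum_congr rfl fun b _ => ?_
    congr 1
    rw [← dotProduct_trace_mul_ad, ← h.dotProduct_inv_mulVec_comm, single_one_dotProduct]
  have hgr : g ⬝ᵥ γ⁻¹ *ᵥ r = 2 * t⁻¹ * (ad κ * logDerivSinhcM (ad κ)).trace := by
    have e1 : γ⁻¹ *ᵥ r = (q + γ⁻¹ * B) *ᵥ k := by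
      rw [hr, hγB, mulVec_mulVec, ← mul_assoc, h.inv_mul, one_mul]
    rw [e1, hg, dotProduct_trace_mul_ad, add_mulVec, map_add, h.ad_inv_mul_mulVec, add_zero, hq,
      h.ad_cothM_mulVec ht hσ, trace_mul_comm (ad κ), hκ, map_smul]
    simp only [mul_smul_comm, trace_smul, smul_eq_mul]
    ring
  have hrr : r ⬝ᵥ γ⁻¹ *ᵥ r = _ := h.dotProduct_inv_mulVec_gradient k
  have hlin : ∑ b, ((γ * q + B) *ᵥ ((1 + ad κ + ad κ * logDerivSinhcM (ad κ))
        *ᵥ (γ⁻¹ *ᵥ Pi.single b 1))) b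
      = q.trace + t⁻¹ * (ad κ * logDerivSinhcM (ad κ)).trace := by
    have e1 : ∀ b : n, ((γ * q + B) *ᵥ ((1 + ad κ + ad κ * logDerivSinhcM (ad κ))
        *ᵥ (γ⁻¹ *ᵥ Pi.single b 1))) b = ((γ * ((q + γ⁻¹ * B) * (1 + ad κ + ad κ
          * logDerivSinhcM (ad κ)))) *ᵥ (γ⁻¹ *ᵥ Pi.single b 1)) b := by
      intro b
      rw [mulVec_mulVec, hγB, mul_assoc γ]
    rw [Finset.sum_congr rfl fun b _ => e1 b, h.sum_mulVec_inv_apply, mul_add, mul_add, mul_one,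
      ← mul_assoc, hq, h.cothM_add_mul_ad ht hσ, trace_add, trace_add, trace_add, h.trace_inv_mul,
      smul_mul_assoc, trace_smul, trace_smul, h.trace_ad, smul_eq_mul, smul_eq_mul]
    ring
  rw [Finset.sum_sub_distrib, ← Finset.mul_sum, ← Finset.mul_sum, hlin, hwg]
  simp only [mulVec_sub, mulVec_smul, dotProduct_sub, sub_dotProduct, dotProduct_smul,
    smul_dotProduct, smul_eq_mul, hrg, hgr, hrr]
  rw [hgg]
  linarith

end IsInvariantAd

end CasimirSymbol

section Gradient

variable {n : Type*} [Fintype n]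

theorem hasFDerivAt_quadratic {M : Matrix n n ℝ} (hM : Mᵀ = M) (k : n → ℝ) :
    ∃ D : (n → ℝ) →L[ℝ] ℝ, HasFDerivAt (fun k : n → ℝ => k ⬝ᵥ M *ᵥ k) D k ∧
      ∀ v, D v = 2 * (k ⬝ᵥ M *ᵥ v) := by
  have h1 : ∀ i, HasFDerivAt (fun k : n → ℝ => (M *ᵥ k) i)
      (ContinuousLinearMap.proj i ∘L M.mulVecLin.toContinuousLinearMap) k := fun i =>
    (ContinuousLinearMap.proj (R := ℝ) (φ := fun _ : n => ℝ) i
      ∘L M.mulVecLin.toContinuousLinearMap).hasFDerivAt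
  have h2 := HasFDerivAt.fun_sum (u := Finset.univ) fun i _ =>
    (hasFDerivAt_apply (𝕜 := ℝ) (F' := fun _ : n => ℝ) i k).mul (h1 i)
  refine ⟨_, h2, fun v => ?_⟩
  have h3 : (M *ᵥ k) ⬝ᵥ v = k ⬝ᵥ M *ᵥ v := by
    rw [dotProduct_mulVec, ← mulVec_transpose, hM]
  rw [two_mul]
  nth_rewrite 2 [← h3]
  simp [dotProduct, Finset.sum_add_distrib]

variable [DecidableEq n]

theorem psDivDiff_smul {φ : PowerSeries ℝ} (h : ExpBounded φ) (X : Matrix n n ℝ) (c : ℝ)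
    (V Y : Matrix n n ℝ) : psDivDiff φ X (c • V) Y = c • psDivDiff φ X V Y := by
  refine (((Matrix.hasSum_psDivDiff h X V Y).const_smul c).unique
    ((Matrix.hasSum_psDivDiff h X (c • V) Y).congr_fun fun j => ?_)).symm
  simp only [mul_smul_comm, smul_mul_assoc, ← Finset.smul_sum]
  rw [smul_comm]

theorem fderivLogDerivSinhcM_smul (X : Matrix n n ℝ) (c : ℝ) (V : Matrix n n ℝ) :
    fderivLogDerivSinhcM X (c • V) = c • fderivLogDerivSinhcM X V := by
  simp only [fderivLogDerivSinhcM, psDivDiff_smul expBounded_sinhcSeries,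
    psDivDiff_smul expBounded_sinhcSeries.derivative, mul_smul_comm, smul_mul_assoc, smul_sub]

variable (ad : (n → ℝ) →ₗ[ℝ] Matrix n n ℝ)

theorem hasFDerivAt_gaussian {M : Matrix n n ℝ} (hM : Mᵀ = M) {d : ℝ} (a c : ℝ) {k : n → ℝ}
    (hk : 0 < (sinhcM (ad ((1 / 2 : ℝ) • k))).det * d) :
    ∃ D : (n → ℝ) →L[ℝ] ℝ,
      HasFDerivAt (fun k : n → ℝ => a * ((sinhcM (ad ((1 / 2 : ℝ) • k))).det * d) ^ (-(1 : ℝ) / 2)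
        * Real.exp (-(1 / 4) * (k ⬝ᵥ M *ᵥ k) + c)) D k ∧
      ∀ v, D v = a * ((sinhcM (ad ((1 / 2 : ℝ) • k))).det * d) ^ (-(1 : ℝ) / 2)
        * Real.exp (-(1 / 4) * (k ⬝ᵥ M *ᵥ k) + c)
        * (-(1 / 4) * (logDerivSinhcM (ad ((1 / 2 : ℝ) • k)) * ad v).trace
          - 1 / 2 * (k ⬝ᵥ M *ᵥ v)) := by
  have hdet : (sinhcM (ad ((1 / 2 : ℝ) • k))).det ≠ 0 := (left_ne_zero_of_mul hk.ne')
  have hd : d ≠ 0 := right_ne_zero_of_mul hk.ne'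
  have hS : IsUnit (sinhcM (((1 / 2 : ℝ) • ad) k)) := by
    rw [LinearMap.smul_apply, ← map_smul, Matrix.isUnit_iff_isUnit_det]
    exact hdet.isUnit
  obtain ⟨D₁, hD₁, hD₁v⟩ := hasFDerivAt_det_psEval expBounded_sinhcSeries
    expBounded_sinhcSeries.derivative ((1 / 2 : ℝ) • ad) hS
  obtain ⟨D₂, hD₂, hD₂v⟩ := hasFDerivAt_quadratic hM k
  simp only [LinearMap.smul_apply, ← map_smul] at hD₁ hD₁v
  have h1 := ((hD₁.mul_const d).rpow_const (p := -(1 : ℝ) / 2) (Or.inl hk.ne')).const_mul a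
  have h2 := ((hD₂.const_mul (-(1 / 4) : ℝ)).add_const c).exp
  refine ⟨_, h1.mul h2, fun v => ?_⟩
  have h3 : Commute (dsinhcM (ad ((1 / 2 : ℝ) • k))) (sinhcM (ad ((1 / 2 : ℝ) • k)))⁻¹ :=
    commute_matrix_inv (commute_psEval_psEval _ _ _)
  simp only [_root_.add_apply, _root_.smul_apply, smul_eq_mul, hD₁v, hD₂v, Real.rpow_sub_one hk.ne']
  rw [h3.eq, map_smul ad _ v, mul_smul_comm, trace_smul, smul_eq_mul, ← logDerivSinhcM]
  field_simp
  ring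

theorem hasFDerivAt_logGradient (M T : Matrix n n ℝ) (b : n) {k : n → ℝ}
    (hS : IsUnit (sinhcM (ad ((1 / 2 : ℝ) • k)))) :
    ∃ D : (n → ℝ) →L[ℝ] ℝ,
      HasFDerivAt (fun k : n → ℝ => -(1 / 4) * (logDerivSinhcM (ad ((1 / 2 : ℝ) • k)) * T).trace
        - 1 / 2 * (M *ᵥ k) b) D k ∧
      ∀ v, D v = -(1 / 8) * (T * fderivLogDerivSinhcM (ad ((1 / 2 : ℝ) • k)) (ad v)).trace
        - 1 / 2 * (M *ᵥ v) b := by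
  have hS' : IsUnit (sinhcM (((1 / 2 : ℝ) • ad) k)) := by
    rwa [LinearMap.smul_apply, ← map_smul]
  obtain ⟨D₁, hD₁, hD₁v⟩ := hasFDerivAt_trace_inv_psEval_mul_psEval
    expBounded_sinhcSeries.derivative expBounded_sinhcSeries ((1 / 2 : ℝ) • ad) T hS'
  simp only [LinearMap.smul_apply, ← map_smul] at hD₁ hD₁v
  have h1 : HasFDerivAt (fun k : n → ℝ => (M *ᵥ k) b)
      (ContinuousLinearMap.proj b ∘L M.mulVecLin.toContinuousLinearMap) k :=
    (ContinuousLinearMap.proj (R := ℝ) (φ := fun _ : n => ℝ) b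
      ∘L M.mulVecLin.toContinuousLinearMap).hasFDerivAt
  refine ⟨_, (hD₁.const_mul (-(1 / 4) : ℝ)).sub (h1.const_mul (1 / 2 : ℝ)), fun v => ?_⟩
  have h2 : D₁ v = 1 / 2 * (T * fderivLogDerivSinhcM (ad ((1 / 2 : ℝ) • k)) (ad v)).trace := by
    rw [hD₁v, ← logDerivSinhcM, ← fderivLogDerivSinhcM, map_smul ad _ v, fderivLogDerivSinhcM_smul,
      smul_mul_assoc, trace_smul, trace_mul_comm, smul_eq_mul]
  simp only [_root_.sub_apply, _root_.smul_apply, smul_eq_mul, h2]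
  simp
  ring

variable {ad}

namespace IsInvariantAd

variable {γ B : Matrix n n ℝ}

theorem trace_logDerivSinhcM_mul_ad_frame (h : IsInvariantAd ad γ B) (k v : n → ℝ) :
    (logDerivSinhcM (ad k) * ad ((1 + ad k + ad k * logDerivSinhcM (ad k)) *ᵥ v)).trace
      = (logDerivSinhcM (ad k) * ad v).trace := by
  have h1 : ∀ w, (logDerivSinhcM (ad k) * ad (ad k *ᵥ w)).trace = 0 := by
    intro w
    rw [h.ad_mulVec, mul_sub, trace_sub, ← mul_assoc, ← (logDerivSinhcM_comm (ad k)).eq, mul_assoc,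
      trace_mul_comm, mul_assoc, sub_self]
  rw [add_mulVec, add_mulVec, one_mulVec, ← mulVec_mulVec, map_add, map_add, mul_add, mul_add,
    trace_add, trace_add, h1, h1, add_zero, add_zero]

theorem dotProduct_cothM_mulVec_frame (h : IsInvariantAd ad γ B) {t : ℝ} (ht : t ≠ 0)
    (hσ : IsUnit (sinhcM (t • (γ⁻¹ * B)))) (k v : n → ℝ) :
    k ⬝ᵥ (γ * cothM t (γ⁻¹ * B)) *ᵥ ((1 + ad ((1 / 2 : ℝ) • k)
        + ad ((1 / 2 : ℝ) • k) * logDerivSinhcM (ad ((1 / 2 : ℝ) • k))) *ᵥ v)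
      = k ⬝ᵥ (γ * cothM t (γ⁻¹ * B)) *ᵥ v := by
  have h1 : ∀ w, k ⬝ᵥ (γ * cothM t (γ⁻¹ * B)) *ᵥ (ad ((1 / 2 : ℝ) • k) *ᵥ w) = 0 := by
    intro w
    rw [mulVec_mulVec, mul_assoc, cothM_mul_of_mul_eq_zero ht hσ (h.inv_mul_mul_ad _),
      mul_smul_comm, h.mul_ad, dotProduct_mulVec, ← mulVec_transpose, transpose_smul,
      transpose_neg, transpose_mul, transpose_transpose, h.symm, smul_mulVec, neg_mulVec,
      ← mulVec_mulVec, map_smul, smul_mulVec, h.ad_mulVec_self]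
    simp
  rw [add_mulVec, add_mulVec, one_mulVec, mulVec_add, mulVec_add, dotProduct_add, dotProduct_add,
    ← mulVec_mulVec v (ad ((1 / 2 : ℝ) • k)), h1, h1, add_zero, add_zero]

end IsInvariantAd

end Gradient

section HeatEquation

variable {N : ℕ}

theorem covVecFieldOp_eq_of_hasFDerivAt {Xe : (Fin N → ℝ) → Fin N → Fin N → ℝ}
    (B : Matrix (Fin N) (Fin N) ℝ) (A : Fin N) {f : (Fin N → ℝ) → ℝ} {k : Fin N → ℝ}
    {D : (Fin N → ℝ) →L[ℝ] ℝ} (hf : HasFDerivAt f D k) :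
    covVecFieldOp Xe B A f k = D (Xe k A) - 1 / 2 * (B *ᵥ k) A * f k := by
  rw [covVecFieldOp, hf.fderiv]
  congr 1
  conv_rhs => rw [← Finset.univ_sum_single (Xe k A)]
  rw [map_sum]
  refine Finset.sum_congr rfl fun M _ => ?_
  rw [← smul_eq_mul, ← map_smul, ← Pi.single_smul, smul_eq_mul, mul_one]

theorem covVecFieldOp_congr {Xe : (Fin N → ℝ) → Fin N → Fin N → ℝ}
    (B : Matrix (Fin N) (Fin N) ℝ) (A : Fin N) {f g : (Fin N → ℝ) → ℝ} {k : Fin N → ℝ}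
    (hfg : f =ᶠ[nhds k] g) : covVecFieldOp Xe B A f k = covVecFieldOp Xe B A g k := by
  rw [covVecFieldOp, covVecFieldOp, hfg.fderiv_eq, hfg.eq_of_nhds]

theorem sum_sum_mul_mul_add_eq (γ' : Matrix (Fin N) (Fin N) ℝ) (w : Fin N → ℝ)
    (D : Fin N → (Fin N → ℝ) →L[ℝ] ℝ) (E : Matrix (Fin N) (Fin N) ℝ) (F : ℝ) :
    ∑ a, ∑ b, γ' a b * (F * (w a * w b + D b (E *ᵥ Pi.single a 1)))
      = F * (w ⬝ᵥ γ' *ᵥ w + ∑ b, D b (E *ᵥ (γ' *ᵥ Pi.single b 1))) := by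
  have h1 : ∀ b, D b (E *ᵥ (γ' *ᵥ Pi.single b 1))
      = ∑ a, γ' a b * D b (E *ᵥ Pi.single a 1) := by
    intro b
    conv_lhs => rw [← Finset.univ_sum_single (γ' *ᵥ Pi.single b 1)]
    rw [mulVec_sum, map_sum]
    refine Finset.sum_congr rfl fun a _ => ?_
    rw [← smul_eq_mul, ← map_smul, ← mulVec_smul, ← Pi.single_smul, smul_eq_mul, mul_one,
      mulVec_single_one, col_apply]
  simp only [h1, mul_add, Finset.sum_add_distrib, dotProduct, mulVec, Finset.mul_sum]
  congr 1
  · refine Finset.sum_congr rfl fun a _ => Finset.sum_congr rfl fun b _ => ?_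
    ring
  · rw [Finset.sum_comm]
    refine Finset.sum_congr rfl fun a _ => Finset.sum_congr rfl fun b _ => ?_
    ring

namespace IsInvariantAd

variable {ad : (Fin N → ℝ) →ₗ[ℝ] Matrix (Fin N) (Fin N) ℝ} {γ B : Matrix (Fin N) (Fin N) ℝ}

theorem covVecFieldOp_gaussian (h : IsInvariantAd ad γ B) {t : ℝ} (ht : t ≠ 0)
    (hσ : IsUnit (sinhcM (t • (γ⁻¹ * B)))) {Xe : (Fin N → ℝ) → Fin N → Fin N → ℝ} {k : Fin N → ℝ}
    (a c : ℝ) {d : ℝ} (hk : 0 < (sinhcM (ad ((1 / 2 : ℝ) • k))).det * d) (A : Fin N)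
    (hXe : Xe k A = (1 + ad ((1 / 2 : ℝ) • k)
      + ad ((1 / 2 : ℝ) • k) * logDerivSinhcM (ad ((1 / 2 : ℝ) • k))) *ᵥ Pi.single A 1) :
    covVecFieldOp Xe B A (fun k : Fin N → ℝ =>
        a * ((sinhcM (ad ((1 / 2 : ℝ) • k))).det * d) ^ (-(1 : ℝ) / 2)
        * Real.exp (-(1 / 4) * (k ⬝ᵥ (γ * cothM t (γ⁻¹ * B)) *ᵥ k) + c)) k
      = a * ((sinhcM (ad ((1 / 2 : ℝ) • k))).det * d) ^ (-(1 : ℝ) / 2)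
        * Real.exp (-(1 / 4) * (k ⬝ᵥ (γ * cothM t (γ⁻¹ * B)) *ᵥ k) + c)
        * (-(1 / 4) * (logDerivSinhcM (ad ((1 / 2 : ℝ) • k)) * ad (Pi.single A 1)).trace
          - 1 / 2 * ((γ * cothM t (γ⁻¹ * B) + B) *ᵥ k) A) := by
  obtain ⟨D, hD, hDv⟩ := hasFDerivAt_gaussian ad (h.transpose_mul_cothM t) a c hk
  have h1 : k ⬝ᵥ (γ * cothM t (γ⁻¹ * B)) *ᵥ Pi.single A 1
      = ((γ * cothM t (γ⁻¹ * B)) *ᵥ k) A := by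
    rw [dotProduct_mulVec, ← mulVec_transpose, h.transpose_mul_cothM t, dotProduct_single_one]
  have h2 : (logDerivSinhcM (ad ((1 / 2 : ℝ) • k)) * ad ((1 + ad ((1 / 2 : ℝ) • k)
      + ad ((1 / 2 : ℝ) • k) * logDerivSinhcM (ad ((1 / 2 : ℝ) • k))) *ᵥ Pi.single A 1)).trace
      = (logDerivSinhcM (ad ((1 / 2 : ℝ) • k)) * ad (Pi.single A 1)).trace :=
    h.trace_logDerivSinhcM_mul_ad_frame _ _
  rw [covVecFieldOp_eq_of_hasFDerivAt B A hD, hDv, hXe, h2,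
    h.dotProduct_cothM_mulVec_frame ht hσ, h1, add_mulVec, Pi.add_apply]
  ring

theorem covCasimirOp_gaussian (h : IsInvariantAd ad γ B) {t : ℝ} (ht : t ≠ 0)
    (hσ : IsUnit (sinhcM (t • (γ⁻¹ * B)))) {Xe : (Fin N → ℝ) → Fin N → Fin N → ℝ}
    (hXe : ∀ k A, IsUnit (sinhcM (ad ((1 / 2 : ℝ) • k))) → Xe k A = (1 + ad ((1 / 2 : ℝ) • k)
      + ad ((1 / 2 : ℝ) • k) * logDerivSinhcM (ad ((1 / 2 : ℝ) • k))) *ᵥ Pi.single A 1)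
    {k : Fin N → ℝ} (a c : ℝ) {d : ℝ} (hk : 0 < (sinhcM (ad ((1 / 2 : ℝ) • k))).det * d) :
    covCasimirOp γ⁻¹ Xe B (fun k : Fin N → ℝ =>
        a * ((sinhcM (ad ((1 / 2 : ℝ) • k))).det * d) ^ (-(1 : ℝ) / 2)
        * Real.exp (-(1 / 4) * (k ⬝ᵥ (γ * cothM t (γ⁻¹ * B)) *ᵥ k) + c)) k
      = a * ((sinhcM (ad ((1 / 2 : ℝ) • k))).det * d) ^ (-(1 : ℝ) / 2)
        * Real.exp (-(1 / 4) * (k ⬝ᵥ (γ * cothM t (γ⁻¹ * B)) *ᵥ k) + c)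
        * (-(1 / 2) * (cothM t (γ⁻¹ * B)).trace
          - 1 / 4 * (k ⬝ᵥ (γ * ((γ⁻¹ * B) * (γ⁻¹ * B)
            - cothM t (γ⁻¹ * B) * cothM t (γ⁻¹ * B))) *ᵥ k)
          - 1 / 24 * ∑ b, (ad (Pi.single b 1) * ad (γ⁻¹ *ᵥ Pi.single b 1)).trace) := by
  have hunit : ∀ k : Fin N → ℝ, 0 < (sinhcM (ad ((1 / 2 : ℝ) • k))).det * d →
      IsUnit (sinhcM (ad ((1 / 2 : ℝ) • k))) := fun k hk =>
    (Matrix.isUnit_iff_isUnit_det _).2 (left_ne_zero_of_mul hk.ne').isUnit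
  have hcont : Continuous fun k : Fin N → ℝ => (sinhcM (ad ((1 / 2 : ℝ) • k))).det * d :=
    (((continuous_psEval expBounded_sinhcSeries).comp
      (ad.continuous_of_finiteDimensional.comp (continuous_const_smul (1 / 2 : ℝ)))).matrix_det).mul
        continuous_const
  set F : (Fin N → ℝ) → ℝ := fun k =>
    a * ((sinhcM (ad ((1 / 2 : ℝ) • k))).det * d) ^ (-(1 : ℝ) / 2)
      * Real.exp (-(1 / 4) * (k ⬝ᵥ (γ * cothM t (γ⁻¹ * B)) *ᵥ k) + c)
  set w : (Fin N → ℝ) → Fin N → ℝ := fun k b =>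
    -(1 / 4) * (logDerivSinhcM (ad ((1 / 2 : ℝ) • k)) * ad (Pi.single b 1)).trace
      - 1 / 2 * ((γ * cothM t (γ⁻¹ * B) + B) *ᵥ k) b
  have hJ : ∀ b, covVecFieldOp Xe B b F =ᶠ[nhds k] fun k => F k * w k b := by
    intro b
    filter_upwards [(isOpen_lt continuous_const hcont).mem_nhds hk] with x hx
    exact h.covVecFieldOp_gaussian ht hσ a c hx b (hXe x b (hunit x hx))
  obtain ⟨DF, hDF, -⟩ := hasFDerivAt_gaussian ad (h.transpose_mul_cothM t) a c hk
  choose Dw hDw hDwv using fun b => hasFDerivAt_logGradient ad (γ * cothM t (γ⁻¹ * B) + B)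
    (ad (Pi.single b 1)) b (hunit k hk)
  have hJJ : ∀ A b, covVecFieldOp Xe B A (covVecFieldOp Xe B b F) k
      = F k * (w k A * w k b + Dw b ((1 + ad ((1 / 2 : ℝ) • k)
      + ad ((1 / 2 : ℝ) • k) * logDerivSinhcM (ad ((1 / 2 : ℝ) • k))) *ᵥ Pi.single A 1)) := by
    intro A b
    have h1 := covVecFieldOp_eq_of_hasFDerivAt (Xe := Xe) B A hDF
    have h2 : covVecFieldOp Xe B A F k = F k * w k A := (hJ A).eq_of_nhds
    have h3 := covVecFieldOp_eq_of_hasFDerivAt (Xe := Xe) B A (hDF.mul (hDw b))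
    rw [covVecFieldOp_congr B A (hJ b)]
    refine h3.trans ?_
    rw [← hXe k A (hunit k hk)]
    simp only [_root_.add_apply, _root_.smul_apply, smul_eq_mul, Pi.mul_apply]
    linear_combination w k b * (h2 - h1)
  have hsym := h.casimirSymbol_eq ht hσ k (hunit k hk) (w k) fun b => rfl
  simp only [← hDwv] at hsym
  rw [covCasimirOp, ← hsym, ← sum_sum_mul_mul_add_eq]
  simp only [hJJ]
  rfl

end IsInvariantAd

end HeatEquation

section TimeDerivative

variable {n : Type*} [Fintype n]

theorem dotProduct_mul_mulVec_eq_trace (γ P : Matrix n n ℝ) (k : n → ℝ) :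
    k ⬝ᵥ (γ * P) *ᵥ k = (P * (vecMulVec k k * γ)).trace := by
  rw [← mul_assoc, trace_mul_comm, ← mul_assoc, mul_vecMulVec, trace_vecMulVec, dotProduct_comm]

variable [DecidableEq n]

theorem hasDerivAt_gaussian_time (γ β : Matrix n n ℝ) (k : n → ℝ) {δ : ℝ} (r : ℝ) {t : ℝ}
    (ht : 0 < t) (hσ : 0 < δ * (sinhcM (t • β)).det) :
    HasDerivAt (fun s => (4 * Real.pi * s) ^ (-(Fintype.card n : ℝ) / 2)
        * (δ * (sinhcM (s • β)).det) ^ (-(1 : ℝ) / 2)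
        * Real.exp (-(1 / 4) * (k ⬝ᵥ (γ * cothM s β) *ᵥ k) + r * s))
      ((4 * Real.pi * t) ^ (-(Fintype.card n : ℝ) / 2)
        * (δ * (sinhcM (t • β)).det) ^ (-(1 : ℝ) / 2)
        * Real.exp (-(1 / 4) * (k ⬝ᵥ (γ * cothM t β) *ᵥ k) + r * t)
        * (-(1 / 2) * (cothM t β).trace
          - 1 / 4 * (k ⬝ᵥ (γ * (β * β - cothM t β * cothM t β)) *ᵥ k) + r)) t := by
  have hu : IsUnit (sinhcM (t • β)) :=
    (Matrix.isUnit_iff_isUnit_det _).2 (right_ne_zero_of_mul hσ.ne').isUnit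
  have hδ : δ ≠ 0 := left_ne_zero_of_mul hσ.ne'
  have hdet : (sinhcM (t • β)).det ≠ 0 := right_ne_zero_of_mul hσ.ne'
  have hpi : 0 < 4 * Real.pi * t := by positivity
  have h1 := ((hasDerivAt_id t).const_mul (4 * Real.pi)).rpow_const
    (p := -(Fintype.card n : ℝ) / 2) (Or.inl hpi.ne')
  have h2 := ((hasDerivAt_det_sinhcM_smul ht.ne' hu).const_mul δ).rpow_const
    (p := -(1 : ℝ) / 2) (Or.inl hσ.ne')
  have h3 := (((hasDerivAt_trace_cothM_mul ht.ne' hu (vecMulVec k k * γ)).const_mul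
    (-(1 / 4) : ℝ)).add ((hasDerivAt_id t).const_mul r)).exp
  simp only [dotProduct_mul_mulVec_eq_trace]
  refine ((h1.mul h2).mul h3).congr_deriv ?_
  simp only [id, Pi.add_apply, Pi.mul_apply, Real.rpow_sub_one hpi.ne', Real.rpow_sub_one hσ.ne']
  have hp := Real.pi_ne_zero
  have ht' := ht.ne'
  field_simp
  ring

end TimeDerivative

theorem isInvariantAd_linearCombination {N : ℕ} {C : Fin N → Fin N → Fin N → ℝ}
    (hCanti : ∀ A B C', C A B C' = -C A C' B) {CM : Fin N → Matrix (Fin N) (Fin N) ℝ}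
    (hCM : ∀ A B C', CM A B C' = C B A C')
    (hCC : ∀ A B, CM A * CM B - CM B * CM A = ∑ C', C C' A B • CM C')
    {γ : Matrix (Fin N) (Fin N) ℝ} (hγsymm : γᵀ = γ) (hγinv : IsUnit γ)
    (hγC : ∀ A C' D', ∑ B, (γ A B * C B C' D' + γ D' B * C B C' A) = 0)
    {B : Matrix (Fin N) (Fin N) ℝ} (hBanti : Bᵀ = -B)
    (hCB : ∀ B' C' D', ∑ A, C A B' C' * B A D' = 0) :
    IsInvariantAd (Fintype.linearCombination ℝ CM) γ B where
  mulVec_comm v w := by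
    ext b
    simp only [Fintype.linearCombination_apply, mulVec, dotProduct, Matrix.sum_apply,
      Matrix.smul_apply, Pi.neg_apply, Finset.sum_mul, hCM, smul_eq_mul]
    rw [Finset.sum_comm, ← Finset.sum_neg_distrib]
    refine Finset.sum_congr rfl fun a _ => ?_
    rw [← Finset.sum_neg_distrib]
    refine Finset.sum_congr rfl fun c _ => ?_
    rw [hCanti]
    ring
  ad_mulVec v w := by
    have h1 : ∀ A, Fintype.linearCombination ℝ CM v * CM A - CM A * Fintype.linearCombination ℝ CM v
        = Fintype.linearCombination ℝ CM ((Fintype.linearCombination ℝ CM v).col A) := by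
      intro A
      simp only [Fintype.linearCombination_apply, Finset.sum_mul, Finset.mul_sum, smul_mul_assoc,
        mul_smul_comm, ← Finset.sum_sub_distrib, ← smul_sub, hCC, col_apply, Matrix.sum_apply,
        Matrix.smul_apply, hCM, Finset.smul_sum, Finset.sum_smul, smul_assoc]
      exact Finset.sum_comm
    have h2 : Fintype.linearCombination ℝ CM v *ᵥ w
        = ∑ A, w A • (Fintype.linearCombination ℝ CM v).col A := by
      ext b
      simp [mulVec, dotProduct, mul_comm]
    rw [h2, map_sum]
    simp only [map_smul, ← h1]
    rw [Fintype.linearCombination_apply ℝ CM w]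
    simp only [smul_sub, Finset.sum_sub_distrib, Finset.mul_sum, Finset.sum_mul, mul_smul_comm,
      smul_mul_assoc]
  symm := hγsymm
  isUnit := hγinv
  mul_ad v := by
    have h1 : ∀ A, γ * CM A = -((CM A)ᵀ * γ) := by
      intro A
      ext i j
      have h2 := hγC i A j
      rw [Finset.sum_add_distrib] at h2
      have h3 : ∀ x, γ x j = γ j x := fun x => congr_fun (congr_fun hγsymm j) x
      simp only [mul_apply, Matrix.neg_apply, transpose_apply, hCM, h3, mul_comm (C _ A i)]
      linarith
    simp only [Fintype.linearCombination_apply, Finset.mul_sum, transpose_sum, transpose_smul,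
      Finset.sum_mul, mul_smul_comm, smul_mul_assoc, h1, smul_neg, Finset.sum_neg_distrib]
  skew := hBanti
  transpose_ad_mul v := by
    have h1 : ∀ A, (CM A)ᵀ * B = 0 := by
      intro A
      ext i j
      simp [mul_apply, hCM, hCB]
    simp [Fintype.linearCombination_apply, transpose_sum, Finset.sum_mul, h1]

theorem sum_structureConstants_eq_sum_trace {N : ℕ} {C : Fin N → Fin N → Fin N → ℝ}
    {CM : Fin N → Matrix (Fin N) (Fin N) ℝ} (hCM : ∀ A B C', CM A B C' = C B A C')
    (γ' : Matrix (Fin N) (Fin N) ℝ) :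
    ∑ A, ∑ B', ∑ C', ∑ D', γ' A B' * C C' A D' * C D' B' C'
      = ∑ b, (Fintype.linearCombination ℝ CM (Pi.single b 1)
          * Fintype.linearCombination ℝ CM (γ' *ᵥ Pi.single b 1)).trace := by
  rw [Finset.sum_comm]
  refine Finset.sum_congr rfl fun b _ => ?_
  rw [Fintype.linearCombination_apply_single, one_smul, Fintype.linearCombination_apply,
    Finset.mul_sum, trace_sum]
  refine Finset.sum_congr rfl fun a _ => ?_
  rw [mul_smul_comm, trace_smul, trace_mul_comm, smul_eq_mul, mulVec_single_one, col_apply]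
  simp only [trace, diag_apply, mul_apply, hCM, Finset.mul_sum, mul_assoc]

/-- The function
`Φ(t;k) = (4πt)^{-N/2} (det sinhc(C(k)/2 + t𝓑))^{-1/2} exp(−Θ(t;k)/(2t) + R_G t/6)`
satisfies the heat equation `∂_t Φ = J² Φ` on `Ω`. -/
theorem Phi_satisfies_heat_equation
    (N : ℕ)
    (C : Fin N → Fin N → Fin N → ℝ)
    (hCanti : ∀ A B C', C A B C' = -C A C' B)
    (CM : Fin N → Matrix (Fin N) (Fin N) ℝ)
    (hCM : ∀ A B C', CM A B C' = C B A C')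
    (hCC : ∀ A B, CM A * CM B - CM B * CM A = ∑ C', C C' A B • CM C')
    (γ : Matrix (Fin N) (Fin N) ℝ)
    (hγsymm : γᵀ = γ) (hγinv : IsUnit γ)
    (hγC : ∀ A C' D', ∑ B, (γ A B * C B C' D' + γ D' B * C B C' A) = 0)
    (B : Matrix (Fin N) (Fin N) ℝ)
    (hBanti : Bᵀ = -B)
    (hCB : ∀ B' C' D', ∑ A, C A B' C' * B A D' = 0)
    (𝓑 : Matrix (Fin N) (Fin N) ℝ)
    (h𝓑 : 𝓑 = γ⁻¹ * B)
    (Ck : (Fin N → ℝ) → Matrix (Fin N) (Fin N) ℝ)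
    (hCk : ∀ k, Ck k = ∑ A, k A • CM A)
    (Y : (Fin N → ℝ) → Matrix (Fin N) (Fin N) ℝ)
    (hY : ∀ k, Y k =
      ∑' j : ℕ, ((-1 : ℝ) ^ j / (Nat.factorial (j + 1))) • (Ck k) ^ j)
    (U : Set (Fin N → ℝ))
    (hU : U = {k | IsUnit (Y k)})
    (Xe : (Fin N → ℝ) → Fin N → Fin N → ℝ)
    (hXe : ∀ k A M, Xe k A M = (Y k)⁻¹ M A)
    -- the scalar curvature of the group, the quadratic form Θ and the function Φ
    (R_G : ℝ)
    (hRG : R_G = -(1/4 : ℝ) * ∑ A, ∑ B', ∑ C', ∑ D', γ⁻¹ A B' * C C' A D' * C D' B' C')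
    (Θ : ℝ → (Fin N → ℝ) → ℝ)
    (hΘ : ∀ t k, Θ t k = (1/2 : ℝ) * ∑ A, ∑ B', ∑ C',
        k A * γ A B' * (matCosh (t • 𝓑) * (matSinhc (t • 𝓑))⁻¹) B' C' * k C')
    (Φ : ℝ → (Fin N → ℝ) → ℝ)
    (hΦ : ∀ t k, Φ t k =
        (4 * Real.pi * t) ^ (-(N : ℝ) / 2) *
        ((matSinhc ((1/2 : ℝ) • Ck k + t • 𝓑)).det) ^ (-(1 : ℝ) / 2) *
        Real.exp (-(Θ t k) / (2 * t) + R_G * t / 6))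
    (Ω : Set (ℝ × (Fin N → ℝ)))
    (hΩ : Ω = {q | 0 < q.1 ∧ q.2 ∈ U ∧ IsUnit (matSinhc (q.1 • 𝓑)) ∧
        0 < (matSinhc ((1/2 : ℝ) • Ck q.2 + q.1 • 𝓑)).det}) :
    ∀ q ∈ Ω, deriv (fun s => Φ s q.2) q.1 = covCasimirOp γ⁻¹ Xe B (fun k => Φ q.1 k) q.2 := by
  rintro ⟨t, k⟩ hq
  rw [hΩ] at hq
  obtain ⟨ht, -, hσ, hdet⟩ := hq
  dsimp only at ht hσ hdet ⊢
  have h := isInvariantAd_linearCombination hCanti hCM hCC hγsymm hγinv hγC hBanti hCB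
  set ad := Fintype.linearCombination ℝ CM with had
  have hCk' : ∀ k, Ck k = ad k := fun k => by rw [hCk, had, Fintype.linearCombination_apply]
  have hprod : ∀ (s : ℝ) (k : Fin N → ℝ), matSinhc ((1 / 2 : ℝ) • Ck k + s • 𝓑)
      = sinhcM (ad ((1 / 2 : ℝ) • k)) * sinhcM (s • (γ⁻¹ * B)) := by
    intro s k
    rw [matSinhc_eq, hCk', ← map_smul, h𝓑, sinhcM_add_of_mul_eq_zero]
    · rw [mul_smul_comm, h.ad_mul_inv_mul, smul_zero]
    · rw [smul_mul_assoc, h.inv_mul_mul_ad, smul_zero]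
  rw [matSinhc_eq, h𝓑] at hσ
  rw [hprod, det_mul] at hdet
  have hΘ' : ∀ s k, s ≠ 0 → -(Θ s k) / (2 * s)
      = -(1 / 4) * (k ⬝ᵥ (γ * cothM s (γ⁻¹ * B)) *ᵥ k) := by
    intro s k hs
    have h1 : ∀ P : Matrix (Fin N) (Fin N) ℝ,
        ∑ A, ∑ B', ∑ C', k A * γ A B' * P B' C' * k C' = k ⬝ᵥ (γ * P) *ᵥ k := by
      intro P
      rw [← mulVec_mulVec]
      simp only [dotProduct, mulVec, Finset.mul_sum, mul_assoc]
    rw [hΘ, h1, cothM, matCosh_eq, matSinhc_eq, h𝓑, mul_smul_comm, smul_mulVec, dotProduct_smul,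
      smul_eq_mul]
    field_simp
    ring
  have hΦ' : ∀ s k, s ≠ 0 → Φ s k = (4 * Real.pi * s) ^ (-(N : ℝ) / 2)
      * ((sinhcM (ad ((1 / 2 : ℝ) • k))).det * (sinhcM (s • (γ⁻¹ * B))).det) ^ (-(1 : ℝ) / 2)
      * Real.exp (-(1 / 4) * (k ⬝ᵥ (γ * cothM s (γ⁻¹ * B)) *ᵥ k) + R_G / 6 * s) := by
    intro s k hs
    rw [hΦ, hprod, det_mul, hΘ' s k hs, mul_div_right_comm]
  have hXe' : ∀ k A, IsUnit (sinhcM (ad ((1 / 2 : ℝ) • k))) → Xe k A = (1 + ad ((1 / 2 : ℝ) • k)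
      + ad ((1 / 2 : ℝ) • k) * logDerivSinhcM (ad ((1 / 2 : ℝ) • k))) *ᵥ Pi.single A 1 := by
    intro k A hS
    have hYk : Y k = psEval oneSubExpNegSeries ((2 : ℝ) • ad ((1 / 2 : ℝ) • k)) := by
      rw [← map_smul, smul_smul, hY, hCk', psEval]
      norm_num [oneSubExpNegSeries]
    ext M
    rw [hXe, hYk, inv_psEval_oneSubExpNegSeries hS, mulVec_single_one, col_apply]
  have htime := hasDerivAt_gaussian_time γ (γ⁻¹ * B) k (R_G / 6) ht hdet
  rw [Fintype.card_fin] at htime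
  have hR : R_G / 6
      = -(1 / 24 * ∑ b, (ad (Pi.single b 1) * ad (γ⁻¹ *ᵥ Pi.single b 1)).trace) := by
    rw [hRG, sum_structureConstants_eq_sum_trace hCM, ← had]
    ring
  have hspace : (fun k => Φ t k) = _ := funext fun k => hΦ' t k ht.ne'
  rw [hspace, h.covCasimirOp_gaussian ht.ne' hσ hXe' _ _ hdet]
  refine HasDerivAt.deriv ((htime.congr_of_eventuallyEq ?_).congr_deriv ?_)
  · filter_upwards [lt_mem_nhds ht] with s hs
    exact hΦ' s k hs.ne'
  · congr 1
    linear_combination hR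
end

section
/- Let N ∈ ℕ and let C^A_{BC} (A,B,C = 1,…,N) be real constants, antisymmetric in the lower indices, such that the N×N matrices C_A with entries (C_A)^B_C = C^B_{AC} satisfy [C_A, C_B] = Σ_C C^C_{AB} C_C. Let γ = (γ_{AB}) be a real symmetric positive definite N×N matrix satisfying γ_{AB} C^B_{CD} + γ_{DB} C^B_{CA} = 0. Let B = (B_{AB}) be a real antisymmetric N×N matrix satisfying Σ_A C^A_{BC} B_{AD} = 0 for all B, C, D, and set 𝓑 := γ^{−1}B. For k ∈ ℝ^N set C(k) := Σ_A k^A C_A, Y(k) := Σ_{j≥0} (−1)^j C(k)^j/(j+1)!; set sinhc(X) := Σ_{j≥0} X^{2j}/(2j+1)!, cosh(X) := Σ_{j≥0} X^{2j}/(2j)!, R_G := −(1/4) Σ γ^{AB} C^C_{AD} C^D_{BC}, Θ(t;k) := (1/2) Σ k^A γ_{AB} [cosh(t𝓑)·sinhc(t𝓑)^{−1}]^B_C k^C, and Φ(t;k) := (4πt)^{−N/2} · (det sinhc(C(k)/2 + t𝓑))^{−1/2} · exp(−Θ(t;k)/(2t) + R_G t/6) wherever sinhc(t𝓑) is invertible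 and det sinhc(C(k)/2 + t𝓑) > 0. Let V be the connected component of 0 of the open set {k ∈ ℝ^N : det sinhc(C(k)/2) > 0}. Then for every continuous compactly supported function φ : ℝ^N → ℝ with support contained in V, there is ε > 0 such that Φ(t;k) is defined for all t ∈ (0,ε) and k in the support of φ, and lim_{t→0⁺} ∫_{ℝ^N} Φ(t;k) φ(k) dk = (det γ)^{−1/2} φ(0); i.e. Φ(t;·) converges as t → 0⁺ to |det γ|^{−1/2} times the Dirac delta at k = 0. -/
open Matrix MeasureTheory

section EvenPowerSeries

open scoped Matrix.Norms.Operator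

lemma Matrix.continuous_tsum_smul_pow_two_mul {n : Type*} [Fintype n] [DecidableEq n]
    {c : ℕ → ℝ} (hc : ∀ R : ℝ, Summable fun j => ‖c j‖ * R ^ (2 * j)) :
    Continuous fun X : Matrix n n ℝ => ∑' j, c j • X ^ (2 * j) := by
  have hpow : ∀ (X : Matrix n n ℝ) (m : ℕ), ‖X ^ m‖ ≤ ‖(1 : Matrix n n ℝ)‖ * ‖X‖ ^ m := by
    intro X m
    induction m with
    | zero => simp
    | succ m ih =>
      rw [pow_succ, pow_succ, ← mul_assoc]
      exact (norm_mul_le _ _).trans (by gcongr)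
  rw [continuous_iff_continuousAt]
  intro X
  refine ContinuousOn.continuousAt (s := Metric.ball 0 (‖X‖ + 1)) ?_
    (Metric.isOpen_ball.mem_nhds (by simp))
  refine continuousOn_tsum (u := fun j => ‖(1 : Matrix n n ℝ)‖ * (‖c j‖ * (‖X‖ + 1) ^ (2 * j)))
    (fun j => by fun_prop) ((hc _).mul_left _) fun j Y hY => ?_
  rw [mem_ball_zero_iff] at hY
  rw [norm_smul]
  calc ‖c j‖ * ‖Y ^ (2 * j)‖
      ≤ ‖c j‖ * (‖(1 : Matrix n n ℝ)‖ * ‖Y‖ ^ (2 * j)) := by gcongr; exact hpow _ _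
    _ ≤ ‖c j‖ * (‖(1 : Matrix n n ℝ)‖ * (‖X‖ + 1) ^ (2 * j)) := by gcongr
    _ = _ := by ring

end EvenPowerSeries

lemma continuous_matSinhc {N : ℕ} : Continuous (matSinhc (N := N)) := by
  refine Matrix.continuous_tsum_smul_pow_two_mul fun R => ?_
  have h : Summable fun j : ℕ => |R| ^ (2 * j) / (Nat.factorial (2 * j) : ℝ) :=
    (Real.summable_pow_div_factorial |R|).comp_injective
      (mul_right_injective₀ (two_ne_zero (α := ℕ)))
  refine Summable.of_norm_bounded h fun j => ?_
  rw [norm_mul, norm_norm, norm_pow, Real.norm_eq_abs R, norm_div, norm_one, RCLike.norm_natCast,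
    one_div_mul_eq_div]
  gcongr
  omega

lemma continuous_matCosh {N : ℕ} : Continuous (matCosh (N := N)) := by
  refine Matrix.continuous_tsum_smul_pow_two_mul fun R => ?_
  have h : Summable fun j : ℕ => |R| ^ (2 * j) / (Nat.factorial (2 * j) : ℝ) :=
    (Real.summable_pow_div_factorial |R|).comp_injective
      (mul_right_injective₀ (two_ne_zero (α := ℕ)))
  refine Summable.of_norm_bounded h fun j => ?_
  rw [norm_mul, norm_norm, norm_pow, Real.norm_eq_abs R, norm_div, norm_one, RCLike.norm_natCast,
    one_div_mul_eq_div]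

@[simp]
lemma matSinhc_zero {N : ℕ} : matSinhc (0 : Matrix (Fin N) (Fin N) ℝ) = 1 := by
  rw [matSinhc, tsum_eq_single 0 fun j hj => by simp [hj]]
  simp

@[simp]
lemma matCosh_zero {N : ℕ} : matCosh (0 : Matrix (Fin N) (Fin N) ℝ) = 1 := by
  rw [matCosh, tsum_eq_single 0 fun j hj => by simp [hj]]
  simp

lemma Matrix.continuousAt_inv {n : Type*} [Fintype n] [DecidableEq n] {A : Matrix n n ℝ}
    (hA : A.det ≠ 0) : ContinuousAt (fun X : Matrix n n ℝ => X⁻¹) A := by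
  simp only [Matrix.inv_def, Ring.inverse_eq_inv']
  have hdet : Continuous fun X : Matrix n n ℝ => X.det := continuous_id.matrix_det
  have hadj : Continuous fun X : Matrix n n ℝ => X.adjugate := continuous_id.matrix_adjugate
  exact (hdet.continuousAt.inv₀ hA).smul hadj.continuousAt

lemma IsCompact.exists_forall_lt_eventually {X Y : Type*} [TopologicalSpace X]
    [TopologicalSpace Y] {K : Set Y} (hK : IsCompact K) {x₀ : X} {f : X → Y → ℝ}
    (hf : ∀ y ∈ K, ContinuousAt (fun z : X × Y => f z.1 z.2) (x₀, y))
    (hpos : ∀ y ∈ K, 0 < f x₀ y) :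
    ∃ m > 0, ∀ᶠ x in nhds x₀, ∀ y ∈ K, m < f x y := by
  have hcont : ContinuousOn (f x₀) K := fun y hy =>
    (ContinuousAt.comp (f := fun y => (x₀, y)) (hf y hy) (by fun_prop)).continuousWithinAt
  obtain ⟨a, ha, hle⟩ := hK.exists_forall_le' hcont hpos
  refine ⟨a / 2, half_pos ha, hK.eventually_forall_of_forall_eventually fun y hy => ?_⟩
  exact (hf y hy).eventually (lt_mem_nhds ((half_lt_self ha).trans_le (hle y hy)))

section Gaussian

lemma integral_exp_neg_mul_dotProduct_self {n : Type*} [Fintype n] (b : ℝ) :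
    ∫ u : n → ℝ, Real.exp (-b * (u ⬝ᵥ u)) = √(Real.pi / b) ^ Fintype.card n := by
  rw [← integral_gaussian b, ← integral_fintype_prod_volume_eq_pow]
  simp only [← Real.exp_sum, dotProduct, Finset.mul_sum, pow_two]

open scoped MatrixOrder Matrix.Norms.L2Operator ComplexOrder in
lemma Matrix.PosDef.exists_eq_transpose_mul_self {n : Type*} [Fintype n] [DecidableEq n]
    {M : Matrix n n ℝ} (hM : M.PosDef) : ∃ A : Matrix n n ℝ, M = Aᵀ * A := by
  obtain ⟨A, -, rfl⟩ := CStarAlgebra.isStrictlyPositive_iff_eq_star_mul_self.mp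
    hM.isStrictlyPositive
  exact ⟨A, by simp [star_eq_conjTranspose]⟩

lemma integral_comp_mulVec {n : Type*} [Fintype n] [DecidableEq n] {A : Matrix n n ℝ}
    (hA : A.det ≠ 0) {f : (n → ℝ) → ℝ} (hf : Continuous f) :
    ∫ u, f (A *ᵥ u) = |A.det|⁻¹ * ∫ u, f u := by
  have h := integral_map (μ := volume) (φ := Matrix.toLin' A) (f := f)
    (LinearMap.continuous_of_finiteDimensional _).measurable.aemeasurable
    hf.aestronglyMeasurable
  rw [Real.map_matrix_volume_pi_eq_smul_volume_pi hA, integral_smul_measure,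
    ENNReal.toReal_ofReal (abs_nonneg _), abs_inv] at h
  simpa using h.symm

lemma integral_exp_neg_mul_quadraticForm {n : Type*} [Fintype n] [DecidableEq n]
    {M : Matrix n n ℝ} (hM : M.PosDef) (b : ℝ) :
    ∫ u : n → ℝ, Real.exp (-b * (u ⬝ᵥ M *ᵥ u)) =
      √(Real.pi / b) ^ Fintype.card n * M.det ^ (-(1 : ℝ) / 2) := by
  have hdet := hM.det_pos
  obtain ⟨A, rfl⟩ := hM.exists_eq_transpose_mul_self
  rw [Matrix.det_mul, Matrix.det_transpose, ← pow_two] at hdet ⊢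
  have hA : A.det ≠ 0 := by rintro h; simp [h] at hdet
  have hquad : ∀ u : n → ℝ, u ⬝ᵥ (Aᵀ * A) *ᵥ u = (A *ᵥ u) ⬝ᵥ (A *ᵥ u) := fun u => by
    rw [← Matrix.mulVec_mulVec, Matrix.dotProduct_mulVec, Matrix.vecMul_transpose]
  simp only [hquad]
  rw [integral_comp_mulVec hA (f := fun v => Real.exp (-b * (v ⬝ᵥ v)))
    (by unfold dotProduct; fun_prop), integral_exp_neg_mul_dotProduct_self, mul_comm]
  congr 1
  rw [neg_div, Real.rpow_neg hdet.le, ← Real.sqrt_eq_rpow, Real.sqrt_sq_eq_abs]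

lemma integrable_exp_neg_mul_norm_sq {n : Type*} [Fintype n] {b : ℝ} (hb : 0 < b) :
    Integrable fun u : n → ℝ => Real.exp (-b * ‖u‖ ^ 2) := by
  have hb' : 0 < b / (Fintype.card n + 1) := by positivity
  have hint : Integrable fun u : n → ℝ =>
      ∏ i, Real.exp (-(b / (Fintype.card n + 1)) * u i ^ 2) :=
    Integrable.fintype_prod (f := fun _ x => Real.exp (-(b / (Fintype.card n + 1)) * x ^ 2))
      fun _ => integrable_exp_neg_mul_sq hb'
  refine hint.mono' (by fun_prop) (.of_forall fun u => ?_)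
  rw [Real.norm_eq_abs, Real.abs_exp, ← Real.exp_sum, ← Finset.mul_sum, Real.exp_le_exp,
    neg_mul, neg_mul, neg_le_neg_iff, div_mul_eq_mul_div, div_le_iff₀ (by positivity), mul_assoc]
  gcongr
  calc ∑ i, u i ^ 2 ≤ ∑ _i : n, ‖u‖ ^ 2 := by
        refine Finset.sum_le_sum fun i _ => ?_
        exact sq_le_sq' (neg_le_of_abs_le (norm_le_pi_norm u i))
          (le_of_abs_le (norm_le_pi_norm u i))
    _ ≤ ‖u‖ ^ 2 * (Fintype.card n + 1) := by
        rw [Finset.sum_const, Finset.card_univ, nsmul_eq_mul]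
        nlinarith [sq_nonneg ‖u‖]

end Gaussian

lemma Matrix.PosDef.eventually_mul_norm_sq_le {n X : Type*} [Fintype n]
    [TopologicalSpace X] {P : X → Matrix n n ℝ} {x₀ : X} (hP : ContinuousAt P x₀)
    (hpos : (P x₀).PosDef) :
    ∃ m > 0, ∀ᶠ x in nhds x₀, ∀ u : n → ℝ, m * ‖u‖ ^ 2 ≤ u ⬝ᵥ P x *ᵥ u := by
  have hcont : ∀ y : n → ℝ,
      ContinuousAt (fun z : X × (n → ℝ) => z.2 ⬝ᵥ P z.1 *ᵥ z.2) (x₀, y) := by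
    intro y
    have hQ : Continuous fun w : Matrix n n ℝ × (n → ℝ) => w.2 ⬝ᵥ w.1 *ᵥ w.2 := by fun_prop
    have hPz : ContinuousAt (fun z : X × (n → ℝ) => P z.1) (x₀, y) :=
      ContinuousAt.comp (f := Prod.fst) hP continuousAt_fst
    exact ContinuousAt.comp (f := fun z : X × (n → ℝ) => (P z.1, z.2)) hQ.continuousAt
      (hPz.prodMk continuousAt_snd)
  obtain ⟨m, hm, hev⟩ := (isCompact_sphere (0 : n → ℝ) 1).exists_forall_lt_eventually
    (f := fun x u => u ⬝ᵥ P x *ᵥ u) (fun y _ => hcont y) fun y hy => by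
      simpa using hpos.dotProduct_mulVec_pos (x := y) (by rintro rfl; simp at hy)
  refine ⟨m, hm, hev.mono fun x hx u => ?_⟩
  rcases eq_or_ne u 0 with rfl | hu
  · simp
  have hnorm : 0 < ‖u‖ := norm_pos_iff.2 hu
  have h := hx (‖u‖⁻¹ • u) (by simp [norm_smul, hnorm.ne'])
  simp only [Matrix.mulVec_smul, dotProduct_smul, smul_dotProduct, smul_eq_mul] at h
  rw [← mul_assoc, ← mul_inv, inv_mul_eq_div, lt_div_iff₀ (by positivity), ← pow_two] at h
  exact h.le

/-- Heat-kernel type functions with continuous positive Van Vleck determinant `D` and quadratic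
phase `P` converge to a multiple of the Dirac delta as `t → 0⁺`. -/
lemma tendsto_integral_heatKernel {n : Type*} [Fintype n] [DecidableEq n]
    {D : ℝ → (n → ℝ) → ℝ} (hD : Continuous fun z : ℝ × (n → ℝ) => D z.1 z.2) (hD0 : D 0 0 = 1)
    {P : ℝ → Matrix n n ℝ} (hP : ContinuousAt P 0) (hP0 : (P 0).PosDef) (r : ℝ)
    {φ : (n → ℝ) → ℝ} (hφ : Continuous φ) (hφc : HasCompactSupport φ)
    (hpos : ∀ k ∈ tsupport φ, 0 < D 0 k) :
    Filter.Tendsto (fun t : ℝ => ∫ k, (4 * Real.pi * t) ^ (-(Fintype.card n : ℝ) / 2) *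
        D t k ^ (-(1 : ℝ) / 2) *
        Real.exp (-((1 / 2 : ℝ) * (k ⬝ᵥ P t *ᵥ k)) / (2 * t) + r * t) * φ k)
      (nhdsWithin 0 (Set.Ioi 0)) (nhds ((P 0).det ^ (-(1 : ℝ) / 2) * φ 0)) := by
  have hπ := Real.pi_pos
  set a : ℝ := (4 * Real.pi) ^ (-(Fintype.card n : ℝ) / 2) with ha
  have ha0 : 0 < a := by positivity
  obtain ⟨d, hd, hDd⟩ := hφc.exists_forall_lt_eventually (f := D)
    (fun k _ => hD.continuousAt) hpos
  obtain ⟨m, hm, hPm⟩ := Matrix.PosDef.eventually_mul_norm_sq_le hP hP0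
  obtain ⟨S, hS⟩ := hφ.bounded_above_of_compact_support hφc
  have hS0 : 0 ≤ S := (norm_nonneg _).trans (hS 0)
  set F : ℝ → (n → ℝ) → ℝ := fun t u => a * D t (√t • u) ^ (-(1 : ℝ) / 2) *
    Real.exp (-(1 / 4) * (u ⬝ᵥ P t *ᵥ u) + r * t) * φ (√t • u) with hF
  have hscale : ∀ t : ℝ, 0 < t → ∫ k, (4 * Real.pi * t) ^ (-(Fintype.card n : ℝ) / 2) *
      D t k ^ (-(1 : ℝ) / 2) * Real.exp (-((1 / 2 : ℝ) * (k ⬝ᵥ P t *ᵥ k)) / (2 * t) + r * t) *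
      φ k = ∫ u, F t u := by
    intro t ht
    have hst : 0 < √t := Real.sqrt_pos.2 ht
    have hpow : (4 * Real.pi * t) ^ (-(Fintype.card n : ℝ) / 2) =
        a * (√t ^ Fintype.card n)⁻¹ := by
      rw [Real.mul_rpow (by positivity) ht.le, Real.sqrt_eq_rpow, ← Real.rpow_natCast,
        ← Real.rpow_mul ht.le, ← Real.rpow_neg ht.le]
      congr 2
      ring
    have h := Measure.integral_comp_smul_of_nonneg (μ := (volume : Measure (n → ℝ)))
      (fun k => a * D t k ^ (-(1 : ℝ) / 2) *
        Real.exp (-((1 / 2 : ℝ) * (k ⬝ᵥ P t *ᵥ k)) / (2 * t) + r * t) * φ k) √t (hR := hst.le)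
    rw [Module.finrank_fintype_fun_eq_card, smul_eq_mul, ← integral_const_mul] at h
    calc _ = _ := by
          refine Eq.trans ?_ h.symm
          congr 1 with k
          rw [hpow]
          ring
      _ = _ := by
          congr 1 with u
          simp only [hF, Matrix.mulVec_smul, dotProduct_smul, smul_dotProduct, smul_eq_mul]
          congr 4
          rw [← mul_assoc √t, Real.mul_self_sqrt ht.le]
          field_simp
          ring
  have hlim : Filter.Tendsto (fun t => ∫ u, F t u) (nhdsWithin 0 (Set.Ioi 0))
      (nhds (∫ u, a * Real.exp (-(1 / 4) * (u ⬝ᵥ P 0 *ᵥ u)) * φ 0)) := by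
    refine tendsto_integral_filter_of_dominated_convergence
      (fun u => a * d ^ (-(1 : ℝ) / 2) * Real.exp |r| * S * Real.exp (-(m / 4) * ‖u‖ ^ 2))
      (.of_forall fun t => ?_) ?_ ((integrable_exp_neg_mul_norm_sq (by positivity)).const_mul _)
      (.of_forall fun u => ?_)
    · have hDt : Continuous fun u : n → ℝ => D t (√t • u) :=
        hD.comp (f := fun u : n → ℝ => (t, √t • u)) (by fun_prop)
      have hexp : Continuous fun u : n → ℝ =>
        Real.exp (-(1 / 4) * (u ⬝ᵥ P t *ᵥ u) + r * t) := by fun_prop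
      have hφt : Continuous fun u : n → ℝ => φ (√t • u) := by fun_prop
      exact (((hDt.measurable.pow_const _).const_mul a).mul hexp.measurable |>.mul
        hφt.measurable).aestronglyMeasurable
    · filter_upwards [nhdsWithin_le_nhds hDd, nhdsWithin_le_nhds hPm, self_mem_nhdsWithin,
        nhdsWithin_le_nhds (Iio_mem_nhds zero_lt_one)] with t hDt hPt (ht : 0 < t) (ht1 : t < 1)
      refine .of_forall fun u => ?_
      by_cases hu : √t • u ∈ tsupport φ
      · have hDu := hDt _ hu
        have hDu0 := hd.trans hDu
        have hrt : r * t ≤ |r| :=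
          (le_abs_self _).trans (by
            rw [abs_mul, abs_of_pos ht]; exact mul_le_of_le_one_right (abs_nonneg r) ht1.le)
        have hexp : Real.exp (-(1 / 4) * (u ⬝ᵥ P t *ᵥ u) + r * t) ≤
            Real.exp |r| * Real.exp (-(m / 4) * ‖u‖ ^ 2) := by
          rw [← Real.exp_add, Real.exp_le_exp]
          linarith [hPt u]
        have hrpow : D t (√t • u) ^ (-(1 : ℝ) / 2) ≤ d ^ (-(1 : ℝ) / 2) :=
          Real.rpow_le_rpow_of_nonpos hd hDu.le (by norm_num)
        rw [norm_mul, Real.norm_of_nonneg (by positivity)]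
        calc _ ≤ a * d ^ (-(1 : ℝ) / 2) * (Real.exp |r| * Real.exp (-(m / 4) * ‖u‖ ^ 2)) * S := by
              gcongr
              exact hS _
          _ = _ := by ring
      · rw [hF]
        simp only [image_eq_zero_of_notMem_tsupport hu, mul_zero, norm_zero]
        positivity
    · have hsmul : ContinuousAt (fun t : ℝ => √t • u) 0 := by fun_prop
      have hφt : ContinuousAt (fun t : ℝ => φ (√t • u)) 0 := by fun_prop
      have hDt : ContinuousAt (fun t : ℝ => D t (√t • u)) 0 :=
        (hD.comp (f := fun t : ℝ => (t, √t • u)) (by fun_prop)).continuousAt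
      have hQ : Continuous fun M : Matrix n n ℝ => u ⬝ᵥ M *ᵥ u := by fun_prop
      have hQt : ContinuousAt (fun t : ℝ => u ⬝ᵥ P t *ᵥ u) 0 :=
        ContinuousAt.comp (f := P) hQ.continuousAt hP
      have hFt : ContinuousAt (fun t => F t u) 0 :=
        ((continuousAt_const.mul (hDt.rpow_const (Or.inl (by simp [hD0])))).mul
          ((hQt.const_mul _).add (continuousAt_id.const_mul r)).rexp).mul hφt
      have := hFt.tendsto.mono_left (nhdsWithin_le_nhds (s := Set.Ioi 0))
      simpa [hF, hD0] using this
  have hval : ∫ u, a * Real.exp (-(1 / 4) * (u ⬝ᵥ P 0 *ᵥ u)) * φ 0 =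
      (P 0).det ^ (-(1 : ℝ) / 2) * φ 0 := by
    have hnorm : a * √(Real.pi / (1 / 4)) ^ Fintype.card n = 1 := by
      rw [show Real.pi / (1 / 4) = 4 * Real.pi by ring, ha, Real.sqrt_eq_rpow,
        ← Real.rpow_natCast, ← Real.rpow_mul (by positivity), ← Real.rpow_add (by positivity)]
      rw [show -(Fintype.card n : ℝ) / 2 + 1 / 2 * Fintype.card n = 0 by ring, Real.rpow_zero]
    rw [integral_mul_const, integral_const_mul, integral_exp_neg_mul_quadraticForm hP0,
      ← mul_assoc, hnorm, one_mul]
  rw [← hval]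
  refine hlim.congr' ?_
  filter_upwards [self_mem_nhdsWithin] with t ht using (hscale t ht).symm

/-- As `t → 0⁺`, the function `Φ(t;·)` converges to `(det γ)^{-1/2}` times the
Dirac delta at `k = 0`: for every continuous compactly supported `φ` with support in `V`,
`∫ Φ(t;k) φ(k) dk → (det γ)^{-1/2} φ(0)`. -/
theorem Phi_initial_condition
    (N : ℕ)
    (C : Fin N → Fin N → Fin N → ℝ)
    (hCanti : ∀ A B C', C A B C' = -C A C' B)
    (CM : Fin N → Matrix (Fin N) (Fin N) ℝ)
    (hCM : ∀ A B C', CM A B C' = C B A C')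
    (hCC : ∀ A B, CM A * CM B - CM B * CM A = ∑ C', C C' A B • CM C')
    (γ : Matrix (Fin N) (Fin N) ℝ)
    (hγpos : γ.PosDef) (hγsymm : γᵀ = γ)
    (hγC : ∀ A C' D', ∑ B, (γ A B * C B C' D' + γ D' B * C B C' A) = 0)
    (B : Matrix (Fin N) (Fin N) ℝ)
    (hBanti : Bᵀ = -B)
    (hCB : ∀ B' C' D', ∑ A, C A B' C' * B A D' = 0)
    (𝓑 : Matrix (Fin N) (Fin N) ℝ)
    (h𝓑 : 𝓑 = γ⁻¹ * B)
    (Ck : (Fin N → ℝ) → Matrix (Fin N) (Fin N) ℝ)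
    (hCk : ∀ k, Ck k = ∑ A, k A • CM A)
    (R_G : ℝ)
    (hRG : R_G = -(1/4 : ℝ) * ∑ A, ∑ B', ∑ C', ∑ D', γ⁻¹ A B' * C C' A D' * C D' B' C')
    (Θ : ℝ → (Fin N → ℝ) → ℝ)
    (hΘ : ∀ t k, Θ t k = (1/2 : ℝ) * ∑ A, ∑ B', ∑ C',
        k A * γ A B' * (matCosh (t • 𝓑) * (matSinhc (t • 𝓑))⁻¹) B' C' * k C')
    (Φ : ℝ → (Fin N → ℝ) → ℝ)
    (hΦ : ∀ t k, Φ t k =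
        (4 * Real.pi * t) ^ (-(N : ℝ) / 2) *
        ((matSinhc ((1/2 : ℝ) • Ck k + t • 𝓑)).det) ^ (-(1 : ℝ) / 2) *
        Real.exp (-(Θ t k) / (2 * t) + R_G * t / 6))
    (V : Set (Fin N → ℝ))
    (hV : V = connectedComponentIn {k | 0 < (matSinhc ((1/2 : ℝ) • Ck k)).det} 0) :
    ∀ φ : (Fin N → ℝ) → ℝ, Continuous φ → HasCompactSupport φ → tsupport φ ⊆ V →
      ∃ ε > 0,
        (∀ t : ℝ, 0 < t → t < ε → IsUnit (matSinhc (t • 𝓑)) ∧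
          ∀ k ∈ tsupport φ, 0 < (matSinhc ((1/2 : ℝ) • Ck k + t • 𝓑)).det) ∧
        Filter.Tendsto (fun t : ℝ => ∫ k : Fin N → ℝ, Φ t k * φ k)
          (nhdsWithin 0 (Set.Ioi 0)) (nhds (γ.det ^ (-(1 : ℝ) / 2) * φ 0)) := by
  intro φ hφ hφc hφV
  have hCkcont : Continuous Ck := by
    rw [funext hCk]
    fun_prop
  have hCk0 : Ck 0 = 0 := by simp [hCk]
  have hD : Continuous fun z : ℝ × (Fin N → ℝ) =>
      (matSinhc ((1 / 2 : ℝ) • Ck z.2 + z.1 • 𝓑)).det :=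
    (continuous_matSinhc.comp (by fun_prop)).matrix_det
  have hpos : ∀ k ∈ tsupport φ, 0 < (matSinhc ((1 / 2 : ℝ) • Ck k + (0 : ℝ) • 𝓑)).det := by
    intro k hk
    have := connectedComponentIn_subset _ _ (hV ▸ hφV hk)
    simpa using this
  have hsinhc : Continuous fun t : ℝ => matSinhc (t • 𝓑) := continuous_matSinhc.comp (by fun_prop)
  have hcosh : Continuous fun t : ℝ => matCosh (t • 𝓑) := continuous_matCosh.comp (by fun_prop)
  have hP : ContinuousAt (fun t : ℝ => γ * (matCosh (t • 𝓑) * (matSinhc (t • 𝓑))⁻¹)) 0 := by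
    have hinv : ContinuousAt (fun t : ℝ => (matSinhc (t • 𝓑))⁻¹) 0 :=
      ContinuousAt.comp (f := fun t : ℝ => matSinhc (t • 𝓑))
        (Matrix.continuousAt_inv (by simp)) hsinhc.continuousAt
    exact continuousAt_const.mul (hcosh.continuousAt.mul hinv)
  have hΘ' : ∀ t k, Θ t k = (1 / 2 : ℝ) *
      (k ⬝ᵥ (γ * (matCosh (t • 𝓑) * (matSinhc (t • 𝓑))⁻¹)) *ᵥ k) := by
    intro t k
    rw [hΘ, ← Matrix.mulVec_mulVec]
    simp only [dotProduct, Matrix.mulVec, Finset.mul_sum, mul_assoc]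
  have hD0 : (matSinhc ((1 / 2 : ℝ) • Ck 0 + (0 : ℝ) • 𝓑)).det = 1 := by simp [hCk0]
  have hP0 : (γ * (matCosh ((0 : ℝ) • 𝓑) * (matSinhc ((0 : ℝ) • 𝓑))⁻¹)).PosDef := by
    simpa using hγpos
  obtain ⟨d, hd, hDd⟩ := hφc.exists_forall_lt_eventually
    (f := fun t k => (matSinhc ((1 / 2 : ℝ) • Ck k + t • 𝓑)).det)
    (fun k _ => hD.continuousAt) hpos
  have hunit : ∀ᶠ t : ℝ in nhds 0, (matSinhc (t • 𝓑)).det ≠ 0 :=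
    hsinhc.matrix_det.continuousAt.eventually_ne (by simp)
  obtain ⟨ε, hε, hball⟩ := Metric.eventually_nhds_iff.1 (hDd.and hunit)
  refine ⟨ε, hε, fun t ht htε => ?_, ?_⟩
  · have h := hball (y := t) (by simpa [abs_of_pos ht] using htε)
    exact ⟨(Matrix.isUnit_iff_isUnit_det _).2 h.2.isUnit, fun k hk => hd.trans (h.1 k hk)⟩
  · have h := tendsto_integral_heatKernel (n := Fin N)
      (D := fun t k => (matSinhc ((1 / 2 : ℝ) • Ck k + t • 𝓑)).det) hD hD0 hP
      hP0 (R_G / 6) hφ hφc hpos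
    simpa [hΦ, hΘ', div_mul_eq_mul_div] using h
end
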